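/- Among all rhombic lattices (real invariants g₂, g₃ with g₂³ − 27g₃² < 0, half-periods ω₁ ∈ (0,∞), Re ω₃ = ω₁/2, Im ω₃ > 0) there is, up to scaling, exactly one exceptional elliptic curve 𝓔* for which the non-degeneracy conditions η₁ + ω₁e_j ≠ 0 (j = 1,2,3) are violated; it is uniquely determined by the condition η₁ + ω₁e₁ = 0. For this curve the spectrum of the m = 1 complex Lamé operator with ω = ω₁ has a tripod structure: it is the union of three simple regular analytic arcs joined at one point at angles 2π/3. The same curve is the bifurcation point for the non-singularity condition, separating the rhombic cases with intersecting spectral arcs from those with non-intersecting arcs. -/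

import Mathlib

open Complex Set Filter

noncomputable section

/-- The period lattice with half-periods `w1`, `w3`, i.e. the set of all
`2 m w1 + 2 n w3` with `m n : ℤ`. -/
def latticeSet (w1 w3 : ℂ) : Set ℂ := {z | ∃ m n : ℤ, z = 2 * m * w1 + 2 * n * w3}

/-- Weierstrass data for a lattice `𝓛` with basic half-periods `w1`, `w3`:
the functions `℘` (denoted `P`), `ζ` (denoted `Z`) and `σ` (denoted `S`),
characterized up to uniqueness by their standard analytic properties:
`℘` is `𝓛`-periodic, holomorphic off `𝓛`, with `℘(z) - 1/z² → 0` as `z → 0`;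
`ζ` is odd with `ζ' = -℘`; `σ` is entire, non-vanishing off `𝓛`, with
`σ'/σ = ζ` and `σ(z)/z → 1` as `z → 0`. -/
structure WeierstrassData where
  w1 : ℂ
  w3 : ℂ
  P : ℂ → ℂ
  Z : ℂ → ℂ
  S : ℂ → ℂ
  w1_ne : w1 ≠ 0
  indep : ∀ r : ℝ, w3 ≠ (r : ℂ) * w1
  P_diff : ∀ z ∉ latticeSet w1 w3, DifferentiableAt ℂ P z
  P_periodic : ∀ w ∈ latticeSet w1 w3, ∀ z, P (z + w) = P z
  P_pole : Tendsto (fun z => P z - 1 / z ^ 2) (nhdsWithin 0 {(0 : ℂ)}ᶜ) (nhds 0)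
  Z_diff : ∀ z ∉ latticeSet w1 w3, DifferentiableAt ℂ Z z
  Z_deriv : ∀ z ∉ latticeSet w1 w3, deriv Z z = -P z
  Z_odd : ∀ z, Z (-z) = -Z z
  S_diff : Differentiable ℂ S
  S_ne : ∀ z ∉ latticeSet w1 w3, S z ≠ 0
  S_deriv : ∀ z ∉ latticeSet w1 w3, deriv S z = Z z * S z
  S_norm : Tendsto (fun z => S z / z) (nhdsWithin 0 {(0 : ℂ)}ᶜ) (nhds 1)

namespace WeierstrassData

variable (W : WeierstrassData)

/-- The period lattice of `W`. -/
def lattice : Set ℂ := latticeSet W.w1 W.w3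

/-- The third basic half-period `ω₂ = ω₁ + ω₃`. -/
def w2 : ℂ := W.w1 + W.w3

/-- `e₁ = ℘(ω₁)`. -/
def e1 : ℂ := W.P W.w1
/-- `e₂ = ℘(ω₂)`. -/
def e2 : ℂ := W.P W.w2
/-- `e₃ = ℘(ω₃)`. -/
def e3 : ℂ := W.P W.w3

/-- The Rofe-Beketov spectrum of the complex Lamé operator
`L = -d²/dx² + m(m+1) ω² ℘(ωx + z₀)` in `L²(ℝ)`: the set of `λ ∈ ℂ` for which
the equation `Lψ = λψ` has a nonzero bounded solution on the whole real line. -/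
def lameSpectrum (m : ℕ) (ω z0 : ℂ) : Set ℂ :=
  {lam | ∃ φ : ℝ → ℂ, φ ≠ 0 ∧ ContDiff ℝ 2 φ ∧
    (∀ x : ℝ, -deriv (deriv φ) x + (m * (m + 1) : ℂ) * ω ^ 2 * W.P (ω * x + z0) * φ x
      = lam * φ x) ∧ ∃ C : ℝ, ∀ x : ℝ, ‖φ x‖ ≤ C}

/-- The function `u(k) = Re[η k - ω ζ(k)]`, where `η = ζ(ω)`. -/
def uFun (ω : ℂ) : ℂ → ℝ := fun k => (W.Z ω * k - ω * W.Z k).re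

/-- The function `v(k) = Im[η k - ω ζ(k)]`, where `η = ζ(ω)`. -/
def vFun (ω : ℂ) : ℂ → ℝ := fun k => (W.Z ω * k - ω * W.Z k).im

end WeierstrassData




/-- Rhombic normalisation of the period lattice: `ω₁ ∈ (0,∞)`,
`Re ω₃ = ω₁/2`, `Im ω₃ > 0`. -/
def WeierstrassData.IsRhombic (W : WeierstrassData) : Prop :=
  W.w1.im = 0 ∧ 0 < W.w1.re ∧ W.w3.re = W.w1.re / 2 ∧ 0 < W.w3.im

/-- The invariant `g₂ = -4(e₁e₂ + e₁e₃ + e₂e₃)`. -/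
def WeierstrassData.g2 (W : WeierstrassData) : ℂ :=
  -4 * (W.e1 * W.e2 + W.e1 * W.e3 + W.e2 * W.e3)

/-- The invariant `g₃ = 4e₁e₂e₃`. -/
def WeierstrassData.g3 (W : WeierstrassData) : ℂ := 4 * (W.e1 * W.e2 * W.e3)

/-- The `j`-invariant `j = 1728 g₂³/(g₂³ - 27g₃²)` of the elliptic curve. -/
def WeierstrassData.jInv (W : WeierstrassData) : ℂ :=
  1728 * W.g2 ^ 3 / (W.g2 ^ 3 - 27 * W.g3 ^ 2)

/-- The spectrum of the `m = 1` Lamé operator has a *tripod structure*: it is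
the union of three simple regular analytic arcs joined at one common point at
mutual angles `2π/3`, exactly one of the arcs extending to infinity. -/
def WeierstrassData.HasTripodSpectrum (W : WeierstrassData) (ω z0 : ℂ) : Prop :=
  ∃ c : ℂ, ∃ γ1 γ2 : ℝ → ℂ, ∃ γ3 : ℝ → ℂ,
    AnalyticOnNhd ℝ γ1 (Set.Icc 0 1) ∧ (∀ t ∈ Set.Icc (0:ℝ) 1, deriv γ1 t ≠ 0) ∧
      Set.InjOn γ1 (Set.Icc 0 1) ∧
    AnalyticOnNhd ℝ γ2 (Set.Icc 0 1) ∧ (∀ t ∈ Set.Icc (0:ℝ) 1, deriv γ2 t ≠ 0) ∧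
      Set.InjOn γ2 (Set.Icc 0 1) ∧
    AnalyticOnNhd ℝ γ3 (Set.Ici 0) ∧ (∀ t ∈ Set.Ici (0:ℝ), deriv γ3 t ≠ 0) ∧
      Set.InjOn γ3 (Set.Ici 0) ∧
    γ1 0 = c ∧ γ2 0 = c ∧ γ3 0 = c ∧
    W.lameSpectrum 1 ω z0
      = γ1 '' Set.Icc 0 1 ∪ γ2 '' Set.Icc 0 1 ∪ γ3 '' Set.Ici 0 ∧
    (γ1 '' Set.Icc 0 1) ∩ (γ2 '' Set.Icc 0 1) = {c} ∧
    (γ1 '' Set.Icc 0 1) ∩ (γ3 '' Set.Ici 0) = {c} ∧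
    (γ2 '' Set.Icc 0 1) ∩ (γ3 '' Set.Ici 0) = {c} ∧
    Filter.Tendsto (fun t => ‖γ3 t‖) Filter.atTop Filter.atTop ∧
    Bornology.IsBounded (γ1 '' Set.Icc 0 1) ∧
    Bornology.IsBounded (γ2 '' Set.Icc 0 1) ∧
    -- the three arcs meet at angles 2π/3
    (∃ d : ℂ, d ≠ 0 ∧ ∃ r1 r2 r3 : ℝ, 0 < r1 ∧ 0 < r2 ∧ 0 < r3 ∧
      deriv γ1 0 = (r1 : ℂ) * d ∧
      deriv γ2 0 = (r2 : ℂ) * (d * Complex.exp (2 * Real.pi * Complex.I / 3)) ∧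
      deriv γ3 0 = (r3 : ℂ) * (d * Complex.exp (4 * Real.pi * Complex.I / 3)))

noncomputable section

/-- Euler product `∏ (1 - Q^(n+1) X)`. -/
def eulA (Q X : ℂ) : ℂ := ∏' n : ℕ, (1 + -(Q ^ (n + 1) * X))

lemma eul_summable {Q : ℂ} (hQ : ‖Q‖ < 1) (X : ℂ) :
    Summable fun n : ℕ => ‖-(Q ^ (n + 1) * X)‖ := by
  simp only [norm_neg, norm_mul, norm_pow]
  exact ((summable_nat_add_iff 1).mpr
    (summable_geometric_of_lt_one (norm_nonneg _) hQ)).mul_right _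

lemma eul_mult {Q : ℂ} (hQ : ‖Q‖ < 1) (X : ℂ) :
    Multipliable fun n : ℕ => (1 + -(Q ^ (n + 1) * X)) :=
  multipliable_one_add_of_summable (eul_summable hQ X)

lemma eul_unif {Q : ℂ} (hQ : ‖Q‖ < 1) :
    MultipliableLocallyUniformlyOn (fun (n : ℕ) (X : ℂ) => 1 + -(Q ^ (n + 1) * X)) univ := by
  use eulA Q
  apply hasProdLocallyUniformlyOn_of_forall_compact isOpen_univ
  intro K hK hcK
  obtain ⟨M, hM⟩ := hcK.isBounded.exists_norm_le
  have hs : Summable fun n : ℕ => ‖Q‖ ^ (n + 1) * M :=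
    ((summable_nat_add_iff 1).mpr
    (summable_geometric_of_lt_one (norm_nonneg _) hQ)).mul_right _
  refine hs.hasProdUniformlyOn_nat_one_add
      hcK (.of_forall fun n x hx ↦ ?_) (fun _ ↦ by fun_prop)
  simp only [norm_neg, norm_mul, norm_pow]
  gcongr
  exact hM x hx

lemma eulA_diff {Q : ℂ} (hQ : ‖Q‖ < 1) : Differentiable ℂ (eulA Q) := by
  rw [← differentiableOn_univ]
  exact (eul_unif hQ).hasProdLocallyUniformlyOn.differentiableOn
    (.of_forall fun _ ↦ by simpa [Finset.prod_fn] using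
      DifferentiableOn.finsetProd (fun _ _ ↦ by fun_prop)) isOpen_univ

lemma eulA_ne {Q : ℂ} (hQ : ‖Q‖ < 1) {X : ℂ} (h : ∀ n : ℕ, Q ^ (n + 1) * X ≠ 1) :
    eulA Q X ≠ 0 := by
  refine tprod_one_add_ne_zero_of_summable ?_ (eul_summable hQ X)
  intro i hi
  exact h i (by linear_combination -hi)

lemma eulA_fun {Q : ℂ} (hQ : ‖Q‖ < 1) (X : ℂ) :
    eulA Q X = (1 - Q * X) * eulA Q (Q * X) := by
  unfold eulA
  rw [tprod_eq_zero_mul']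
  · congr 1
    · simp; ring
    · congr 1; ext n; ring
  · convert eul_mult hQ (Q * X) using 2
    ring

lemma eulA_conj (Q X : ℂ) (hQ : (starRingEnd ℂ) Q = Q) :
    (starRingEnd ℂ) (eulA Q X) = eulA Q ((starRingEnd ℂ) X) := by
  unfold eulA
  have := (Complex.conjAe : ℂ ≃ₐ[ℝ] ℂ)
  rw [Function.LeftInverse.map_tprod (g := starRingEnd ℂ) (g' := starRingEnd ℂ)]
  · simp [hQ]
  · exact Complex.continuous_conj
  · exact Complex.continuous_conj
  · exact Complex.conj_conj

/-- the nome -/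
def qQ (β : ℝ) : ℂ := -((Real.exp (-2 * β) : ℝ) : ℂ)

/-- the second period -/
def pt (β : ℝ) : ℂ := Real.pi / 2 + β * I

/-- the lattice -/
def Lam (β : ℝ) : Set ℂ := {v | ∃ m n : ℤ, v = m * Real.pi + n * pt β}

lemma qQ_norm {β : ℝ} (hβ : 0 < β) : ‖qQ β‖ < 1 := by
  unfold qQ
  rw [norm_neg, Complex.norm_real, Real.norm_eq_abs, abs_of_pos (Real.exp_pos _)]
  rw [Real.exp_lt_one_iff]; linarith

lemma qQ_conj (β : ℝ) : (starRingEnd ℂ) (qQ β) = qQ β := by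
  simp only [qQ, map_neg, Complex.conj_ofReal]

lemma qQ_exp (β : ℝ) : qQ β = cexp (2 * I * pt β) := by
  unfold qQ pt
  have : (2 * I * (Real.pi / 2 + β * I) : ℂ) = ((-2 * β : ℝ) : ℂ) + Real.pi * I := by
    push_cast; linear_combination (2 * β : ℂ) * I_mul_I
  rw [this, Complex.exp_add, Complex.exp_pi_mul_I]; push_cast; ring

/-- the theta function -/
def Th (β : ℝ) (v : ℂ) : ℂ :=
  sin v * eulA (qQ β) (cexp (2 * I * v)) * eulA (qQ β) (cexp (-(2 * I * v)))

variable {β : ℝ}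

lemma Th_diff (hβ : 0 < β) : Differentiable ℂ (Th β) := by
  unfold Th
  have := eulA_diff (qQ_norm hβ)
  have h1 : Differentiable ℂ fun v : ℂ => eulA (qQ β) (cexp (2 * I * v)) :=
    this.comp (by fun_prop)
  have h2 : Differentiable ℂ fun v : ℂ => eulA (qQ β) (cexp (-(2 * I * v))) :=
    this.comp (by fun_prop)
  exact (Complex.differentiable_sin.mul h1).mul h2

lemma Th_neg (v : ℂ) : Th β (-v) = - Th β v := by
  unfold Th
  rw [Complex.sin_neg, show (2 * I * -v) = -(2 * I * v) by ring, neg_neg]; ring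

lemma Th_conj (v : ℂ) : Th β ((starRingEnd ℂ) v) = (starRingEnd ℂ) (Th β v) := by
  unfold Th
  rw [map_mul, map_mul, eulA_conj _ _ (qQ_conj β), eulA_conj _ _ (qQ_conj β),
    ← Complex.exp_conj, ← Complex.exp_conj, ← Complex.sin_conj]
  simp only [map_mul, map_neg, Complex.conj_I, Complex.conj_ofNat]
  rw [show (2 * -I * (starRingEnd ℂ) v) = -(2 * I * (starRingEnd ℂ) v) by ring, neg_neg]; ring

lemma Th_add_pi (v : ℂ) : Th β (v + Real.pi) = - Th β v := by
  unfold Th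
  rw [Complex.sin_add_pi, show (2 * I * (v + Real.pi)) = 2 * I * v + 2 * Real.pi * I by ring,
    Complex.exp_periodic, neg_add, Complex.exp_add _ (-(2 * Real.pi * I)),
    Complex.exp_neg (2 * Real.pi * I), Complex.exp_two_pi_mul_I]
  simp

lemma Th_add_pt (hβ : 0 < β) (v : ℂ) :
    Th β (v + pt β) = - cexp (-(I * pt β)) * cexp (-(2 * I * v)) * Th β v := by
  unfold Th
  have hQ := qQ_norm hβ
  have e1 : cexp (2 * I * (v + pt β)) = qQ β * cexp (2 * I * v) := by
    rw [qQ_exp, ← Complex.exp_add]; ring_nf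
  have e2 : qQ β * cexp (-(2 * I * (v + pt β))) = cexp (-(2 * I * v)) := by
    rw [qQ_exp, ← Complex.exp_add]; ring_nf
  rw [eulA_fun hQ (cexp (-(2 * I * (v + pt β)))), e2, eulA_fun hQ (cexp (2 * I * v)), e1]
  have e3 : sin (v + pt β) = cexp (-(I * pt β)) * cexp (-(I * v)) * (1 - qQ β * cexp (2 * I * v)) * I / 2 := by
    have e4 : cexp (-(I * pt β)) * cexp (-(I * v)) * (qQ β * cexp (2 * I * v)) = cexp ((v + pt β) * I) := by
      rw [qQ_exp, ← Complex.exp_add, ← Complex.exp_add, ← Complex.exp_add]; ring_nf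
    have e5 : cexp (-(I * pt β)) * cexp (-(I * v)) = cexp (-(v + pt β) * I) := by
      rw [← Complex.exp_add]; ring_nf
    rw [Complex.sin, ← e4, ← e5]; ring
  have e6 : cexp (-(2 * I * v)) * sin v = - cexp (-(I * v)) * (1 - cexp (-(2 * I * v))) * I / 2 := by
    have e4 : cexp (-(2 * I * v)) * cexp (v * I) = cexp (-(I * v)) := by
      rw [← Complex.exp_add]; ring_nf
    have e5 : cexp (-v * I) = cexp (-(I * v)) := by ring_nf
    rw [Complex.sin, e5]; linear_combination (-I / 2) * e4
  rw [e3]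
  linear_combination (cexp (-(I * pt β)) * (1 - qQ β * cexp (2 * I * v)) *
    eulA (qQ β) (qQ β * cexp (2 * I * v)) * eulA (qQ β) (cexp (-(2 * I * v)))) * e6

lemma lam_ind {p : ℂ → Prop} (h1 : ∀ v, p (v + Real.pi) ↔ p v) (h2 : ∀ v, p (v + pt β) ↔ p v)
    {w : ℂ} (hw : w ∈ Lam β) (v : ℂ) : p (v + w) ↔ p v := by
  obtain ⟨m, n, rfl⟩ := hw
  have a : ∀ c : ℂ, (∀ v, p (v + c) ↔ p v) → ∀ (m : ℤ) v, p (v + m * c) ↔ p v := by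
    intro c hc m
    induction m using Int.induction_on with
    | zero => simp
    | succ k ih =>
      intro v
      rw [← ih v, ← hc (v + ((k : ℤ) : ℂ) * c)]; push_cast; ring_nf
    | pred k ih =>
      intro v
      rw [← ih v, ← hc (v + ((-(k : ℤ) - 1 : ℤ) : ℂ) * _)]; push_cast; ring_nf
  rw [← add_assoc, a _ h2, a _ h1]

lemma Th_zero_iff (hβ : 0 < β) (v : ℂ) : Th β v = 0 ↔ v ∈ Lam β := by
  have hQ := qQ_norm hβ
  constructor
  · intro h
    unfold Th at h
    rw [mul_eq_zero, mul_eq_zero] at h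
    have key : ∀ u : ℂ, eulA (qQ β) (cexp (2 * I * u)) = 0 → ∃ m n : ℤ, u = m * Real.pi + n * pt β := by
      intro u hu
      by_contra hc
      push Not at hc
      refine eulA_ne hQ ?_ hu
      intro n hn
      rw [qQ_exp, ← Complex.exp_nat_mul, ← Complex.exp_add, Complex.exp_eq_one_iff] at hn
      obtain ⟨m, hm⟩ := hn
      apply hc m (-(n + 1 : ℤ))
      have : (2 * I) * u = (2 * I) * (m * Real.pi + (-(n + 1 : ℤ) : ℤ) * pt β) := by
        push_cast at hm ⊢
        linear_combination hm
      exact mul_left_cancel₀ (by simp) this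
    rcases h with (h | h) | h
    · rw [Complex.sin_eq_zero_iff] at h
      obtain ⟨k, hk⟩ := h
      exact ⟨k, 0, by simp [hk]⟩
    · exact key v h
    · rw [show -(2 * I * v) = 2 * I * (-v) by ring] at h
      obtain ⟨m, n, hmn⟩ := key _ h
      exact ⟨-m, -n, by push_cast; linear_combination -hmn⟩
  · intro h
    have := (lam_ind (p := fun v => Th β v = 0) (β := β) (fun v => by simp [Th_add_pi])
      (fun v => by simp [Th_add_pt hβ]) h 0)
    rw [zero_add] at this
    rw [this]; simp [Th]

lemma Th_deriv_zero (hβ : 0 < β) : deriv (Th β) 0 ≠ 0 := by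
  have hQ := qQ_norm hβ
  have := eulA_diff hQ
  have h1 : Differentiable ℂ fun v : ℂ => eulA (qQ β) (cexp (2 * I * v)) :=
    this.comp (by fun_prop)
  have h2 : Differentiable ℂ fun v : ℂ => eulA (qQ β) (cexp (-(2 * I * v))) :=
    this.comp (by fun_prop)
  have : HasDerivAt (Th β) (eulA (qQ β) 1 * eulA (qQ β) 1) 0 := by
    have a := ((Complex.hasDerivAt_sin 0).mul (h1 0).hasDerivAt).mul (h2 0).hasDerivAt
    refine HasDerivAt.congr_deriv a ?_
    simp
  rw [this.deriv]
  have : eulA (qQ β) 1 ≠ 0 := by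
    apply eulA_ne hQ
    intro n hn
    have : ‖qQ β ^ (n + 1) * 1‖ < 1 := by
      rw [mul_one, norm_pow]; exact pow_lt_one₀ (norm_nonneg _) hQ (by omega)
    rw [hn] at this; simp at this
  exact mul_ne_zero this this

end

noncomputable section
variable {β : ℝ}

lemma pt_im (β : ℝ) : (pt β).im = β := by simp [pt]
lemma pt_re (β : ℝ) : (pt β).re = Real.pi / 2 := by
  have : ((Real.pi : ℂ) / 2).re = Real.pi / 2 := by
    rw [show ((Real.pi : ℂ) / 2) = ((Real.pi / 2 : ℝ) : ℂ) by push_cast; rfl, Complex.ofReal_re]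
  simp [pt, this]

lemma pi_mem : (Real.pi : ℂ) ∈ Lam β := ⟨1, 0, by simp⟩
lemma pt_mem : pt β ∈ Lam β := ⟨0, 1, by simp⟩
lemma zero_mem_lam : (0 : ℂ) ∈ Lam β := ⟨0, 0, by simp⟩
lemma add_mem_lam {v w : ℂ} (hw : w ∈ Lam β) : v + w ∈ Lam β ↔ v ∈ Lam β := by
  obtain ⟨m, n, rfl⟩ := hw
  constructor
  · rintro ⟨a, b, h⟩
    exact ⟨a - m, b - n, by push_cast; linear_combination h⟩
  · rintro ⟨a, b, h⟩
    exact ⟨a + m, b + n, by push_cast; linear_combination h⟩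
lemma neg_mem_lam {v : ℂ} : -v ∈ Lam β ↔ v ∈ Lam β := by
  constructor
  · rintro ⟨a, b, h⟩
    exact ⟨-a, -b, by push_cast; linear_combination -h⟩
  · rintro ⟨a, b, h⟩
    exact ⟨-a, -b, by push_cast; linear_combination -h⟩
lemma conj_mem_lam {v : ℂ} (hβ : 0 < β) : (starRingEnd ℂ) v ∈ Lam β ↔ v ∈ Lam β := by
  rw [← Th_zero_iff hβ, ← Th_zero_iff hβ, Th_conj]; simp

lemma lam_closed (hβ : 0 < β) : IsClosed (Lam β) := by
  have : Lam β = Th β ⁻¹' {0} := by ext v; simp [Th_zero_iff hβ]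
  rw [this]; exact isClosed_singleton.preimage (Th_diff hβ).continuous

lemma lam_compl_nhds (hβ : 0 < β) {v : ℂ} (hv : v ∉ Lam β) : ∀ᶠ w in nhds v, w ∉ Lam β :=
  (lam_closed hβ).isOpen_compl.mem_nhds hv

lemma lam_discrete (hβ : 0 < β) (v : ℂ) : ∀ᶠ w in nhdsWithin v {v}ᶜ, w ∉ Lam β := by
  by_cases hv : v ∈ Lam β
  · have h0 : ∀ᶠ w in nhdsWithin (0 : ℂ) {0}ᶜ, w ∉ Lam β := by
      have := (Th_diff hβ 0).hasDerivAt.eventually_ne (c := 0) (Th_deriv_zero hβ)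
      filter_upwards [this] with w hw
      rwa [← Th_zero_iff hβ]
    have ht : Tendsto (fun w => w - v) (nhdsWithin v {v}ᶜ) (nhdsWithin 0 {0}ᶜ) := by
      apply tendsto_nhdsWithin_of_tendsto_nhds_of_eventually_within
      · have : ContinuousAt (fun w => w - v) v := by fun_prop
        have := this.tendsto
        rw [sub_self] at this
        exact this.mono_left nhdsWithin_le_nhds
      · filter_upwards [self_mem_nhdsWithin] with w hw
        simpa [sub_eq_zero] using hw
    filter_upwards [ht.eventually h0] with w hw hc
    apply hw
    rw [sub_eq_add_neg, add_mem_lam (neg_mem_lam.mpr hv)]; exact hc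
  · exact (lam_compl_nhds hβ hv).filter_mono nhdsWithin_le_nhds

/-- reduction to a compact fundamental cell -/
lemma lam_reduce (hβ : 0 < β) (v : ℂ) : ∃ w ∈ Lam β, ∃ a ∈ Icc (0 : ℝ) 1, ∃ b ∈ Icc (0 : ℝ) 1,
    v + w = a * Real.pi + b * pt β := by
  set y := v.im / β with hy
  set x := (v.re - y * (Real.pi / 2)) / Real.pi with hx
  have hv : v = x * Real.pi + y * pt β := by
    apply Complex.ext
    · simp [pt_re, hx]
    · simp [pt_im, hy]; field_simp
  refine ⟨(-⌊x⌋ : ℤ) * Real.pi + (-⌊y⌋ : ℤ) * pt β, ⟨_, _, rfl⟩, Int.fract x, ⟨Int.fract_nonneg _, (Int.fract_lt_one _).le⟩,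
    Int.fract y, ⟨Int.fract_nonneg _, (Int.fract_lt_one _).le⟩, ?_⟩
  conv_lhs => rw [hv]
  rw [Int.fract, Int.fract]; push_cast; ring

/-- Liouville for doubly periodic functions with removable singularities -/
lemma liouville (hβ : 0 < β) (T : Set ℂ) (g : ℂ → ℂ)
    (hT : ∀ v, ∀ᶠ w in nhdsWithin v {v}ᶜ, w ∉ T)
    (hd : ∀ v ∉ T, DifferentiableAt ℂ g v)
    (h1 : ∀ v ∉ T, g (v + Real.pi) = g v) (h2 : ∀ v ∉ T, g (v + pt β) = g v)
    (hl : ∀ v ∈ T, ∃ l, Tendsto g (nhdsWithin v {v}ᶜ) (nhds l)) : ∃ c, ∀ v ∉ T, g v = c := by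
  have hl' : ∀ v, ∃ l, Tendsto g (nhdsWithin v {v}ᶜ) (nhds l) := by
    intro v
    by_cases hv : v ∈ T
    · exact hl v hv
    · exact ⟨g v, (hd v hv).continuousAt.tendsto.mono_left nhdsWithin_le_nhds⟩
  choose G hG using hl'
  have hGg : ∀ v ∉ T, G v = g v := fun v hv =>
    tendsto_nhds_unique (hG v) ((hd v hv).continuousAt.tendsto.mono_left nhdsWithin_le_nhds)
  have hev : ∀ v, ∀ᶠ w in nhdsWithin v {v}ᶜ, DifferentiableAt ℂ G w := by
    intro v
    have h3 : ∀ᶠ w in nhdsWithin v {v}ᶜ, ∀ᶠ w' in nhds w, w' ∉ T := by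
      have := eventually_eventually_nhdsWithin.mpr (hT v)
      filter_upwards [this, self_mem_nhdsWithin] with w hw hne
      rwa [nhdsWithin_eq_nhds.mpr (isOpen_compl_singleton.mem_nhds hne)] at hw
    filter_upwards [h3] with w hw
    have e : G =ᶠ[nhds w] g := by filter_upwards [hw] with z hz using hGg z hz
    exact (hd w hw.self_of_nhds).congr_of_eventuallyEq e
  have hcont : ∀ v, ContinuousAt G v := by
    intro v
    rw [continuousAt_iff_punctured_nhds]
    refine (hG v).congr' ?_
    filter_upwards [hT v] with w hw using (hGg w hw).symm
  have hGd : Differentiable ℂ G := fun v =>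
    (Complex.analyticAt_of_differentiable_on_punctured_nhds_of_continuousAt (hev v) (hcont v)).differentiableAt
  have shift : ∀ c : ℂ, (∀ v ∉ T, g (v + c) = g v) → ∀ v, G (v + c) = G v := by
    intro c hc v
    have t1 : Tendsto (fun w => w + c) (nhdsWithin v {v}ᶜ) (nhdsWithin (v + c) {v + c}ᶜ) := by
      apply tendsto_nhdsWithin_of_tendsto_nhds_of_eventually_within
      · have : ContinuousAt (fun w => w + c) v := by fun_prop
        exact this.tendsto.mono_left nhdsWithin_le_nhds
      · filter_upwards [self_mem_nhdsWithin] with w hw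
        simpa using hw
    refine tendsto_nhds_unique ((hG (v + c)).comp t1) ((hG v).congr' ?_)
    filter_upwards [hT v] with w hw using (hc w hw).symm
  have s1 := shift _ h1
  have s2 := shift _ h2
  have hper : ∀ w ∈ Lam β, ∀ v, G (v + w) = G v := by
    intro w hw v
    have := (lam_ind (p := fun z => G z = G v) (β := β) (fun z => by rw [s1]) (fun z => by rw [s2]) hw v)
    exact this.mpr rfl
  have hK : IsCompact ((fun p : ℝ × ℝ => (p.1 * Real.pi + p.2 * pt β : ℂ)) '' (Icc 0 1 ×ˢ Icc 0 1)) :=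
    (isCompact_Icc.prod isCompact_Icc).image (by fun_prop)
  obtain ⟨M, hM⟩ := (hK.image hGd.continuous).isBounded.exists_norm_le
  have hb : Bornology.IsBounded (range G) := by
    rw [isBounded_iff_forall_norm_le]
    refine ⟨M, ?_⟩
    rintro _ ⟨v, rfl⟩
    obtain ⟨w, hw, a, ha, b, hb, e⟩ := lam_reduce hβ v
    rw [← hper w hw v, e]
    exact hM _ ⟨_, ⟨(a, b), ⟨ha, hb⟩, rfl⟩, rfl⟩
  refine ⟨G 0, fun v hv => ?_⟩
  rw [← hGg v hv]
  exact hGd.apply_eq_apply_of_bounded hb v 0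

/-- logarithmic derivative of theta -/
def Cf (β : ℝ) (v : ℂ) : ℂ := deriv (Th β) v / Th β v

/-- minus second logarithmic derivative of theta -/
def Df (β : ℝ) (v : ℂ) : ℂ :=
  (deriv (Th β) v ^ 2 - Th β v * deriv (deriv (Th β)) v) / Th β v ^ 2

lemma Th_diff' (hβ : 0 < β) : Differentiable ℂ (deriv (Th β)) := by
  have : AnalyticOnNhd ℂ (Th β) univ := fun z _ => (Th_diff hβ).analyticAt z
  exact fun z => (this.deriv z (mem_univ _)).differentiableAt

lemma Th_diff'' (hβ : 0 < β) : Differentiable ℂ (deriv (deriv (Th β))) := by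
  have : AnalyticOnNhd ℂ (deriv (Th β)) univ := fun z _ => (Th_diff' hβ).analyticAt z
  exact fun z => (this.deriv z (mem_univ _)).differentiableAt

lemma Th_ne (hβ : 0 < β) {v : ℂ} (hv : v ∉ Lam β) : Th β v ≠ 0 := by
  rwa [Ne, Th_zero_iff hβ]

lemma Cf_hasDeriv (hβ : 0 < β) {v : ℂ} (hv : v ∉ Lam β) : HasDerivAt (Cf β) (-Df β v) v := by
  have := (Th_diff' hβ v).hasDerivAt.div (Th_diff hβ v).hasDerivAt (Th_ne hβ hv)
  refine HasDerivAt.congr_deriv this ?_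
  rw [Df]; ring

lemma Df_differentiableAt (hβ : 0 < β) {v : ℂ} (hv : v ∉ Lam β) : DifferentiableAt ℂ (Df β) v := by
  have h0 := Th_diff hβ v
  have h1 := Th_diff' hβ v
  have h2 := Th_diff'' hβ v
  unfold Df
  exact DifferentiableAt.div ((h1.pow 2).sub (h0.mul h2)) (h0.pow 2) (pow_ne_zero 2 (Th_ne hβ hv))

lemma Df_eq (hβ : 0 < β) {v : ℂ} (hv : v ∉ Lam β) : Df β v = - deriv (Cf β) v := by
  rw [(Cf_hasDeriv hβ hv).deriv, neg_neg]

lemma Df_lam (hβ : 0 < β) {v : ℂ} (hv : v ∈ Lam β) : Df β v = 0 := by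
  rw [Df, (Th_zero_iff hβ v).mpr hv]; simp
lemma Cf_lam (hβ : 0 < β) {v : ℂ} (hv : v ∈ Lam β) : Cf β v = 0 := by
  rw [Cf, (Th_zero_iff hβ v).mpr hv]; simp

lemma dTh_neg (v : ℂ) : deriv (Th β) (-v) = deriv (Th β) v := by
  have : (fun v => Th β (-v)) = fun v => - Th β v := funext Th_neg
  have h := congrArg (fun f => deriv f v) this
  simp only [deriv_comp_neg, deriv.fun_neg] at h
  exact neg_injective h

lemma Cf_neg (v : ℂ) : Cf β (-v) = - Cf β v := by
  rw [Cf, Cf, dTh_neg, Th_neg, div_neg]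

lemma Cf_conj (v : ℂ) : Cf β ((starRingEnd ℂ) v) = (starRingEnd ℂ) (Cf β v) := by
  rw [Cf, Cf, Th_conj, map_div₀]
  congr 1
  have : Th β = (starRingEnd ℂ) ∘ Th β ∘ (starRingEnd ℂ) := by
    ext z; simp [Th_conj]
  conv_lhs => rw [this]
  rw [deriv_conj_conj]; simp

lemma Cf_add_pi (v : ℂ) : Cf β (v + Real.pi) = Cf β v := by
  have : (fun v => Th β (v + Real.pi)) = fun v => - Th β v := funext Th_add_pi
  have h := congrArg (fun f => deriv f v) this
  simp only [deriv_comp_add_const, deriv.fun_neg] at h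
  rw [Cf, Cf, h, Th_add_pi, neg_div_neg_eq]

lemma Cf_add_pt (hβ : 0 < β) {v : ℂ} (hv : v ∉ Lam β) : Cf β (v + pt β) = Cf β v - 2 * I := by
  have : (fun v => Th β (v + pt β)) = fun v => - cexp (-(I * pt β)) * cexp (-(2 * I * v)) * Th β v :=
    funext (Th_add_pt hβ)
  have h := congrArg (fun f => deriv f v) this
  simp only [deriv_comp_add_const] at h
  have hd : HasDerivAt (fun v => - cexp (-(I * pt β)) * cexp (-(2 * I * v)) * Th β v)
     (- cexp (-(I * pt β)) * (cexp (-(2 * I * v)) * (-(2 * I))) * Th β v +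
       - cexp (-(I * pt β)) * cexp (-(2 * I * v)) * deriv (Th β) v) v := by
    have a : HasDerivAt (fun v : ℂ => -(2 * I * v)) (-(2 * I)) v := by
      simpa using ((hasDerivAt_id v).const_mul (2 * I)).fun_neg
    exact (a.cexp.const_mul _).mul (Th_diff hβ v).hasDerivAt
  rw [hd.deriv] at h
  have hT := Th_ne hβ hv
  rw [Cf, Cf, h, Th_add_pt hβ]
  have e1 := Complex.exp_ne_zero (-(I * pt β))
  have e2 := Complex.exp_ne_zero (-(2 * I * v))
  field_simp
  ring

lemma Df_shift (hβ : 0 < β) {c : ℂ} {K : ℂ} (hc : c ∈ Lam β)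
    (h : ∀ v ∉ Lam β, Cf β (v + c) = Cf β v + K) (v : ℂ) : Df β (v + c) = Df β v := by
  by_cases hv : v ∈ Lam β
  · rw [Df_lam hβ hv, Df_lam hβ ((add_mem_lam hc).mpr hv)]
  · have hv' : v + c ∉ Lam β := by rwa [add_mem_lam hc]
    have a := (Cf_hasDeriv hβ hv').comp_add_const v c
    have b := (Cf_hasDeriv hβ hv).add_const K
    have e : (fun v => Cf β (v + c)) =ᶠ[nhds v] fun v => Cf β v + K := by
      filter_upwards [lam_compl_nhds hβ hv] with w hw using h w hw
    have := (a.congr_of_eventuallyEq e.symm).unique b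
    exact neg_injective this

lemma Df_add_pi (hβ : 0 < β) (v : ℂ) : Df β (v + Real.pi) = Df β v :=
  Df_shift hβ pi_mem (K := 0) (fun v _ => by rw [Cf_add_pi, add_zero]) v
lemma Df_add_pt (hβ : 0 < β) (v : ℂ) : Df β (v + pt β) = Df β v :=
  Df_shift hβ pt_mem (K := -(2 * I)) (fun v hv => by rw [Cf_add_pt hβ hv, sub_eq_add_neg]) v
lemma Df_add_lam (hβ : 0 < β) {w : ℂ} (hw : w ∈ Lam β) (v : ℂ) : Df β (v + w) = Df β v :=
  (lam_ind (p := fun z => Df β z = Df β v) (β := β) (fun z => by rw [Df_add_pi hβ])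
    (fun z => by rw [Df_add_pt hβ]) hw v).mpr rfl

lemma Df_neg (hβ : 0 < β) (v : ℂ) : Df β (-v) = Df β v := by
  by_cases hv : v ∈ Lam β
  · rw [Df_lam hβ hv, Df_lam hβ (neg_mem_lam.mpr hv)]
  · have hv' : -v ∉ Lam β := by rwa [neg_mem_lam]
    rw [Df_eq hβ hv, Df_eq hβ hv']
    have : (fun v => Cf β (-v)) = fun v => - Cf β v := funext Cf_neg
    have h := congrArg (fun f => deriv f v) this
    simp only [deriv_comp_neg, deriv.fun_neg] at h
    exact h

lemma Df_conj (hβ : 0 < β) (v : ℂ) : Df β ((starRingEnd ℂ) v) = (starRingEnd ℂ) (Df β v) := by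
  by_cases hv : v ∈ Lam β
  · rw [Df_lam hβ hv, Df_lam hβ ((conj_mem_lam hβ).mpr hv)]; simp
  · have hv' : (starRingEnd ℂ) v ∉ Lam β := by rwa [conj_mem_lam hβ]
    rw [Df_eq hβ hv, Df_eq hβ hv']
    have : Cf β = (starRingEnd ℂ) ∘ Cf β ∘ (starRingEnd ℂ) := by
      ext z; simp [Cf_conj]
    conv_lhs => rw [this]
    rw [deriv_conj_conj]; simp

end

noncomputable section
variable {β : ℝ}

/-- `Th v = v * Td v` -/
def Td (β : ℝ) : ℂ → ℂ := dslope (Th β) 0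

lemma Th_zero (hβ : 0 < β) : Th β 0 = 0 := (Th_zero_iff hβ 0).mpr zero_mem_lam

lemma Td_diff (hβ : 0 < β) : Differentiable ℂ (Td β) := by
  have := (Complex.differentiableOn_dslope (f := Th β) (s := univ) (c := 0) univ_mem).mpr
    (Th_diff hβ).differentiableOn
  exact differentiableOn_univ.mp this

lemma Td_mul (hβ : 0 < β) (v : ℂ) : Th β v = v * Td β v := by
  have := sub_smul_dslope (Th β) 0 v
  rw [Th_zero hβ] at this
  simpa [Td] using this.symm

lemma Td_zero : Td β 0 = deriv (Th β) 0 := dslope_same _ _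

lemma Td_even (hβ : 0 < β) (v : ℂ) : Td β (-v) = Td β v := by
  by_cases hv : v = 0
  · simp [hv]
  · have h1 := Td_mul hβ v
    have h2 := Td_mul hβ (-v)
    rw [Th_neg, h1] at h2
    have : v * (Td β v - Td β (-v)) = 0 := by linear_combination -h2
    rcases mul_eq_zero.mp this with h | h
    · exact absurd h hv
    · exact (sub_eq_zero.mp h).symm

lemma even_deriv_zero {f : ℂ → ℂ} (h : ∀ v, f (-v) = f v) : deriv f 0 = 0 := by
  have : (fun v => f (-v)) = f := funext h
  have h := congrArg (fun f => deriv f 0) this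
  simp only [deriv_comp_neg, neg_zero] at h
  have : deriv f 0 + deriv f 0 = 0 := by linear_combination -h
  simpa using this

/-- regular part of `Cf` at `0` -/
def Rf (β : ℝ) (v : ℂ) : ℂ := deriv (Td β) v / Td β v

/-- the constant term -/
def kap (β : ℝ) : ℂ := - deriv (Rf β) 0

lemma Td_ne_zero (hβ : 0 < β) : Td β 0 ≠ 0 := by rw [Td_zero]; exact Th_deriv_zero hβ

lemma Rf_analytic (hβ : 0 < β) : AnalyticAt ℂ (Rf β) 0 :=
  AnalyticAt.div ((Td_diff hβ).analyticAt 0).deriv ((Td_diff hβ).analyticAt 0) (Td_ne_zero hβ)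

lemma Rf_zero (hβ : 0 < β) : Rf β 0 = 0 := by
  rw [Rf, even_deriv_zero (Td_even hβ), zero_div]

lemma Cf_local0 (hβ : 0 < β) {v : ℂ} (hv : v ≠ 0) (hT : Td β v ≠ 0) :
    Cf β v = 1 / v + Rf β v := by
  have h : HasDerivAt (Th β) (1 * Td β v + v * deriv (Td β) v) v := by
    have := (hasDerivAt_id v).mul (Td_diff hβ v).hasDerivAt
    have e : Th β = id * Td β := by ext w; simpa using Td_mul hβ w
    rw [e]; exact this
  rw [Cf, h.deriv, Td_mul hβ, Rf]
  field_simp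

lemma Cf_local (hβ : 0 < β) : ∀ᶠ v in nhdsWithin (0 : ℂ) {0}ᶜ, Cf β v = 1 / v + Rf β v := by
  have h1 : ∀ᶠ v in nhdsWithin (0 : ℂ) {0}ᶜ, Td β v ≠ 0 :=
    ((Td_diff hβ).continuous.continuousAt.eventually_ne (Td_ne_zero hβ)).filter_mono nhdsWithin_le_nhds
  filter_upwards [h1, self_mem_nhdsWithin] with v h hv
  exact Cf_local0 hβ hv h

lemma punct_nhds {p : ℂ → Prop} {a : ℂ} (h : ∀ᶠ v in nhdsWithin a {a}ᶜ, p v) :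
    ∀ᶠ v in nhdsWithin a {a}ᶜ, ∀ᶠ w in nhds v, p w := by
  have := eventually_eventually_nhdsWithin.mpr h
  filter_upwards [this, self_mem_nhdsWithin] with w hw hne
  rwa [nhdsWithin_eq_nhds.mpr (isOpen_compl_singleton.mem_nhds hne)] at hw

lemma Df_local (hβ : 0 < β) :
    ∀ᶠ v in nhdsWithin (0 : ℂ) {0}ᶜ, Df β v = 1 / v ^ 2 - deriv (Rf β) v := by
  have h1 := punct_nhds (Cf_local hβ)
  have h2 : ∀ᶠ v in nhdsWithin (0 : ℂ) {0}ᶜ, AnalyticAt ℂ (Rf β) v :=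
    ((Rf_analytic hβ).eventually_analyticAt).filter_mono nhdsWithin_le_nhds
  filter_upwards [h1, h2, self_mem_nhdsWithin, lam_discrete hβ 0] with v a b hv hl
  have hv : v ≠ 0 := hv
  have c := Cf_hasDeriv hβ hl
  have d := (hasDerivAt_inv hv).add b.differentiableAt.hasDerivAt
  have e : Cf β =ᶠ[nhds v] (fun y => y⁻¹) + Rf β := by
    filter_upwards [a] with w hw; rw [hw]; simp
  have := c.unique (d.congr_of_eventuallyEq e)
  have : Df β v = - (-(v ^ 2)⁻¹ + deriv (Rf β) v) := by linear_combination -this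
  rw [this]; ring

lemma Df_pole (hβ : 0 < β) :
    Tendsto (fun v => Df β v - 1 / v ^ 2) (nhdsWithin 0 {(0 : ℂ)}ᶜ) (nhds (kap β)) := by
  have : Tendsto (fun v => - deriv (Rf β) v) (nhdsWithin 0 {(0 : ℂ)}ᶜ) (nhds (kap β)) :=
    ((Rf_analytic hβ).deriv.continuousAt.neg.tendsto).mono_left nhdsWithin_le_nhds
  refine this.congr' ?_
  filter_upwards [Df_local hβ] with v hv
  rw [hv]; ring

lemma tendsto_inv_sq : Tendsto (fun v : ℂ => ‖1 / v ^ 2‖) (nhdsWithin 0 {(0 : ℂ)}ᶜ) atTop := by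
  have h : Tendsto (fun v : ℂ => ‖v‖⁻¹) (nhdsWithin 0 {(0 : ℂ)}ᶜ) atTop :=
    tendsto_inv_nhdsGT_zero.comp tendsto_norm_nhdsNE_zero
  have := (tendsto_pow_atTop (two_ne_zero)).comp h
  refine this.congr fun v => ?_
  simp

lemma Df_norm_tendsto (hβ : 0 < β) :
    Tendsto (fun v => ‖Df β v‖) (nhdsWithin 0 {(0 : ℂ)}ᶜ) atTop := by
  have h1 := tendsto_inv_sq
  have h2 := (Df_pole hβ).norm
  have h3 : ∀ᶠ v in nhdsWithin 0 {(0 : ℂ)}ᶜ, ‖Df β v - 1 / v ^ 2‖ ≤ ‖kap β‖ + 1 :=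
    (h2.eventually_lt_const (lt_add_one _)).mono fun _ => le_of_lt
  have h4 : Tendsto (fun v : ℂ => ‖1 / v ^ 2‖ - (‖kap β‖ + 1)) (nhdsWithin 0 {(0 : ℂ)}ᶜ) atTop :=
    tendsto_atTop_add_const_right _ _ h1
  refine tendsto_atTop_mono' _ ?_ h4
  filter_upwards [h3] with v hv
  have := norm_sub_norm_le (1 / v ^ 2) (Df β v)
  rw [norm_sub_rev] at this
  linarith

/-- second order quotient -/
lemma quad_limit {N : ℂ → ℂ} (hN : AnalyticAt ℂ N 0) (h0 : deriv N 0 = 0) :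
    ∃ l, Tendsto (fun u => (N u - N 0) / u ^ 2) (nhdsWithin 0 {(0 : ℂ)}ᶜ) (nhds l) := by
  obtain ⟨p, hp⟩ := hN
  have h1 := hp.has_fpower_series_dslope_fslope
  have h2 := h1.has_fpower_series_dslope_fslope
  refine ⟨_, (h2.continuousAt.tendsto.mono_left nhdsWithin_le_nhds).congr' ?_⟩
  filter_upwards [self_mem_nhdsWithin] with u hu
  have hu : u ≠ 0 := hu
  have e1 := sub_smul_dslope N 0 u
  have e2 := sub_smul_dslope (dslope N 0) 0 u
  rw [dslope_same, h0] at e2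
  simp only [sub_zero, smul_eq_mul] at e1 e2
  rw [← e1, ← e2]; field_simp

lemma lim_shift {g : ℂ → ℂ} {w l : ℂ} (a : ℂ) (h : ∀ᶠ v in nhdsWithin (a + w) {a + w}ᶜ, g v = g (v - w))
    (hl : Tendsto g (nhdsWithin a {a}ᶜ) (nhds l)) : Tendsto g (nhdsWithin (a + w) {a + w}ᶜ) (nhds l) := by
  have t1 : Tendsto (fun v => v - w) (nhdsWithin (a + w) {a + w}ᶜ) (nhdsWithin a {a}ᶜ) := by
    apply tendsto_nhdsWithin_of_tendsto_nhds_of_eventually_within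
    · have : ContinuousAt (fun v => v - w) (a + w) := by fun_prop
      have := this.tendsto
      rw [add_sub_cancel_right] at this
      exact this.mono_left nhdsWithin_le_nhds
    · filter_upwards [self_mem_nhdsWithin] with v hv
      simp only [mem_compl_iff, mem_singleton_iff] at hv ⊢
      rwa [sub_eq_iff_eq_add]
  refine (hl.comp t1).congr' ?_
  filter_upwards [h] with v hv using hv.symm

/-- the product formula -/
lemma prod_formula (hβ : 0 < β) {u v : ℂ} (hu : u ∉ Lam β) (hv : v ∉ Lam β) :
    Th β (u + v) * Th β (u - v) * deriv (Th β) 0 ^ 2 =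
      - (Th β v ^ 2 * Th β u ^ 2 * (Df β u - Df β v)) := by
  set A := Th β v ^ 2 / deriv (Th β) 0 ^ 2 with hA
  have hd0 := Th_deriv_zero hβ
  set g : ℂ → ℂ := fun u => Th β (u + v) * Th β (u - v) / Th β u ^ 2 + A * Df β u with hg
  have g1 : ∀ u, g (u + Real.pi) = g u := by
    intro u
    simp only [hg]
    rw [show u + Real.pi + v = (u + v) + Real.pi by ring, show u + Real.pi - v = (u - v) + Real.pi by ring,
      Th_add_pi, Th_add_pi, Th_add_pi, Df_add_pi hβ]
    ring
  have g2 : ∀ u, g (u + pt β) = g u := by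
    intro u
    simp only [hg]
    rw [show u + pt β + v = (u + v) + pt β by ring, show u + pt β - v = (u - v) + pt β by ring,
      Th_add_pt hβ, Th_add_pt hβ, Th_add_pt hβ, Df_add_pt hβ]
    congr 1
    have e : cexp (-(2 * I * (u + v))) * cexp (-(2 * I * (u - v))) = cexp (-(2 * I * u)) ^ 2 := by
      rw [← Complex.exp_add, ← Complex.exp_nat_mul]; congr 1; push_cast; ring
    have e1 := Complex.exp_ne_zero (-(I * pt β))
    have e2 := Complex.exp_ne_zero (-(2 * I * u))
    rw [show -cexp (-(I * pt β)) * cexp (-(2 * I * (u + v))) * Th β (u + v) *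
      (-cexp (-(I * pt β)) * cexp (-(2 * I * (u - v))) * Th β (u - v)) =
      cexp (-(I * pt β)) ^ 2 * (cexp (-(2 * I * (u + v))) * cexp (-(2 * I * (u - v)))) * (Th β (u + v) * Th β (u - v)) by ring, e,
      show (-cexp (-(I * pt β)) * cexp (-(2 * I * u)) * Th β u) ^ 2 =
       (cexp (-(I * pt β)) ^ 2 * cexp (-(2 * I * u)) ^ 2) * Th β u ^ 2 by ring]
    rw [mul_div_mul_left]
    exact mul_ne_zero (pow_ne_zero _ e1) (pow_ne_zero _ e2)
  have gw : ∀ w ∈ Lam β, ∀ u, g (u + w) = g u := fun w hw u =>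
    (lam_ind (p := fun z => g z = g u) (β := β) (fun z => by rw [g1]) (fun z => by rw [g2]) hw u).mpr rfl
  have l0 : ∃ l, Tendsto g (nhdsWithin 0 {(0 : ℂ)}ᶜ) (nhds l) := by
    set N : ℂ → ℂ := fun u => Th β (u + v) * Th β (u - v) / Td β u ^ 2 with hN
    have aN : AnalyticAt ℂ N 0 := by
      have a1 : AnalyticAt ℂ (fun u => Th β (u + v)) 0 :=
        ((Th_diff hβ).comp (differentiable_id.add_const v)).analyticAt 0
      have a2 : AnalyticAt ℂ (fun u => Th β (u - v)) 0 :=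
        ((Th_diff hβ).comp (differentiable_id.sub_const v)).analyticAt 0
      exact (a1.mul a2).div (((Td_diff hβ).analyticAt 0).pow 2) (pow_ne_zero _ (Td_ne_zero hβ))
    have ev : ∀ u, N (-u) = N u := by
      intro u
      simp only [hN]
      rw [Td_even hβ, show -u + v = -(u - v) by ring, show -u - v = -(u + v) by ring, Th_neg, Th_neg]; ring
    obtain ⟨l, hl⟩ := quad_limit aN (even_deriv_zero ev)
    have hN0 : N 0 = - A := by
      simp only [hN, hA]
      rw [zero_add, zero_sub, Th_neg, Td_zero]; ring
    refine ⟨l + A * kap β, (hl.add ((Df_pole hβ).const_mul A)).congr' ?_⟩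
    filter_upwards [self_mem_nhdsWithin] with u hu
    have hu : u ≠ 0 := hu
    rw [hN0]
    simp only [hN, hg]
    rw [Td_mul hβ u]
    by_cases hT : Td β u = 0
    · simp [hT]; field_simp; ring
    · field_simp; ring
  obtain ⟨c, hc⟩ := liouville hβ (Lam β) g (lam_discrete hβ) (by
      intro u hu
      have d1 := Th_diff hβ (u + v)
      have d2 := Th_diff hβ (u - v)
      have d3 : DifferentiableAt ℂ (fun u => Th β (u + v)) u := d1.comp u (differentiableAt_id.add_const v)
      have d4 : DifferentiableAt ℂ (fun u => Th β (u - v)) u := d2.comp u (differentiableAt_id.sub_const v)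
      exact ((d3.mul d4).div ((Th_diff hβ u).pow 2) (pow_ne_zero _ (Th_ne hβ hu))).add
        ((Df_differentiableAt hβ hu).const_mul A))
    (fun u _ => g1 u) (fun u _ => g2 u) (by
      intro w hw
      obtain ⟨l, hl⟩ := l0
      refine ⟨l, ?_⟩
      have := lim_shift (w := w) 0 (Eventually.of_forall fun v => by
        conv_lhs => rw [← sub_add_cancel v w]
        rw [gw w hw]) hl
      rwa [zero_add] at this)
  have e1 := hc u hu
  have e2 := hc v hv
  rw [← e2] at e1
  simp only [hg, sub_self, Th_zero hβ, mul_zero, zero_div, zero_add, hA] at e1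
  have hTu := Th_ne hβ hu
  field_simp at e1
  linear_combination e1

lemma sub_mem_lam {v w : ℂ} (hw : w ∈ Lam β) : v - w ∈ Lam β ↔ v ∈ Lam β := by
  rw [sub_eq_add_neg, add_mem_lam (neg_mem_lam.mpr hw)]

lemma Df_eq_iff (hβ : 0 < β) {u v : ℂ} (hu : u ∉ Lam β) (hv : v ∉ Lam β) :
    Df β u = Df β v ↔ u + v ∈ Lam β ∨ u - v ∈ Lam β := by
  have h := prod_formula hβ hu hv
  have hd0 := Th_deriv_zero hβ
  have h1 := Th_ne hβ hu
  have h2 := Th_ne hβ hv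
  rw [← Th_zero_iff hβ, ← Th_zero_iff hβ, ← mul_eq_zero]
  constructor
  · intro e
    rw [e, sub_self, mul_zero, neg_zero] at h
    rcases mul_eq_zero.mp h with h | h
    · exact h
    · exact absurd h (pow_ne_zero _ hd0)
  · intro e
    rw [e, zero_mul, eq_comm, neg_eq_zero] at h
    rcases mul_eq_zero.mp h with h | h
    · exact absurd h (mul_ne_zero (pow_ne_zero _ h2) (pow_ne_zero _ h1))
    · exact sub_eq_zero.mp h

lemma Df_deriv_formula (hβ : 0 < β) {v : ℂ} (hv : v ∉ Lam β) :
    deriv (Df β) v * Th β v ^ 4 = - (Th β (2 * v) * deriv (Th β) 0 ^ 3) := by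
  have e : (fun u => Th β (u + v) * Th β (u - v) * deriv (Th β) 0 ^ 2) =ᶠ[nhds v] fun u =>
      - (Th β v ^ 2 * Th β u ^ 2 * (Df β u - Df β v)) := by
    filter_upwards [lam_compl_nhds hβ hv] with u hu using prod_formula hβ hu hv
  have d1 : HasDerivAt (fun u => Th β (u + v)) (deriv (Th β) (v + v)) v :=
    (Th_diff hβ (v + v)).hasDerivAt.comp_add_const v v
  have d2 : HasDerivAt (fun u => Th β (u - v)) (deriv (Th β) (v - v)) v :=
    (Th_diff hβ (v - v)).hasDerivAt.comp_sub_const v v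
  have d3 := (d1.mul d2).mul_const (deriv (Th β) 0 ^ 2)
  have d4 := ((((Th_diff hβ v).hasDerivAt.pow 2).const_mul (Th β v ^ 2)).mul
    ((Df_differentiableAt hβ hv).hasDerivAt.sub_const (Df β v))).neg
  have := d3.unique (d4.congr_of_eventuallyEq e)
  rw [sub_self, sub_self, Th_zero hβ] at this
  rw [two_mul]
  simp only [Pi.mul_apply, Pi.pow_apply] at this
  linear_combination this

lemma Df_deriv_eq_zero (hβ : 0 < β) {v : ℂ} (hv : v ∉ Lam β) :
    deriv (Df β) v = 0 ↔ 2 * v ∈ Lam β := by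
  have h := Df_deriv_formula hβ hv
  have hd0 := Th_deriv_zero hβ
  have h1 := Th_ne hβ hv
  rw [← Th_zero_iff hβ]
  constructor
  · intro e
    rw [e, zero_mul, eq_comm, neg_eq_zero] at h
    rcases mul_eq_zero.mp h with h | h
    · exact h
    · exact absurd h (pow_ne_zero _ hd0)
  · intro e
    rw [e, zero_mul, neg_zero] at h
    rcases mul_eq_zero.mp h with h | h
    · exact h
    · exact absurd h (pow_ne_zero _ h1)

lemma Cf_addition (hβ : 0 < β) {u v : ℂ} (hu : u ∉ Lam β) (hv : v ∉ Lam β)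
    (h1 : u + v ∉ Lam β) (h2 : u - v ∉ Lam β) :
    (Cf β (u + v) - Cf β (u - v) - 2 * Cf β v) * (Df β u - Df β v) = - deriv (Df β) v := by
  have e : (fun v => Th β (u + v) * Th β (u - v) * deriv (Th β) 0 ^ 2) =ᶠ[nhds v] fun v =>
      - (Th β v ^ 2 * Th β u ^ 2 * (Df β u - Df β v)) := by
    filter_upwards [lam_compl_nhds hβ hv] with v hv using prod_formula hβ hu hv
  have d1 : HasDerivAt (fun v => Th β (u + v)) (deriv (Th β) (u + v)) v :=
    (Th_diff hβ (u + v)).hasDerivAt.comp_const_add u v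
  have d2 : HasDerivAt (fun v => Th β (u - v)) (-deriv (Th β) (u - v)) v :=
    (Th_diff hβ (u - v)).hasDerivAt.comp_const_sub u v
  have d3 := (d1.mul d2).mul_const (deriv (Th β) 0 ^ 2)
  have d4 := ((((Th_diff hβ v).hasDerivAt.pow 2).mul_const (Th β u ^ 2)).mul
    ((Df_differentiableAt hβ hv).hasDerivAt.const_sub (Df β u))).neg
  have key := d3.unique (d4.congr_of_eventuallyEq e)
  simp only [Pi.mul_apply, Pi.pow_apply] at key
  have hp := prod_formula hβ hu hv
  have n1 := Th_ne hβ hu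
  have n2 := Th_ne hβ hv
  have n3 := Th_ne hβ h1
  have n4 := Th_ne hβ h2
  have hd0 := Th_deriv_zero hβ
  have c1 : Cf β (u + v) * Th β (u + v) = deriv (Th β) (u + v) := by rw [Cf]; field_simp
  have c2 : Cf β (u - v) * Th β (u - v) = deriv (Th β) (u - v) := by rw [Cf]; field_simp
  have c3 : Cf β v * Th β v = deriv (Th β) v := by rw [Cf]; field_simp
  rw [← c1, ← c2, ← c3] at key
  have n : Th β v ^ 2 * Th β u ^ 2 ≠ 0 := mul_ne_zero (pow_ne_zero _ n2) (pow_ne_zero _ n1)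
  apply mul_left_cancel₀ n
  push_cast at key
  linear_combination -key + (Cf β (u + v) - Cf β (u - v)) * hp

lemma Df_surj (hβ : 0 < β) (E : ℂ) : ∃ v ∉ Lam β, Df β v = E := by
  by_contra! hne
  set g : ℂ → ℂ := fun v => (Df β v - E)⁻¹
  have l0 : Tendsto g (nhdsWithin 0 {(0 : ℂ)}ᶜ) (nhds 0) := by
    have h := tendsto_atTop_add_const_right _ (-‖E‖) (Df_norm_tendsto hβ)
    have h2 : Tendsto (fun v => ‖Df β v - E‖) (nhdsWithin 0 {(0 : ℂ)}ᶜ) atTop := by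
      refine tendsto_atTop_mono (fun v => ?_) h
      have := norm_sub_norm_le (Df β v) E
      linarith
    have := tendsto_inv_atTop_zero.comp h2
    rw [tendsto_zero_iff_norm_tendsto_zero]
    refine this.congr fun v => ?_
    simp [g]
  obtain ⟨c, hc⟩ := liouville hβ (Lam β) g (lam_discrete hβ)
    (fun v hv => ((Df_differentiableAt hβ hv).sub_const E).inv (sub_ne_zero.mpr (hne v hv)))
    (fun v _ => by simp only [g, Df_add_pi hβ]) (fun v _ => by simp only [g, Df_add_pt hβ]) (by
      intro w hw
      refine ⟨0, ?_⟩
      have := lim_shift (w := w) 0 (Eventually.of_forall fun v => by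
        conv_lhs => rw [← sub_add_cancel v w]
        simp only [g]
        rw [Df_add_lam hβ hw]) l0
      rwa [zero_add] at this)
  have hc0 : c = 0 := by
    refine tendsto_nhds_unique (tendsto_const_nhds.congr' ?_) l0
    filter_upwards [lam_discrete hβ 0] with v hv using (hc v hv).symm
  obtain ⟨v, hv⟩ := (lam_discrete hβ 0).exists
  have := hc v hv
  rw [hc0, inv_eq_zero, sub_eq_zero] at this
  exact hne v hv this

end

noncomputable section
variable {β : ℝ}

/-- the key quadratic identity -/
lemma f_sq (hβ : 0 < β) {k v : ℂ} (hk : k ∉ Lam β) (hv : v ∉ Lam β) (hvk : v + k ∉ Lam β) :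
    (Cf β (v + k) - Cf β v - Cf β k) ^ 2 = Df β (v + k) + Df β v + Df β k - 3 * kap β := by
  set T : Set ℂ := {v | v ∈ Lam β ∨ v + k ∈ Lam β} with hT
  set g : ℂ → ℂ := fun v => (Cf β (v + k) - Cf β v - Cf β k) ^ 2 - Df β (v + k) - Df β v with hg
  have Tw : ∀ w ∈ Lam β, ∀ v, v + w ∈ T ↔ v ∈ T := by
    intro w hw v
    simp only [hT, mem_setOf_eq]
    rw [show v + w + k = v + k + w by ring, add_mem_lam hw, add_mem_lam hw]
  have g1 : ∀ v, g (v + Real.pi) = g v := by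
    intro v
    simp only [hg]
    rw [show v + Real.pi + k = (v + k) + Real.pi by ring, Cf_add_pi, Cf_add_pi, Df_add_pi hβ, Df_add_pi hβ]
  have g2 : ∀ v ∉ T, g (v + pt β) = g v := by
    intro v hv
    simp only [hT, mem_setOf_eq, not_or] at hv
    simp only [hg]
    rw [show v + pt β + k = (v + k) + pt β by ring, Cf_add_pt hβ hv.1, Cf_add_pt hβ hv.2,
      Df_add_pt hβ, Df_add_pt hβ]
    ring
  have gw : ∀ w ∈ Lam β, ∀ v ∉ T, g (v + w) = g v := by
    intro w hw v hv
    have := (lam_ind (p := fun z => z ∉ T → g z = g v) (β := β)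
      (fun z => by rw [Tw _ pi_mem, g1])
      (fun z => by
        rw [Tw _ pt_mem]
        exact ⟨fun h hz => by rw [← g2 z hz]; exact h hz, fun h hz => by rw [g2 z hz]; exact h hz⟩) hw v).mpr (fun _ => rfl)
    exact this (by rwa [Tw w hw])
  have hTd : ∀ v, ∀ᶠ w in nhdsWithin v {v}ᶜ, w ∉ T := by
    intro v
    have h1 := lam_discrete hβ v
    have t1 : Tendsto (fun w => w + k) (nhdsWithin v {v}ᶜ) (nhdsWithin (v + k) {v + k}ᶜ) := by
      apply tendsto_nhdsWithin_of_tendsto_nhds_of_eventually_within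
      · have : ContinuousAt (fun w => w + k) v := by fun_prop
        exact this.tendsto.mono_left nhdsWithin_le_nhds
      · filter_upwards [self_mem_nhdsWithin] with w hw
        simpa using hw
    filter_upwards [h1, t1.eventually (lam_discrete hβ (v + k))] with w a b
    simp only [hT, mem_setOf_eq, not_or]; exact ⟨a, b⟩
  have gs : ∀ v, g (-k - v) = g v := by
    intro v
    simp only [hg]
    rw [show -k - v + k = -v by ring, show -k - v = -(v + k) by ring, Cf_neg, Cf_neg, Df_neg hβ, Df_neg hβ]
    ring
  have l0 : Tendsto g (nhdsWithin 0 {(0 : ℂ)}ᶜ) (nhds (Df β k - 3 * kap β)) := by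
    set h : ℂ → ℂ := fun v => Cf β (v + k) - Cf β k - Rf β v with hh
    have hd : HasDerivAt h (-Df β k + kap β) 0 := by
      have a : HasDerivAt (fun v => Cf β (v + k)) (-Df β k) 0 := by
        have := Cf_hasDeriv hβ (v := 0 + k) (by rwa [zero_add])
        have := this.comp_add_const 0 k
        rwa [zero_add] at this
      have := (a.sub_const (Cf β k)).sub (Rf_analytic hβ).differentiableAt.hasDerivAt
      refine this.congr_deriv ?_
      rw [kap]; ring
    have h0 : h 0 = 0 := by simp [hh, Rf_zero hβ]
    have t1 : Tendsto h (nhdsWithin 0 {(0 : ℂ)}ᶜ) (nhds 0) := by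
      have := hd.continuousAt.tendsto.mono_left (nhdsWithin_le_nhds (s := {(0:ℂ)}ᶜ))
      rwa [h0] at this
    have t2 : Tendsto (fun v => h v / v) (nhdsWithin 0 {(0 : ℂ)}ᶜ) (nhds (-Df β k + kap β)) := by
      have := hasDerivAt_iff_tendsto_slope.mp hd
      refine this.congr fun v => ?_
      rw [slope_def_field, h0]; simp
    have t3 : Tendsto (deriv (Rf β)) (nhdsWithin 0 {(0 : ℂ)}ᶜ) (nhds (-kap β)) := by
      have := (Rf_analytic hβ).deriv.continuousAt.tendsto.mono_left (nhdsWithin_le_nhds (s := {(0:ℂ)}ᶜ))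
      rwa [kap, neg_neg]
    have t4 : Tendsto (fun v => Df β (v + k)) (nhdsWithin 0 {(0 : ℂ)}ᶜ) (nhds (Df β k)) := by
      have c : ContinuousAt (fun v => Df β (v + k)) 0 := by
        have : ContinuousAt (Df β) (0 + k) := by rw [zero_add]; exact (Df_differentiableAt hβ hk).continuousAt
        exact ContinuousAt.comp (f := fun v => v + k) this (by fun_prop)
      have := c.tendsto.mono_left (nhdsWithin_le_nhds (s := {(0:ℂ)}ᶜ))
      simpa using this
    have t := (((t1.pow 2).sub (t2.const_mul 2)).add t3).sub t4
    have e : (0:ℂ) ^ 2 - 2 * (-Df β k + kap β) + -kap β - Df β k = Df β k - 3 * kap β := by ring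
    rw [e] at t
    refine t.congr' ?_
    filter_upwards [Cf_local hβ, Df_local hβ, self_mem_nhdsWithin] with v a b hv
    have hv : v ≠ 0 := hv
    simp only [hg]
    rw [a, b]
    have : Cf β (v + k) = h v + Cf β k + Rf β v := by simp only [hh]; ring
    rw [this]
    field_simp
    ring
  have gw' : ∀ w ∈ Lam β, ∀ v ∉ T, g v = g (v - w) := by
    intro w hw v hv
    have : v - w ∉ T := by
      rw [← Tw w hw]; simpa using hv
    conv_lhs => rw [← sub_add_cancel v w]
    exact gw w hw _ this
  obtain ⟨c, hc⟩ := liouville hβ T g hTd (by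
      intro v hv
      simp only [hT, mem_setOf_eq, not_or] at hv
      have d1 : DifferentiableAt ℂ (fun v => Cf β (v + k)) v :=
        ((Cf_hasDeriv hβ hv.2).comp_add_const v k).differentiableAt
      have d2 : DifferentiableAt ℂ (fun v => Df β (v + k)) v :=
        ((Df_differentiableAt hβ hv.2).hasDerivAt.comp_add_const v k).differentiableAt
      exact ((((d1.sub (Cf_hasDeriv hβ hv.1).differentiableAt).sub_const _).pow 2).sub d2).sub
        (Df_differentiableAt hβ hv.1)) (fun v _ => g1 v) g2 (by
      intro w hw
      refine ⟨Df β k - 3 * kap β, ?_⟩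
      have case1 : ∀ w ∈ Lam β, Tendsto g (nhdsWithin w {w}ᶜ) (nhds (Df β k - 3 * kap β)) := by
        intro w hw
        have := lim_shift (w := w) 0 (by
          filter_upwards [hTd (0 + w)] with v hv using gw' w hw v hv) l0
        rwa [zero_add] at this
      rcases hw with hw | hw
      · exact case1 w hw
      · have hw' : -k - w ∈ Lam β := by
          rw [show -k - w = -(w + k) by ring, neg_mem_lam]; exact hw
        have t1 : Tendsto (fun v => -k - v) (nhdsWithin w {w}ᶜ) (nhdsWithin (-k - w) {-k - w}ᶜ) := by
          apply tendsto_nhdsWithin_of_tendsto_nhds_of_eventually_within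
          · have : ContinuousAt (fun v => -k - v) w := by fun_prop
            exact this.tendsto.mono_left nhdsWithin_le_nhds
          · filter_upwards [self_mem_nhdsWithin] with v hv
            simpa using hv
        exact ((case1 _ hw').comp t1).congr fun v => gs v)
  have hc0 : c = Df β k - 3 * kap β := by
    refine tendsto_nhds_unique (tendsto_const_nhds.congr' ?_) l0
    filter_upwards [hTd 0] with v hv using (hc v hv).symm
  have := hc v (by simp only [hT, mem_setOf_eq, not_or]; exact ⟨hv, hvk⟩)
  rw [hc0] at this
  simp only [hg] at this
  linear_combination this

/-! ### real structure -/

lemma lam_coord (hβ : 0 < β) {v : ℂ} (hv : v ∈ Lam β) : ∃ m n : ℤ, v.re = m * Real.pi + n * (Real.pi / 2) ∧ v.im = n * β := by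
  obtain ⟨m, n, rfl⟩ := hv
  refine ⟨m, n, ?_, ?_⟩
  · simp [pt_re]
  · simp [pt_im]

/-- the open rectangle -/
def Rect (β : ℝ) : Set ℂ := {v | 0 < v.re ∧ v.re < Real.pi / 2 ∧ 0 < v.im ∧ v.im < β}

lemma not_lam_of_strip (hβ : 0 < β) {v : ℂ} (h1 : 0 < v.im) (h2 : v.im < β) : v ∉ Lam β := by
  intro h
  obtain ⟨m, n, -, h⟩ := lam_coord hβ h
  rw [h] at h1 h2
  have a : (0 : ℝ) < n := by by_contra hc; nlinarith
  have b : (n : ℝ) < 1 := by by_contra hc; nlinarith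
  have a' : 0 < n := by exact_mod_cast a
  have b' : n < 1 := by exact_mod_cast b
  omega

lemma not_lam_of_re (hβ : 0 < β) {v : ℂ} (h1 : 0 < v.re) (h2 : v.re < Real.pi / 2) : v ∉ Lam β := by
  intro h
  obtain ⟨m, n, h, -⟩ := lam_coord hβ h
  have hp := Real.pi_pos
  have e : v.re = ((2 * m + n : ℤ) : ℝ) * (Real.pi / 2) := by rw [h]; push_cast; ring
  rw [e] at h1 h2
  have a : (0 : ℝ) < ((2 * m + n : ℤ) : ℝ) := by by_contra hc; nlinarith
  have b : ((2 * m + n : ℤ) : ℝ) < 1 := by by_contra hc; nlinarith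
  have a' : 0 < 2 * m + n := by exact_mod_cast a
  have b' : 2 * m + n < 1 := by exact_mod_cast b
  omega

/-- `Df` is not real inside the rectangle -/
lemma Df_im_ne (hβ : 0 < β) {v : ℂ} (hv : v ∈ Rect β) : (Df β v).im ≠ 0 := by
  obtain ⟨h1, h2, h3, h4⟩ := hv
  have hl := not_lam_of_strip hβ h3 h4
  intro h
  have e : Df β ((starRingEnd ℂ) v) = Df β v := by
    rw [Df_conj hβ, Complex.conj_eq_iff_im.mpr h]
  have hp := Real.pi_pos
  rcases (Df_eq_iff hβ ((conj_mem_lam hβ).not.mpr hl) hl).mp e with h | h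
  · obtain ⟨m, n, a, b⟩ := lam_coord hβ h
    simp only [Complex.add_re, Complex.add_im, Complex.conj_re, Complex.conj_im] at a b
    have n0 : (n : ℝ) = 0 := by
      have : (n : ℝ) * β = 0 := by linarith
      rcases mul_eq_zero.mp this with h | h
      · exact h
      · exact absurd h hβ.ne'
    rw [n0] at a
    have m0 : (0 : ℝ) < m := by by_contra hc; nlinarith
    have m1 : (m : ℝ) < 1 := by by_contra hc; nlinarith
    have a' : 0 < m := by exact_mod_cast m0
    have b' : m < 1 := by exact_mod_cast m1
    omega
  · obtain ⟨m, n, a, b⟩ := lam_coord hβ h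
    simp only [Complex.sub_re, Complex.sub_im, Complex.conj_re, Complex.conj_im] at a b
    have m0 : (n : ℝ) < 0 := by by_contra hc; nlinarith
    have m1 : (-2 : ℝ) < n := by by_contra hc; nlinarith
    have a' : n < 0 := by exact_mod_cast m0
    have b' : -2 < n := by exact_mod_cast m1
    have : n = -1 := by omega
    subst this
    have : ((2 * m : ℤ) : ℝ) = 1 := by
      have h : ((2 * m : ℤ) : ℝ) * Real.pi = 1 * Real.pi := by push_cast at a ⊢; linarith
      exact mul_right_cancel₀ hp.ne' h
    have : 2 * m = 1 := by exact_mod_cast this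
    omega

lemma rect_convex : Convex ℝ (Rect β) := by
  have h1 : Rect β = {v : ℂ | 0 < v.re} ∩ ({v | v.re < Real.pi / 2} ∩ ({v | 0 < v.im} ∩ {v | v.im < β})) := by
    ext v; simp [Rect]
  rw [h1]
  exact (convex_halfSpace_re_gt _).inter ((convex_halfSpace_re_lt _).inter
    ((convex_halfSpace_im_gt _).inter (convex_halfSpace_im_lt _)))

lemma Df_im_neg (hβ : 0 < β) {v : ℂ} (hv : v ∈ Rect β) : (Df β v).im < 0 := by
  -- one point near zero
  obtain ⟨w, hw, hwn⟩ : ∃ w ∈ Rect β, (Df β w).im < 0 := by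
    have hc : ContinuousAt (fun v => (deriv (Rf β) v).im) 0 :=
      Complex.continuous_im.continuousAt.comp (Rf_analytic hβ).deriv.continuousAt
    set φ : ℝ → ℂ := fun t => t * (1 + I) with hφ
    have tφ : Tendsto φ (nhdsWithin 0 (Ioi 0)) (nhdsWithin 0 {0}ᶜ) := by
      apply tendsto_nhdsWithin_of_tendsto_nhds_of_eventually_within
      · have : Continuous φ := by fun_prop
        have := (this.tendsto 0).mono_left (nhdsWithin_le_nhds (s := Ioi (0:ℝ)))
        simpa [hφ] using this
      · filter_upwards [self_mem_nhdsWithin] with t ht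
        simp only [hφ, mem_compl_iff, mem_singleton_iff, mul_eq_zero, not_or]
        refine ⟨by exact_mod_cast (ne_of_gt ht), fun h => ?_⟩
        have := congrArg Complex.re h
        simp at this
    have e1 := tφ.eventually (Df_local hβ)
    have e2 : ∀ᶠ t in nhdsWithin (0 : ℝ) (Ioi 0), -(deriv (Rf β) (φ t)).im < -(deriv (Rf β) 0).im + 1 := by
      have := (hc.tendsto.mono_left (nhdsWithin_le_nhds (s := {0}ᶜ))).comp tφ
      have := this.neg.eventually_lt_const (lt_add_one _)
      exact this
    have e3 : ∀ᶠ t in nhdsWithin (0 : ℝ) (Ioi 0), -(deriv (Rf β) 0).im + 1 < (1 / 2) * (t ^ 2)⁻¹ := by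
      have : Tendsto (fun t : ℝ => (1 / 2) * (t ^ 2)⁻¹) (nhdsWithin (0 : ℝ) (Ioi 0)) atTop := by
        apply Tendsto.const_mul_atTop (by norm_num)
        have := (tendsto_pow_atTop (two_ne_zero)).comp (tendsto_inv_nhdsGT_zero (𝕜 := ℝ))
        exact this.congr fun t => by simp
      exact this.eventually_gt_atTop _
    have e4 : ∀ᶠ t in nhdsWithin (0 : ℝ) (Ioi 0), t ∈ Ioo 0 (min (Real.pi / 2) β) :=
      Ioo_mem_nhdsGT (lt_min (by positivity) hβ)
    obtain ⟨t, a, b, c, d⟩ := (e1.and (e2.and (e3.and e4))).exists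
    have d1 := lt_min_iff.mp d.2
    refine ⟨φ t, ⟨by simpa [hφ] using d.1, by simpa [hφ] using d1.1, by simpa [hφ] using d.1, by simpa [hφ] using d1.2⟩, ?_⟩
    rw [a]
    have : (1 : ℂ) / φ t ^ 2 = -(((1 / 2) * (t ^ 2)⁻¹ : ℝ) : ℂ) * I := by
      simp only [hφ]
      have : (t : ℂ) ≠ 0 := by exact_mod_cast d.1.ne'
      rw [mul_pow, show (1 + I) ^ 2 = 2 * I by linear_combination I_mul_I]
      push_cast
      have hI := Complex.I_ne_zero
      field_simp
      linear_combination I_mul_I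
    rw [this, Complex.sub_im]
    have h5 : (-(((1 / 2) * (t ^ 2)⁻¹ : ℝ) : ℂ) * I).im = -((1 / 2) * (t ^ 2)⁻¹) := by
      rw [← Complex.ofReal_neg, Complex.im_ofReal_mul]; simp
    rw [h5]
    linarith
  by_contra hc
  have hc : 0 < (Df β v).im := lt_of_le_of_ne (not_lt.mp hc) (Df_im_ne hβ hv).symm
  have hcont : ContinuousOn (fun v => (Df β v).im) (Rect β) := fun z hz =>
    (Complex.continuous_im.continuousAt.comp
      (Df_differentiableAt hβ (not_lam_of_strip hβ hz.2.2.1 hz.2.2.2)).continuousAt).continuousWithinAt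
  obtain ⟨z, hz, h⟩ := rect_convex.isPreconnected.intermediate_value hw hv hcont ⟨hwn.le, hc.le⟩
  exact Df_im_ne hβ hz h

end

noncomputable section
variable {β : ℝ}

/-- logarithmic derivative series of the Euler product -/
def eL (Q X : ℂ) : ℂ := ∑' n : ℕ, -Q ^ (n + 1) / (1 - Q ^ (n + 1) * X)

lemma eul_den {Q X : ℂ} {R : ℝ} (hQ : ‖Q‖ < 1) (hX : ‖X‖ ≤ R) (hR : ‖Q‖ * R < 1) (n : ℕ) :
    1 - ‖Q‖ * R ≤ ‖1 - Q ^ (n + 1) * X‖ := by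
  have h1 : ‖Q ^ (n + 1) * X‖ ≤ ‖Q‖ * R := by
    rw [norm_mul, norm_pow]
    have : ‖Q‖ ^ (n + 1) ≤ ‖Q‖ := by
      rw [pow_succ]
      exact mul_le_of_le_one_left (norm_nonneg _) (pow_le_one₀ (norm_nonneg _) hQ.le)
    exact mul_le_mul this hX (norm_nonneg _) (norm_nonneg _)
  have h2 := norm_sub_norm_le (1 : ℂ) (Q ^ (n + 1) * X)
  rw [norm_one] at h2
  linarith

lemma eul_den_ne {Q X : ℂ} {R : ℝ} (hQ : ‖Q‖ < 1) (hX : ‖X‖ ≤ R) (hR : ‖Q‖ * R < 1) (n : ℕ) :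
    1 - Q ^ (n + 1) * X ≠ 0 := by
  have := eul_den hQ hX hR n
  intro h
  rw [h, norm_zero] at this
  linarith

lemma eL_summable {Q X : ℂ} {R : ℝ} (hQ : ‖Q‖ < 1) (hX : ‖X‖ ≤ R) (hR : ‖Q‖ * R < 1) :
    Summable fun n : ℕ => -Q ^ (n + 1) / (1 - Q ^ (n + 1) * X) := by
  have hs : Summable fun n : ℕ => ‖Q‖ ^ (n + 1) / (1 - ‖Q‖ * R) :=
    ((summable_nat_add_iff 1).mpr (summable_geometric_of_lt_one (norm_nonneg _) hQ)).div_const _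
  refine Summable.of_norm_bounded hs fun n => ?_
  rw [norm_div, norm_neg, norm_pow]
  have := eul_den hQ hX hR n
  have : 0 < 1 - ‖Q‖ * R := by linarith
  gcongr

lemma eul_logDeriv {Q X : ℂ} {R : ℝ} (hQ : ‖Q‖ < 1) (hX : ‖X‖ ≤ R) (hR : ‖Q‖ * R < 1) :
    HasDerivAt (eulA Q) (eL Q X * eulA Q X) X := by
  have hne : eulA Q X ≠ 0 := eulA_ne hQ fun n h => by
    have := eul_den_ne hQ hX hR n
    rw [h, sub_self] at this; exact this rfl
  have ld : ∀ n : ℕ, logDeriv (fun X : ℂ => 1 + -(Q ^ (n + 1) * X)) X =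
      -Q ^ (n + 1) / (1 - Q ^ (n + 1) * X) := by
    intro n
    have : HasDerivAt (fun X : ℂ => 1 + -(Q ^ (n + 1) * X)) (-(Q ^ (n + 1))) X := by
      simpa using ((hasDerivAt_id X).const_mul (Q ^ (n + 1))).fun_neg.const_add 1
    rw [logDeriv_apply, this.deriv, ← sub_eq_add_neg]
  have := logDeriv_tprod_eq_tsum isOpen_univ (mem_univ X) (f := fun (n : ℕ) (X : ℂ) => 1 + -(Q ^ (n + 1) * X))
    (fun n => by rw [← sub_eq_add_neg]; exact eul_den_ne hQ hX hR n) (fun n => by fun_prop)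
    (by simp only [ld]; exact eL_summable hQ hX hR) (eul_unif hQ) hne
  simp only [ld] at this
  change logDeriv (eulA Q) X = eL Q X at this
  have h := (eulA_diff hQ X).hasDerivAt
  refine h.congr_deriv ?_
  rw [← this, logDeriv_apply]; field_simp

lemma eL_deriv {Q X : ℂ} {R : ℝ} (hQ : ‖Q‖ < 1) (hX : ‖X‖ < R) (hR : ‖Q‖ * R < 1) :
    HasDerivAt (eL Q) (∑' n : ℕ, -(Q ^ (n + 1)) ^ 2 / (1 - Q ^ (n + 1) * X) ^ 2) X := by
  have hs : Summable fun n : ℕ => ‖Q‖ ^ (n + 1) / (1 - ‖Q‖ * R) ^ 2 :=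
    ((summable_nat_add_iff 1).mpr (summable_geometric_of_lt_one (norm_nonneg _) hQ)).div_const _
  have hXb : X ∈ Metric.ball (0 : ℂ) R := by simpa using hX
  have key := fun h1 h2 => hasDerivAt_tsum_of_isPreconnected (t := Metric.ball (0 : ℂ) R) (y₀ := X) (y := X)
    (g := fun (n : ℕ) (X : ℂ) => -Q ^ (n + 1) / (1 - Q ^ (n + 1) * X))
    (g' := fun (n : ℕ) (X : ℂ) => -(Q ^ (n + 1)) ^ 2 / (1 - Q ^ (n + 1) * X) ^ 2) hs Metric.isOpen_ball
    (convex_ball 0 R).isPreconnected h1 h2 hXb (eL_summable hQ hX.le hR) hXb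
  refine key ?_ ?_
  · intro n y hy
    have hy' : ‖y‖ ≤ R := by simpa using (Metric.mem_ball.mp hy).le
    have hne := eul_den_ne hQ hy' hR n
    have a : HasDerivAt (fun X : ℂ => 1 - Q ^ (n + 1) * X) (-(Q ^ (n + 1))) y := by
      simpa using ((hasDerivAt_id y).const_mul (Q ^ (n + 1))).const_sub 1
    have := (hasDerivAt_const y (-Q ^ (n + 1))).div a hne
    refine this.congr_deriv ?_
    congr 1; ring
  · intro n y hy
    have hy' : ‖y‖ ≤ R := by simpa using (Metric.mem_ball.mp hy).le
    have := eul_den hQ hy' hR n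
    have : 0 < 1 - ‖Q‖ * R := by linarith
    rw [norm_div, norm_neg, norm_pow, norm_pow, norm_pow]
    have h1 : (‖Q‖ ^ (n + 1)) ^ 2 ≤ ‖Q‖ ^ (n + 1) := by
      rw [pow_two]
      exact mul_le_of_le_one_left (by positivity) (pow_le_one₀ (norm_nonneg _) hQ.le)
    gcongr

/-- the real series for `Df (π/2)` -/
def Fr (r : ℝ) : ℝ := 1 + 8 * ∑' n : ℕ, (-r) ^ (n + 1) / (1 + (-r) ^ (n + 1)) ^ 2

lemma Df_half (hβ : 0 < β) : Df β (Real.pi / 2) = (Fr (Real.exp (-2 * β)) : ℂ) := by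
  have hQ := qQ_norm hβ
  set Q := qQ β with hQd
  obtain ⟨R, hR1, hR⟩ : ∃ R : ℝ, 1 < R ∧ ‖Q‖ * R < 1 := by
    have : ContinuousAt (fun R : ℝ => ‖Q‖ * R) 1 := by fun_prop
    have h := this.tendsto.mono_left (nhdsWithin_le_nhds (s := Ioi (1:ℝ)))
    have h1 := h.eventually_lt_const (show ‖Q‖ * 1 < 1 by simpa using hQ)
    obtain ⟨R, h2, h3⟩ := (h1.and self_mem_nhdsWithin).exists
    exact ⟨R, h3, h2⟩
  set p : ℂ := Real.pi / 2 with hp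
  have hcx : Continuous fun v : ℂ => ‖cexp (2 * I * v)‖ := by fun_prop
  have hcy : Continuous fun v : ℂ => ‖cexp (-(2 * I * v))‖ := by fun_prop
  have X0 : cexp (2 * I * p) = -1 := by
    rw [hp, show 2 * I * ((Real.pi : ℂ) / 2) = Real.pi * I by ring, Complex.exp_pi_mul_I]
  have Y0 : cexp (-(2 * I * p)) = -1 := by
    rw [Complex.exp_neg, X0]; norm_num
  have ex : ∀ᶠ v in nhds p, ‖cexp (2 * I * v)‖ < R :=
    hcx.continuousAt.eventually_lt continuousAt_const (by simp only [X0]; simpa using hR1)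
  have ey : ∀ᶠ v in nhds p, ‖cexp (-(2 * I * v))‖ < R :=
    hcy.continuousAt.eventually_lt continuousAt_const (by simp only [Y0]; simpa using hR1)
  have es : ∀ᶠ v in nhds p, Complex.sin v ≠ 0 := by
    apply Complex.continuous_sin.continuousAt.eventually_ne
    rw [hp, Complex.sin_pi_div_two]; exact one_ne_zero
  have dX : ∀ v : ℂ, HasDerivAt (fun v : ℂ => cexp (2 * I * v)) (cexp (2 * I * v) * (2 * I)) v := by
    intro v
    have : HasDerivAt (fun v : ℂ => 2 * I * v) (2 * I) v := by
      simpa using (hasDerivAt_id v).const_mul (2 * I)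
    exact this.cexp
  have dY : ∀ v : ℂ, HasDerivAt (fun v : ℂ => cexp (-(2 * I * v))) (cexp (-(2 * I * v)) * (-(2 * I))) v := by
    intro v
    have : HasDerivAt (fun v : ℂ => -(2 * I * v)) (-(2 * I)) v := by
      simpa using ((hasDerivAt_id v).const_mul (2 * I)).fun_neg
    exact this.cexp
  have hC : Cf β =ᶠ[nhds p] fun v => Complex.cos v / Complex.sin v +
      2 * I * (cexp (2 * I * v) * eL Q (cexp (2 * I * v))) -
      2 * I * (cexp (-(2 * I * v)) * eL Q (cexp (-(2 * I * v)))) := by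
    filter_upwards [ex, ey, es] with v hx hy hs
    have a1 := eul_logDeriv hQ hx.le hR
    have a2 := eul_logDeriv hQ hy.le hR
    have b1 := a1.comp v (dX v)
    have b2 := a2.comp v (dY v)
    have b := ((Complex.hasDerivAt_sin v).mul b1).mul b2
    have n1 : eulA Q (cexp (2 * I * v)) ≠ 0 := eulA_ne hQ fun n h => by
      have := eul_den_ne hQ hx.le hR n
      rw [h, sub_self] at this; exact this rfl
    have n2 : eulA Q (cexp (-(2 * I * v))) ≠ 0 := eulA_ne hQ fun n h => by
      have := eul_den_ne hQ hy.le hR n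
      rw [h, sub_self] at this; exact this rfl
    have hT : Th β = (Complex.sin * (eulA Q ∘ fun v => cexp (2 * I * v))) * (eulA Q ∘ fun v => cexp (-(2 * I * v))) := by
      ext v; rfl
    rw [Cf, hT, b.deriv]
    simp only [Pi.mul_apply, Function.comp_apply]
    field_simp
    ring
  have hX' : ‖cexp (2 * I * p)‖ < R := by rw [X0]; simpa using hR1
  have hY' : ‖cexp (-(2 * I * p))‖ < R := by rw [Y0]; simpa using hR1
  have d1 := (eL_deriv hQ hX' hR).comp p (dX p)
  have d2 := (eL_deriv hQ hY' hR).comp p (dY p)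
  have hs0 : Complex.sin p = 1 := by rw [hp, Complex.sin_pi_div_two]
  have hc0 : Complex.cos p = 0 := by rw [hp, Complex.cos_pi_div_two]
  have d0 := (Complex.hasDerivAt_cos p).div (Complex.hasDerivAt_sin p) (by rw [hs0]; exact one_ne_zero)
  have dd := (d0.add (((dX p).mul d1).const_mul (2 * I))).sub (((dY p).mul d2).const_mul (2 * I))
  have hpl : p ∉ Lam β := by
    intro h
    obtain ⟨m, n, a, b⟩ := lam_coord hβ h
    have hpp : p = ((Real.pi / 2 : ℝ) : ℂ) := by rw [hp]; push_cast; rfl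
    rw [hpp, Complex.ofReal_re] at a
    rw [hpp, Complex.ofReal_im] at b
    have n0 : (n : ℝ) = 0 := by
      rcases mul_eq_zero.mp b.symm with h | h
      · exact h
      · exact absurd h hβ.ne'
    rw [n0] at a
    have hpi := Real.pi_pos
    have : ((2 * m : ℤ) : ℝ) = 1 := by
      have h : ((2 * m : ℤ) : ℝ) * Real.pi = 1 * Real.pi := by push_cast; linarith
      exact mul_right_cancel₀ hpi.ne' h
    have : 2 * m = 1 := by exact_mod_cast this
    omega
  have hD := (Cf_hasDeriv hβ hpl).unique (HasDerivAt.congr_of_eventuallyEq dd hC)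
  simp only [Function.comp_apply, X0, Y0, hs0, hc0] at hD
  have s1 := eL_summable (X := -1) (R := R) hQ (by simpa using hR1.le) hR
  have s2 : Summable fun n : ℕ => -(Q ^ (n + 1)) ^ 2 / (1 - Q ^ (n + 1) * (-1)) ^ 2 := by
    have hs : Summable fun n : ℕ => ‖Q‖ ^ (n + 1) / (1 - ‖Q‖ * R) ^ 2 :=
      ((summable_nat_add_iff 1).mpr (summable_geometric_of_lt_one (norm_nonneg _) hQ)).div_const _
    refine Summable.of_norm_bounded hs fun n => ?_
    have := eul_den (X := -1) hQ (by simpa using hR1.le) hR n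
    have : 0 < 1 - ‖Q‖ * R := by linarith
    rw [norm_div, norm_neg, norm_pow, norm_pow, norm_pow]
    have h1 : (‖Q‖ ^ (n + 1)) ^ 2 ≤ ‖Q‖ ^ (n + 1) := by
      rw [pow_two]
      exact mul_le_of_le_one_left (by positivity) (pow_le_one₀ (norm_nonneg _) hQ.le)
    gcongr
  have hsum : eL Q (-1) - (∑' n : ℕ, -(Q ^ (n + 1)) ^ 2 / (1 - Q ^ (n + 1) * (-1)) ^ 2) =
      -((∑' n : ℕ, (-(Real.exp (-2 * β))) ^ (n + 1) / (1 + (-(Real.exp (-2 * β))) ^ (n + 1)) ^ 2 : ℝ) : ℂ) := by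
    rw [eL, ← s1.tsum_sub s2, Complex.ofReal_tsum, ← tsum_neg]
    congr 1
    ext n
    have := eul_den_ne (X := -1) hQ (by simpa using hR1.le) hR n
    rw [hQd, qQ] at this ⊢
    push_cast
    have h2 : 1 + (-(cexp (-2 * β))) ^ (n + 1) ≠ 0 := by
      have := this; push_cast at this
      intro h; apply this; rw [← h]; ring
    have h3 : 1 - (-cexp (-2 * ↑β)) ^ (n + 1) * -1 = 1 + (-(cexp (-2 * β))) ^ (n + 1) := by ring
    rw [h3]
    field_simp
    ring
  rw [Fr]
  push_cast at hsum ⊢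
  set S := (∑' n : ℕ, -(Q ^ (n + 1)) ^ 2 / (1 - Q ^ (n + 1) * (-1)) ^ 2) with hS
  linear_combination -hD - 8 * hsum + 8 * (eL Q (-1) - S) * I_mul_I

end

noncomputable section
variable {β : ℝ}

/-- paired terms -/
def pr (m : ℕ) (r : ℝ) : ℝ :=
  r ^ (2 * m + 2) / (1 + r ^ (2 * m + 2)) ^ 2 - r ^ (2 * m + 1) / (1 - r ^ (2 * m + 1)) ^ 2

lemma Fr_term_bound {ρ r : ℝ} (h0 : 0 ≤ r) (h : r ≤ ρ) (hρ : ρ < 1) (n : ℕ) :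
    ‖(-r) ^ (n + 1) / (1 + (-r) ^ (n + 1)) ^ 2‖ ≤ ρ ^ (n + 1) / (1 - ρ) ^ 2 := by
  rw [norm_div, norm_pow, norm_pow, norm_neg, Real.norm_of_nonneg h0]
  have h1 : 1 - ρ ≤ ‖1 + (-r) ^ (n + 1)‖ := by
    have a : ‖(-r) ^ (n + 1)‖ ≤ ρ := by
      rw [norm_pow, norm_neg, Real.norm_of_nonneg h0, pow_succ]
      have : r ^ n ≤ 1 := pow_le_one₀ h0 (by linarith)
      nlinarith [pow_nonneg h0 n]
    have b := norm_sub_norm_le (1 : ℝ) (-(-r) ^ (n + 1))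
    rw [norm_one, norm_neg, sub_neg_eq_add] at b
    linarith
  have : 0 < 1 - ρ := by linarith
  have : 0 ≤ ρ := h0.trans h
  gcongr

lemma geo_summable {ρ : ℝ} (h0 : 0 ≤ ρ) (hρ : ρ < 1) : Summable fun n : ℕ => ρ ^ (n + 1) / (1 - ρ) ^ 2 :=
  ((summable_nat_add_iff 1).mpr (summable_geometric_of_lt_one h0 hρ)).div_const _

lemma Fr_summable {r : ℝ} (h0 : 0 ≤ r) (h1 : r < 1) :
    Summable fun n : ℕ => (-r) ^ (n + 1) / (1 + (-r) ^ (n + 1)) ^ 2 :=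
  Summable.of_norm_bounded (geo_summable h0 h1) (Fr_term_bound h0 le_rfl h1)

lemma Fr_cont {a ρ : ℝ} (h0 : 0 < a) (hρ : ρ < 1) : ContinuousOn Fr (Icc a ρ) := by
  by_cases haρ : a ≤ ρ
  swap
  · rw [Icc_eq_empty haρ]; exact continuousOn_empty _
  unfold Fr
  apply ContinuousOn.add continuousOn_const
  apply ContinuousOn.mul continuousOn_const
  refine continuousOn_tsum (u := fun n => ρ ^ (n + 1) / (1 - ρ) ^ 2) ?_ (geo_summable (h0.le.trans haρ) hρ) ?_
  · intro n
    apply ContinuousOn.div (by fun_prop) (by fun_prop)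
    intro x hx
    have hx0 : 0 ≤ x := h0.le.trans hx.1
    have hx1 : x < 1 := lt_of_le_of_lt hx.2 hρ
    have : |(-x) ^ (n + 1)| < 1 := by
      rw [abs_pow, abs_neg, abs_of_nonneg hx0]
      exact pow_lt_one₀ hx0 hx1 (by omega)
    have := (abs_lt.mp this).1
    exact pow_ne_zero _ (by linarith)
  · intro n x hx
    exact Fr_term_bound (h0.le.trans hx.1) hx.2 hρ n

lemma Fr_pair {r : ℝ} (h0 : 0 ≤ r) (h1 : r < 1) :
    Summable (fun m => pr m r) ∧ Fr r = 1 + 8 * ∑' m : ℕ, pr m r := by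
  have hs := Fr_summable h0 h1
  set f : ℕ → ℝ := fun n : ℕ => (-r) ^ (n + 1) / (1 + (-r) ^ (n + 1)) ^ 2 with hf
  have s1 : Summable fun m => f (2 * m) := hs.comp_injective fun a b h => by simpa using h
  have s2 : Summable fun m => f (2 * m + 1) := hs.comp_injective fun a b h => by simpa using h
  have e : ∀ m, f (2 * m) + f (2 * m + 1) = pr m r := by
    intro m
    simp only [hf, pr]
    rw [Odd.neg_pow (⟨m, rfl⟩ : Odd (2 * m + 1)), Even.neg_pow (⟨m + 1, by ring⟩ : Even (2 * m + 1 + 1))]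
    ring
  refine ⟨by simpa only [← e] using s1.add s2, ?_⟩
  rw [Fr, ← tsum_even_add_odd s1 s2, ← s1.tsum_add s2]
  simp only [e]

lemma pr_anti (m : ℕ) : StrictAntiOn (pr m) (Ioo 0 1) := by
  have hne : ∀ x ∈ Ioo (0:ℝ) 1, 0 < 1 - x ^ (2 * m + 1) ∧ 0 < 1 + x ^ (2 * m + 2) := by
    intro x hx
    have : x ^ (2 * m + 1) < 1 := pow_lt_one₀ hx.1.le hx.2 (by omega)
    have := pow_pos hx.1 (2 * m + 2)
    constructor <;> linarith
  have hd : ∀ x ∈ Ioo (0:ℝ) 1, HasDerivAt (pr m)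
      ((2 * m + 2) * x ^ (2 * m + 1) * (1 - x ^ (2 * m + 2)) / (1 + x ^ (2 * m + 2)) ^ 3 -
       (2 * m + 1) * x ^ (2 * m) * (1 + x ^ (2 * m + 1)) / (1 - x ^ (2 * m + 1)) ^ 3) x := by
    intro x hx
    obtain ⟨a, b⟩ := hne x hx
    have d1 := hasDerivAt_pow (2 * m + 2) x
    have d2 := hasDerivAt_pow (2 * m + 1) x
    have e1 := d1.div ((d1.const_add 1).pow 2) (pow_ne_zero _ b.ne')
    have e2 := d2.div ((d2.const_sub 1).pow 2) (pow_ne_zero _ a.ne')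
    refine (e1.sub e2).congr_deriv ?_
    simp only [Nat.add_sub_cancel, show 2 * m + 2 - 1 = 2 * m + 1 by omega, Pi.pow_apply]
    push_cast
    congr 1
    · field_simp; ring
    · field_simp; ring
  refine strictAntiOn_of_deriv_neg (convex_Ioo 0 1) (fun x hx => (hd x hx).continuousAt.continuousWithinAt) ?_
  rw [interior_Ioo]
  intro x hx
  rw [(hd x hx).deriv]
  obtain ⟨a, b⟩ := hne x hx
  have hx0 := hx.1
  have p1 := pow_pos hx0 (2 * m + 1)
  have p2 := pow_pos hx0 (2 * m + 2)
  have p0 := pow_pos hx0 (2 * m)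
  have k1 : (2 * m + 2) * x ^ (2 * m + 1) * (1 - x ^ (2 * m + 2)) / (1 + x ^ (2 * m + 2)) ^ 3 <
      (2 * m + 2) * x ^ (2 * m + 1) := by
    rw [div_lt_iff₀ (by positivity)]
    have c1 : 1 ≤ (1 + x ^ (2 * m + 2)) ^ 3 := one_le_pow₀ (by linarith)
    have c2 : 1 - x ^ (2 * m + 2) < (1 + x ^ (2 * m + 2)) ^ 3 := by linarith
    exact mul_lt_mul_of_pos_left c2 (by positivity)
  have k2 : (2 * m + 1) * x ^ (2 * m) * (1 + x ^ (2 * m + 1)) ≤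
      (2 * m + 1) * x ^ (2 * m) * (1 + x ^ (2 * m + 1)) / (1 - x ^ (2 * m + 1)) ^ 3 := by
    rw [le_div_iff₀ (by positivity)]
    have : (1 - x ^ (2 * m + 1)) ^ 3 ≤ 1 := pow_le_one₀ a.le (by linarith)
    exact mul_le_of_le_one_right (by positivity) this
  have k3 : (2 * m + 2) * x ^ (2 * m + 1) ≤ (2 * m + 1) * x ^ (2 * m) * (1 + x ^ (2 * m + 1)) := by
    have bern := one_add_mul_le_pow (show (-2 : ℝ) ≤ x - 1 by linarith) (2 * m + 2)
    rw [add_sub_cancel] at bern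
    push_cast at bern
    have q : x ^ (2 * m + 2) ≤ x ^ (2 * m + 1) := by
      rw [pow_succ]; exact mul_le_of_le_one_right p1.le hx.2.le
    have m0 : (0 : ℝ) ≤ m := Nat.cast_nonneg m
    have : (2 * m + 2) * x ≤ (2 * m + 1) * (1 + x ^ (2 * m + 1)) := by nlinarith
    calc (2 * m + 2) * x ^ (2 * m + 1) = x ^ (2 * m) * ((2 * m + 2) * x) := by ring
      _ ≤ x ^ (2 * m) * ((2 * m + 1) * (1 + x ^ (2 * m + 1))) := by gcongr
      _ = _ := by ring
  linarith

lemma Fr_anti : StrictAntiOn Fr (Ioo 0 1) := by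
  intro r hr s hs hrs
  obtain ⟨a1, a2⟩ := Fr_pair hr.1.le hr.2
  obtain ⟨b1, b2⟩ := Fr_pair hs.1.le hs.2
  rw [a2, b2]
  have : ∑' m, pr m s < ∑' m, pr m r :=
    Summable.tsum_lt_tsum (i := 0) (fun m => (pr_anti m hr hs hrs).le) (pr_anti 0 hr hs hrs) b1 a1
  linarith

lemma Fr_pos : 0 < Fr (1 / 20) := by
  have h : ‖∑' n : ℕ, (-(1/20 : ℝ)) ^ (n + 1) / (1 + (-(1/20 : ℝ)) ^ (n + 1)) ^ 2‖ ≤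
      ∑' n : ℕ, (1/20 : ℝ) ^ (n + 1) / (1 - (1/20 : ℝ)) ^ 2 :=
    tsum_of_norm_bounded (geo_summable (by norm_num) (by norm_num)).hasSum
      (Fr_term_bound (by norm_num) le_rfl (by norm_num))
  have e : ∑' n : ℕ, (1/20 : ℝ) ^ (n + 1) / (1 - (1/20 : ℝ)) ^ 2 = (1 / 20) / (1 - 1/20) ^ 3 := by
    simp only [pow_succ (1/20 : ℝ)]
    rw [tsum_div_const, tsum_mul_right, tsum_geometric_of_lt_one (by norm_num) (by norm_num)]
    norm_num
  rw [e, Real.norm_eq_abs] at h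
  have := (abs_le.mp h).1
  rw [Fr]
  norm_num at this ⊢
  linarith

lemma Fr_neg : Fr (1 / 2) < 0 := by
  obtain ⟨a1, a2⟩ := Fr_pair (r := 1 / 2) (by norm_num) (by norm_num)
  rw [a2, a1.tsum_eq_zero_add]
  have hn : ∀ m, pr m (1 / 2) ≤ 0 := by
    intro m
    rw [pr, sub_nonpos]
    have p1 : (0 : ℝ) < (1 / 2) ^ (2 * m + 1) := by positivity
    have p2 : (1 / 2 : ℝ) ^ (2 * m + 1) < 1 := pow_lt_one₀ (by norm_num) (by norm_num) (by omega)
    have p3 : (0 : ℝ) < (1 / 2) ^ (2 * m + 2) := by positivity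
    have p4 : (1 / 2 : ℝ) ^ (2 * m + 2) ≤ (1 / 2 : ℝ) ^ (2 * m + 1) := by
      rw [pow_succ]; exact mul_le_of_le_one_right p1.le (by norm_num)
    have q1 : (1 / 2 : ℝ) ^ (2 * m + 2) / (1 + (1 / 2) ^ (2 * m + 2)) ^ 2 ≤ (1 / 2) ^ (2 * m + 2) :=
      div_le_self p3.le (one_le_pow₀ (by linarith))
    have q2 : (1 / 2 : ℝ) ^ (2 * m + 1) ≤ (1 / 2) ^ (2 * m + 1) / (1 - (1 / 2) ^ (2 * m + 1)) ^ 2 := by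
      rw [le_div_iff₀ (pow_pos (by linarith) 2)]
      exact mul_le_of_le_one_right p1.le (pow_le_one₀ (by linarith) (by linarith))
    linarith
  have h2 : ∑' m, pr (m + 1) (1 / 2) ≤ 0 := tsum_nonpos fun m => hn _
  have h3 : pr 0 (1 / 2) < -1 := by norm_num [pr]
  linarith

lemma exists_beta : ∃ β : ℝ, 0 < β ∧ Df β (Real.pi / 2) = 0 := by
  have hc := Fr_cont (a := 1 / 20) (ρ := 1 / 2) (by norm_num) (by norm_num)
  obtain ⟨r, hr, h⟩ := intermediate_value_Icc' (show (1 / 20 : ℝ) ≤ 1 / 2 by norm_num) hc ⟨Fr_neg.le, Fr_pos.le⟩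
  have r0 : 0 < r := lt_of_lt_of_le (by norm_num) hr.1
  have r1 : r < 1 := lt_of_le_of_lt hr.2 (by norm_num)
  have hb : 0 < -(Real.log r) / 2 := by have := Real.log_neg r0 r1; linarith
  refine ⟨-(Real.log r) / 2, hb, ?_⟩
  rw [Df_half hb, show -2 * (-Real.log r / 2) = Real.log r by ring, Real.exp_log r0, h]; simp

lemma unique_beta {β β' : ℝ} (h : 0 < β) (h' : 0 < β') (e : Df β (Real.pi / 2) = 0)
    (e' : Df β' (Real.pi / 2) = 0) : β = β' := by
  rw [Df_half h] at e
  rw [Df_half h'] at e'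
  have mem : ∀ β : ℝ, 0 < β → Real.exp (-2 * β) ∈ Ioo (0:ℝ) 1 := fun β hβ =>
    ⟨Real.exp_pos _, by rw [Real.exp_lt_one_iff]; linarith⟩
  have e1 : Fr (Real.exp (-2 * β)) = 0 := by exact_mod_cast e
  have e2 : Fr (Real.exp (-2 * β')) = 0 := by exact_mod_cast e'
  have := Fr_anti.injOn (mem β h) (mem β' h') (e1.trans e2.symm)
  have := Real.exp_injective this
  linarith

end

noncomputable section
variable {β : ℝ}

lemma lam_countable : (Lam β).Countable := by
  have : Lam β = range fun p : ℤ × ℤ => (p.1 * Real.pi + p.2 * pt β : ℂ) := by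
    ext v; simp only [Lam, mem_setOf_eq, mem_range, Prod.exists]
    exact ⟨fun ⟨m, n, h⟩ => ⟨m, n, h.symm⟩, fun ⟨m, n, h⟩ => ⟨m, n, h.symm⟩⟩
  rw [this]; exact countable_range _

lemma lam_compl_preconnected : IsPreconnected (Lam β)ᶜ :=
  (lam_countable.isConnected_compl_of_one_lt_rank (by rw [Complex.rank_real_complex]; norm_num)).isPreconnected

lemma half_not_lam (hβ : 0 < β) : (Real.pi / 2 : ℂ) ∉ Lam β := by
  intro h
  obtain ⟨m, n, a, b⟩ := lam_coord hβ h
  have hpp : (Real.pi / 2 : ℂ) = ((Real.pi / 2 : ℝ) : ℂ) := by push_cast; rfl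
  rw [hpp, Complex.ofReal_re] at a
  rw [hpp, Complex.ofReal_im] at b
  have n0 : (n : ℝ) = 0 := by
    rcases mul_eq_zero.mp b.symm with h | h
    · exact h
    · exact absurd h hβ.ne'
  rw [n0] at a
  have hpi := Real.pi_pos
  have : ((2 * m : ℤ) : ℝ) = 1 := by
    have h : ((2 * m : ℤ) : ℝ) * Real.pi = 1 * Real.pi := by push_cast; linarith
    exact mul_right_cancel₀ hpi.ne' h
  have : 2 * m = 1 := by exact_mod_cast this
  omega

lemma Cf_half : Cf β (Real.pi / 2) = 0 := by
  have h := Cf_add_pi (β := β) (-(Real.pi / 2 : ℂ))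
  rw [show -(Real.pi / 2 : ℂ) + Real.pi = Real.pi / 2 by ring, Cf_neg] at h
  have : Cf β (Real.pi / 2) + Cf β (Real.pi / 2) = 0 := by linear_combination h
  simpa using this

/-- the normalising data of a rhombic lattice -/
lemma transfer (W : WeierstrassData) (hW : W.IsRhombic) : ∃ s β : ℝ, 0 < s ∧ 0 < β ∧
    W.w1 = s * (Real.pi / 2) ∧ W.w3 = s * (pt β / 2) ∧ (∀ v : ℂ, s * v ∈ W.lattice ↔ v ∈ Lam β) ∧
    (∀ v ∉ Lam β, s ^ 2 * W.P (s * v) = Df β v - kap β) ∧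
    (∀ v ∉ Lam β, s * W.Z (s * v) = Cf β v + kap β * v) := by
  obtain ⟨h1, h2, h3, h4⟩ := hW
  have hpi := Real.pi_pos
  set w := W.w1.re with hw
  set s : ℝ := 2 * w / Real.pi with hs
  set β : ℝ := Real.pi * W.w3.im / w with hβd
  have hs0 : 0 < s := by positivity
  have hβ : 0 < β := by positivity
  have hsC : (s : ℂ) ≠ 0 := by exact_mod_cast hs0.ne'
  have e1 : W.w1 = s * (Real.pi / 2) := by
    rw [show (s : ℂ) * (Real.pi / 2) = ((s * (Real.pi / 2) : ℝ) : ℂ) by push_cast; ring]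
    apply Complex.ext
    · rw [Complex.ofReal_re, hs]; field_simp; rfl
    · rw [h1, Complex.ofReal_im]
  have e3 : W.w3 = s * (pt β / 2) := by
    rw [show (s : ℂ) * (pt β / 2) = ((s / 2 : ℝ) : ℂ) * pt β by push_cast; ring]
    apply Complex.ext
    · rw [Complex.re_ofReal_mul, pt_re, h3, hs]; field_simp
    · rw [Complex.im_ofReal_mul, pt_im, hs, hβd]; field_simp
  have hlat : ∀ v : ℂ, s * v ∈ W.lattice ↔ v ∈ Lam β := by
    intro v
    constructor
    · rintro ⟨m, n, h⟩
      refine ⟨m, n, mul_left_cancel₀ hsC ?_⟩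
      rw [h, e1, e3]; ring
    · rintro ⟨m, n, h⟩
      refine ⟨m, n, ?_⟩
      rw [h, e1, e3]; ring
  have hdP : ∀ v ∉ Lam β, DifferentiableAt ℂ (fun v => W.P (s * v)) v := fun v hv =>
    DifferentiableAt.comp v (W.P_diff _ ((hlat v).not.mpr hv)) (by fun_prop)
  have hP : ∀ v ∉ Lam β, s ^ 2 * W.P (s * v) = Df β v - kap β := by
    set g : ℂ → ℂ := fun v => s ^ 2 * W.P (s * v) - Df β v with hg
    have gw : ∀ w ∈ Lam β, ∀ v, g (v + w) = g v := by
      intro w hw v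
      simp only [hg]
      rw [Df_add_lam hβ hw, mul_add, W.P_periodic _ ((hlat w).mpr hw)]
    have l0 : Tendsto g (nhdsWithin 0 {(0 : ℂ)}ᶜ) (nhds (-kap β)) := by
      have t : Tendsto (fun v : ℂ => s * v) (nhdsWithin 0 {(0 : ℂ)}ᶜ) (nhdsWithin 0 {(0 : ℂ)}ᶜ) := by
        apply tendsto_nhdsWithin_of_tendsto_nhds_of_eventually_within
        · have : ContinuousAt (fun v : ℂ => s * v) 0 := by fun_prop
          have := this.tendsto.mono_left (nhdsWithin_le_nhds (s := {(0:ℂ)}ᶜ))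
          simpa using this
        · filter_upwards [self_mem_nhdsWithin] with v hv
          exact mul_ne_zero hsC hv
      have := (((W.P_pole.comp t).const_mul ((s : ℂ) ^ 2)).sub (Df_pole hβ))
      simp only [mul_zero, zero_sub] at this
      refine this.congr' ?_
      filter_upwards [self_mem_nhdsWithin] with v hv
      have hv : v ≠ 0 := hv
      simp only [hg, Function.comp_apply]
      field_simp
      ring
    obtain ⟨c, hc⟩ := liouville hβ (Lam β) g (lam_discrete hβ)
      (fun v hv => ((hdP v hv).const_mul _).sub (Df_differentiableAt hβ hv))
      (fun v _ => gw _ pi_mem v) (fun v _ => gw _ pt_mem v) (by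
        intro w hw
        refine ⟨-kap β, ?_⟩
        have := lim_shift (w := w) 0 (Eventually.of_forall fun v => by
          conv_lhs => rw [← sub_add_cancel v w]
          rw [gw w hw]) l0
        rwa [zero_add] at this)
    have hc0 : c = -kap β := by
      refine tendsto_nhds_unique (tendsto_const_nhds.congr' ?_) l0
      filter_upwards [lam_discrete hβ 0] with v hv using (hc v hv).symm
    intro v hv
    have := hc v hv
    simp only [hg, hc0] at this
    linear_combination this
  refine ⟨s, β, hs0, hβ, e1, e3, hlat, hP, ?_⟩
  set h : ℂ → ℂ := fun v => s * W.Z (s * v) - Cf β v - kap β * v with hh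
  have hd : ∀ v ∉ Lam β, HasDerivAt h 0 v := by
    intro v hv
    have hl := (hlat v).not.mpr hv
    have a : HasDerivAt (fun v : ℂ => W.Z (s * v)) (-W.P (s * v) * s) v := by
      have b := (W.Z_diff _ hl).hasDerivAt
      rw [W.Z_deriv _ hl] at b
      have c : HasDerivAt (fun v : ℂ => (s : ℂ) * v) s v := by
        simpa using (hasDerivAt_id v).const_mul (s : ℂ)
      exact b.comp v c
    have d : HasDerivAt (fun v : ℂ => kap β * v) (kap β) v := by
      simpa using (hasDerivAt_id v).const_mul (kap β)
    refine (((a.const_mul (s : ℂ)).sub (Cf_hasDeriv hβ hv)).sub d).congr_deriv ?_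
    linear_combination -hP v hv
  intro v hv
  have hconst := (lam_closed hβ).isOpen_compl.is_const_of_deriv_eq_zero lam_compl_preconnected
    (f := h) (fun v hv => (hd v hv).differentiableAt.differentiableWithinAt)
    (fun v hv => (hd v hv).deriv) (x := v) (y := -v) hv (by rw [mem_compl_iff, neg_mem_lam]; exact hv)
  have hodd : h (-v) = - h v := by
    simp only [hh]
    rw [mul_neg, W.Z_odd, Cf_neg]; ring
  rw [hodd] at hconst
  have : h v = 0 := by
    have : h v + h v = 0 := by linear_combination hconst
    simpa using this
  simp only [hh] at this
  linear_combination this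

/-- consequences in terms of `η₁` -/
lemma transfer' (W : WeierstrassData) {s β : ℝ} (hs : 0 < s) (hβ : 0 < β)
    (h1 : W.w1 = s * (Real.pi / 2))
    (hP : ∀ v ∉ Lam β, s ^ 2 * W.P (s * v) = Df β v - kap β)
    (hZ : ∀ v ∉ Lam β, s * W.Z (s * v) = Cf β v + kap β * v) {v : ℂ} (hv : v ∉ Lam β) :
    W.Z W.w1 + W.w1 * W.P (s * v) = ((Real.pi / (2 * s) : ℝ) : ℂ) * Df β v ∧
    W.Z W.w1 * (s * v) - W.w1 * W.Z (s * v) = -((Real.pi / 2 : ℝ) : ℂ) * Cf β v := by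
  have hsC : (s : ℂ) ≠ 0 := by exact_mod_cast hs.ne'
  have a := hZ _ (half_not_lam hβ)
  rw [Cf_half, ← h1] at a
  have b := hP v hv
  have c := hZ v hv
  constructor
  · apply mul_left_cancel₀ (pow_ne_zero 2 hsC)
    have hc : (s : ℂ) ^ 2 * ((Real.pi / (2 * s) : ℝ) : ℂ) = s * (Real.pi / 2) := by
      push_cast; field_simp
    rw [← mul_assoc, hc]
    linear_combination s * a + s * (Real.pi / 2) * b + s ^ 2 * W.P (s * v) * h1
  · push_cast
    linear_combination v * a - (Real.pi / 2) * c - W.Z (s * v) * h1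

lemma half_pt_rect (hβ : 0 < β) : pt β / 2 ∈ Rect β := by
  have hpi := Real.pi_pos
  have e : pt β / 2 = ((1 / 2 : ℝ) : ℂ) * pt β := by push_cast; ring
  rw [Rect, mem_setOf_eq, e, Complex.re_ofReal_mul, Complex.im_ofReal_mul, pt_re, pt_im]
  refine ⟨by positivity, by linarith, by positivity, by linarith⟩

lemma conj_pt : (starRingEnd ℂ) (pt β) = Real.pi - pt β := by
  unfold pt
  rw [map_add, map_mul, Complex.conj_ofReal, Complex.conj_I, map_div₀, Complex.conj_ofReal, map_ofNat]
  ring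

lemma half2_eq : (Real.pi / 2 + pt β / 2 : ℂ) = (starRingEnd ℂ) (pt β / 2) + pt β := by
  rw [map_div₀, conj_pt, map_ofNat]; ring

lemma rect_not_lam (hβ : 0 < β) {v : ℂ} (hv : v ∈ Rect β) : v ∉ Lam β :=
  not_lam_of_strip hβ hv.2.2.1 hv.2.2.2

lemma half2_not_lam (hβ : 0 < β) : (Real.pi / 2 + pt β / 2 : ℂ) ∉ Lam β := by
  rw [half2_eq, add_mem_lam pt_mem, conj_mem_lam hβ]
  exact rect_not_lam hβ (half_pt_rect hβ)

lemma Df_half2 (hβ : 0 < β) : Df β (Real.pi / 2 + pt β / 2) = (starRingEnd ℂ) (Df β (pt β / 2)) := by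
  rw [half2_eq, Df_add_pt hβ, Df_conj hβ]

/-- normalised invariants -/
def J2 (β : ℝ) : ℂ := -4 * ((Df β (Real.pi / 2) - kap β) * (Df β (Real.pi / 2 + pt β / 2) - kap β) +
  (Df β (Real.pi / 2) - kap β) * (Df β (pt β / 2) - kap β) +
  (Df β (Real.pi / 2 + pt β / 2) - kap β) * (Df β (pt β / 2) - kap β))
def J3 (β : ℝ) : ℂ := 4 * ((Df β (Real.pi / 2) - kap β) * (Df β (Real.pi / 2 + pt β / 2) - kap β) *
  (Df β (pt β / 2) - kap β))

lemma jInv_eq (W : WeierstrassData) {s β : ℝ} (hs : 0 < s) (hβ : 0 < β)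
    (h1 : W.w1 = s * (Real.pi / 2)) (h3 : W.w3 = s * (pt β / 2))
    (hP : ∀ v ∉ Lam β, s ^ 2 * W.P (s * v) = Df β v - kap β) :
    W.jInv = 1728 * J2 β ^ 3 / (J2 β ^ 3 - 27 * J3 β ^ 2) := by
  have hsC : (s : ℂ) ≠ 0 := by exact_mod_cast hs.ne'
  have a1 := hP _ (half_not_lam hβ)
  have a3 := hP _ (rect_not_lam hβ (half_pt_rect hβ))
  have a2 := hP _ (half2_not_lam hβ)
  rw [← h1] at a1
  rw [← h3] at a3
  rw [mul_add, ← h1, ← h3] at a2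
  change (s : ℂ) ^ 2 * W.e1 = _ at a1
  change (s : ℂ) ^ 2 * W.e2 = _ at a2
  change (s : ℂ) ^ 2 * W.e3 = _ at a3
  have b2 : J2 β = s ^ 4 * W.g2 := by
    rw [J2, ← a1, ← a2, ← a3, WeierstrassData.g2]; ring
  have b3 : J3 β = s ^ 6 * W.g3 := by
    rw [J3, ← a1, ← a2, ← a3, WeierstrassData.g3]; ring
  rw [b2, b3, WeierstrassData.jInv]
  rw [show 1728 * ((s : ℂ) ^ 4 * W.g2) ^ 3 = s ^ 12 * (1728 * W.g2 ^ 3) by ring,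
    show ((s : ℂ) ^ 4 * W.g2) ^ 3 - 27 * (s ^ 6 * W.g3) ^ 2 = s ^ 12 * (W.g2 ^ 3 - 27 * W.g3 ^ 2) by ring]
  rw [mul_div_mul_left _ _ (pow_ne_zero _ hsC)]

lemma latticeSet_eq : latticeSet (Real.pi / 2) (pt β / 2) = Lam β := by
  ext v
  constructor
  · rintro ⟨m, n, h⟩; exact ⟨m, n, by rw [h]; ring⟩
  · rintro ⟨m, n, h⟩; exact ⟨m, n, by rw [h]; ring⟩

/-- the Weierstrass data attached to `β` -/
def mkW (β : ℝ) (hβ : 0 < β) : WeierstrassData where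
  w1 := Real.pi / 2
  w3 := pt β / 2
  P := fun v => Df β v - kap β
  Z := fun v => Cf β v + kap β * v
  S := fun v => cexp (kap β * v ^ 2 / 2) * Th β v / deriv (Th β) 0
  w1_ne := fun h => by
    have : (Real.pi / 2 : ℂ) ∉ Lam β := half_not_lam hβ
    rw [h] at this; exact this zero_mem_lam
  indep := fun r h => by
    have h' := congrArg Complex.im h
    rw [show pt β / 2 = ((1 / 2 : ℝ) : ℂ) * pt β by push_cast; ring, Complex.im_ofReal_mul,
      Complex.im_ofReal_mul, pt_im, show (Real.pi / 2 : ℂ) = ((Real.pi / 2 : ℝ) : ℂ) by push_cast; rfl,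
      Complex.ofReal_im] at h'
    linarith
  P_diff := fun v hv => by
    rw [latticeSet_eq] at hv
    exact (Df_differentiableAt hβ hv).sub_const _
  P_periodic := fun w hw v => by
    rw [latticeSet_eq] at hw
    rw [Df_add_lam hβ hw]
  P_pole := by
    have := (Df_pole hβ).sub_const (kap β)
    rw [sub_self] at this
    exact this.congr fun v => by ring
  Z_diff := fun v hv => by
    rw [latticeSet_eq] at hv
    exact (Cf_hasDeriv hβ hv).differentiableAt.add (by fun_prop)
  Z_deriv := fun v hv => by
    rw [latticeSet_eq] at hv
    have d : HasDerivAt (fun v : ℂ => kap β * v) (kap β) v := by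
      simpa using (hasDerivAt_id v).const_mul (kap β)
    rw [((Cf_hasDeriv hβ hv).fun_add d).deriv]; ring
  Z_odd := fun v => by rw [Cf_neg]; ring
  S_diff := by
    have := Th_diff hβ
    fun_prop
  S_ne := fun v hv => by
    rw [latticeSet_eq] at hv
    exact div_ne_zero (mul_ne_zero (Complex.exp_ne_zero _) (Th_ne hβ hv)) (Th_deriv_zero hβ)
  S_deriv := fun v hv => by
    rw [latticeSet_eq] at hv
    have d : HasDerivAt (fun v : ℂ => kap β * v ^ 2 / 2) (kap β * v) v := by
      have := ((hasDerivAt_pow 2 v).const_mul (kap β)).div_const 2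
      refine this.congr_deriv ?_
      push_cast; ring
    have e := (d.cexp.fun_mul (Th_diff hβ v).hasDerivAt).div_const (deriv (Th β) 0)
    rw [e.deriv, Cf]
    have := Th_ne hβ hv
    have := Th_deriv_zero hβ
    field_simp
    ring
  S_norm := by
    have c : ContinuousAt (fun v => cexp (kap β * v ^ 2 / 2) * Td β v / deriv (Th β) 0) 0 := by
      have := (Td_diff hβ).continuous.continuousAt (x := 0)
      have := Th_deriv_zero hβ
      fun_prop
    have t := c.tendsto.mono_left (nhdsWithin_le_nhds (s := {(0:ℂ)}ᶜ))
    have e : cexp (kap β * 0 ^ 2 / 2) * Td β 0 / deriv (Th β) 0 = 1 := by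
      rw [Td_zero]
      have := Th_deriv_zero hβ
      simp [this]
    rw [e] at t
    refine t.congr' ?_
    filter_upwards [self_mem_nhdsWithin] with v hv
    have hv : v ≠ 0 := hv
    rw [Td_mul hβ]
    field_simp

lemma mkW_rhombic (hβ : 0 < β) : (mkW β hβ).IsRhombic := by
  have e : (Real.pi / 2 : ℂ) = ((Real.pi / 2 : ℝ) : ℂ) := by push_cast; rfl
  have e3 : pt β / 2 = ((1 / 2 : ℝ) : ℂ) * pt β := by push_cast; ring
  have hpi := Real.pi_pos
  refine ⟨?_, ?_, ?_, ?_⟩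
  · change (Real.pi / 2 : ℂ).im = 0
    rw [e, Complex.ofReal_im]
  · change 0 < (Real.pi / 2 : ℂ).re
    rw [e, Complex.ofReal_re]; positivity
  · change (pt β / 2).re = (Real.pi / 2 : ℂ).re / 2
    rw [e, e3, Complex.ofReal_re, Complex.re_ofReal_mul, pt_re]; ring
  · change 0 < (pt β / 2).im
    rw [e3, Complex.im_ofReal_mul, pt_im]; positivity

/-- first part of the theorem -/
lemma part_one : ∃ Wst : WeierstrassData, Wst.IsRhombic ∧
      Wst.Z Wst.w1 + Wst.w1 * Wst.e1 = 0 ∧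
      ∀ W : WeierstrassData, W.IsRhombic →
        (W.Z W.w1 + W.w1 * W.e1 = 0 ∨ W.Z W.w1 + W.w1 * W.e2 = 0 ∨
          W.Z W.w1 + W.w1 * W.e3 = 0) →
        (W.Z W.w1 + W.w1 * W.e1 = 0 ∧ W.jInv = Wst.jInv) := by
  obtain ⟨β, hβ, hD⟩ := exists_beta
  refine ⟨mkW β hβ, mkW_rhombic hβ, ?_, ?_⟩
  · change Cf β (Real.pi / 2) + kap β * (Real.pi / 2) + (Real.pi / 2) * (Df β (Real.pi / 2) - kap β) = 0
    rw [Cf_half, hD]; ring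
  · intro W hW hor
    obtain ⟨s, β', hs, hβ', h1, h3, hlat, hP, hZ⟩ := transfer W hW
    have hpi := Real.pi_pos
    have hc : ((Real.pi / (2 * s) : ℝ) : ℂ) ≠ 0 := by
      have : 0 < Real.pi / (2 * s) := by positivity
      exact_mod_cast this.ne'
    have t1 := (transfer' W hs hβ' h1 hP hZ (half_not_lam hβ')).1
    have t3 := (transfer' W hs hβ' h1 hP hZ (rect_not_lam hβ' (half_pt_rect hβ'))).1
    have t2 := (transfer' W hs hβ' h1 hP hZ (half2_not_lam hβ')).1
    rw [← h1] at t1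
    rw [← h3] at t3
    rw [mul_add, ← h1, ← h3] at t2
    change W.Z W.w1 + W.w1 * W.e1 = _ at t1
    change W.Z W.w1 + W.w1 * W.e2 = _ at t2
    change W.Z W.w1 + W.w1 * W.e3 = _ at t3
    have im := Df_im_neg hβ' (half_pt_rect hβ')
    have key : Df β' (Real.pi / 2) = 0 := by
      rcases hor with h | h | h
      · rw [h, eq_comm] at t1
        exact (mul_eq_zero.mp t1).resolve_left hc
      · rw [h, eq_comm] at t2
        have := (mul_eq_zero.mp t2).resolve_left hc
        rw [Df_half2 hβ'] at this
        have := congrArg Complex.im this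
        rw [Complex.conj_im] at this
        simp only [Complex.zero_im] at this
        linarith
      · rw [h, eq_comm] at t3
        have := (mul_eq_zero.mp t3).resolve_left hc
        rw [this] at im
        simp at im
    refine ⟨by rw [t1, key, mul_zero], ?_⟩
    have hb := unique_beta hβ' hβ key hD
    subst hb
    rw [jInv_eq W hs hβ' h1 h3 hP]
    refine (jInv_eq (mkW β' hβ) one_pos hβ' ?_ ?_ ?_).symm
    · change (Real.pi / 2 : ℂ) = _
      push_cast; ring
    · change (pt β' / 2 : ℂ) = _
      push_cast; ring
    · intro v _
      change _ * (Df β' _ - kap β') = _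
      push_cast; rw [one_mul]; ring

end

noncomputable section
variable {β : ℝ}

lemma half_cast : ((Real.pi / 2 : ℝ) : ℂ) = Real.pi / 2 := by push_cast; rfl

lemma ibeta_eq : (β : ℂ) * I = -(Real.pi / 2) + pt β := by unfold pt; ring

lemma real_not_lam (hβ : 0 < β) {x : ℝ} (h0 : 0 < x) (h1 : x ≤ Real.pi / 2) : (x : ℂ) ∉ Lam β := by
  rcases h1.lt_or_eq with h | h
  · exact not_lam_of_re hβ (by simpa using h0) (by simpa using h)
  · rw [h, half_cast]; exact half_not_lam hβ

lemma imag_not_lam (hβ : 0 < β) {y : ℝ} (h0 : 0 < y) (h1 : y ≤ β) : (y * I : ℂ) ∉ Lam β := by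
  rcases h1.lt_or_eq with h | h
  · exact not_lam_of_strip hβ (by simpa using h0) (by simpa using h)
  · rw [h, ibeta_eq, add_mem_lam pt_mem, neg_mem_lam]; exact half_not_lam hβ

lemma Df_real (hβ : 0 < β) (x : ℝ) : Df β x = ((Df β x).re : ℂ) := by
  have := Df_conj hβ (x : ℂ)
  rw [Complex.conj_ofReal, eq_comm, Complex.conj_eq_iff_re] at this
  exact this.symm

lemma Cf_real (x : ℝ) : Cf β x = ((Cf β x).re : ℂ) := by
  have := Cf_conj (β := β) (x : ℂ)
  rw [Complex.conj_ofReal, eq_comm, Complex.conj_eq_iff_re] at this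
  exact this.symm

lemma conj_imag (y : ℝ) : (starRingEnd ℂ) (y * I) = -(y * I) := by
  rw [map_mul, Complex.conj_ofReal, Complex.conj_I]; ring

lemma Df_imag (hβ : 0 < β) (y : ℝ) : Df β (y * I) = ((Df β (y * I)).re : ℂ) := by
  have := Df_conj hβ (y * I : ℂ)
  rw [conj_imag, Df_neg hβ, eq_comm, Complex.conj_eq_iff_re] at this
  exact this.symm

lemma Cf_imag (y : ℝ) : (Cf β (y * I)).re = 0 := by
  have := Cf_conj (β := β) (y * I : ℂ)
  rw [conj_imag, Cf_neg] at this
  have := congrArg Complex.re this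
  rw [Complex.neg_re, Complex.conj_re] at this
  linarith

lemma Df_ibeta (hβ : 0 < β) : Df β (β * I) = Df β (Real.pi / 2) := by
  rw [ibeta_eq, Df_add_pt hβ, Df_neg hβ]

lemma Cf_ibeta (hβ : 0 < β) : Cf β (β * I) = - (2 * I) := by
  rw [ibeta_eq, Cf_add_pt hβ (by rw [neg_mem_lam]; exact half_not_lam hβ), Cf_neg, Cf_half]; ring

lemma real_inj (hβ : 0 < β) {x y : ℝ} (hx : 0 < x) (hx' : x ≤ Real.pi / 2) (hy : 0 < y)
    (hy' : y ≤ Real.pi / 2) (h : Df β x = Df β y) : x = y := by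
  have hpi := Real.pi_pos
  rcases (Df_eq_iff hβ (real_not_lam hβ hx hx') (real_not_lam hβ hy hy')).mp h with h | h
  · obtain ⟨m, n, a, b⟩ := lam_coord hβ h
    rw [← Complex.ofReal_add, Complex.ofReal_re] at a
    rw [← Complex.ofReal_add, Complex.ofReal_im] at b
    have n0 : (n : ℝ) = 0 := (mul_eq_zero.mp b.symm).resolve_right hβ.ne'
    rw [n0] at a
    have : (0 : ℝ) < m := by by_contra hc; nlinarith
    have : (0 : ℤ) < m := by exact_mod_cast this
    have : (1 : ℝ) ≤ m := by exact_mod_cast this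
    nlinarith
  · obtain ⟨m, n, a, b⟩ := lam_coord hβ h
    rw [← Complex.ofReal_sub, Complex.ofReal_re] at a
    rw [← Complex.ofReal_sub, Complex.ofReal_im] at b
    have n0 : (n : ℝ) = 0 := (mul_eq_zero.mp b.symm).resolve_right hβ.ne'
    rw [n0] at a
    have h1 : (m : ℝ) < 1 := by by_contra hc; nlinarith
    have h2 : (-1 : ℝ) < m := by by_contra hc; nlinarith
    have h1 : m < 1 := by exact_mod_cast h1
    have h2 : -1 < m := by exact_mod_cast h2
    have : m = 0 := by omega
    rw [this] at a
    push_cast at a; linarith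

lemma imag_inj (hβ : 0 < β) {x y : ℝ} (hx : 0 < x) (hx' : x ≤ β) (hy : 0 < y)
    (hy' : y ≤ β) (h : Df β (x * I) = Df β (y * I)) : x = y := by
  have hpi := Real.pi_pos
  rcases (Df_eq_iff hβ (imag_not_lam hβ hx hx') (imag_not_lam hβ hy hy')).mp h with h | h
  · obtain ⟨m, n, a, b⟩ := lam_coord hβ h
    simp at a b
    have e : ((2 * m + n : ℤ) : ℝ) = 0 := by
      have : ((2 * m + n : ℤ) : ℝ) * (Real.pi / 2) = 0 := by push_cast; linarith
      exact (mul_eq_zero.mp this).resolve_right (by positivity)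
    have e : 2 * m + n = 0 := by exact_mod_cast e
    have : (0 : ℝ) < n := by by_contra hc; nlinarith
    have : (0 : ℤ) < n := by exact_mod_cast this
    have : 2 ≤ n := by omega
    have : (2 : ℝ) ≤ n := by exact_mod_cast this
    nlinarith
  · obtain ⟨m, n, a, b⟩ := lam_coord hβ h
    simp at a b
    have h1 : (n : ℝ) < 1 := by by_contra hc; nlinarith
    have h2 : (-1 : ℝ) < n := by by_contra hc; nlinarith
    have h1 : n < 1 := by exact_mod_cast h1
    have h2 : -1 < n := by exact_mod_cast h2
    have : n = 0 := by omega
    rw [this] at b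
    push_cast at b; linarith

lemma Df_contAt (hβ : 0 < β) {v : ℂ} (hv : v ∉ Lam β) : ContinuousAt (Df β) v :=
  (Df_differentiableAt hβ hv).continuousAt

lemma inv_sq_atTop : Tendsto (fun x : ℝ => 1 / x ^ 2) (nhdsWithin 0 (Ioi 0)) atTop := by
  have := (tendsto_pow_atTop (two_ne_zero)).comp (tendsto_inv_nhdsGT_zero (𝕜 := ℝ))
  refine this.congr fun x => ?_
  simp

lemma real_lim (hβ : 0 < β) : Tendsto (fun x : ℝ => (Df β x).re) (nhdsWithin 0 (Ioi 0)) atTop := by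
  have t : Tendsto (fun x : ℝ => (x : ℂ)) (nhdsWithin 0 (Ioi 0)) (nhdsWithin 0 {(0 : ℂ)}ᶜ) := by
    apply tendsto_nhdsWithin_of_tendsto_nhds_of_eventually_within
    · have := (Complex.continuous_ofReal.tendsto 0).mono_left (nhdsWithin_le_nhds (s := Ioi 0))
      simpa using this
    · filter_upwards [self_mem_nhdsWithin] with x hx
      have : x ≠ 0 := (mem_Ioi.mp hx).ne'
      simpa using this
  have a := (Complex.continuous_re.tendsto _).comp ((Df_pole hβ).comp t)
  have := inv_sq_atTop.atTop_add a
  refine this.congr fun x => ?_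
  simp only [Function.comp_apply, Complex.sub_re]
  have : (1 / (x : ℂ) ^ 2) = ((1 / x ^ 2 : ℝ) : ℂ) := by push_cast; rfl
  rw [this, Complex.ofReal_re]; ring

lemma imag_lim (hβ : 0 < β) : Tendsto (fun x : ℝ => (Df β (x * I)).re) (nhdsWithin 0 (Ioi 0)) atBot := by
  have t : Tendsto (fun x : ℝ => (x * I : ℂ)) (nhdsWithin 0 (Ioi 0)) (nhdsWithin 0 {(0 : ℂ)}ᶜ) := by
    apply tendsto_nhdsWithin_of_tendsto_nhds_of_eventually_within
    · have : Continuous (fun x : ℝ => (x * I : ℂ)) := by fun_prop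
      have := (this.tendsto 0).mono_left (nhdsWithin_le_nhds (s := Ioi 0))
      simpa using this
    · filter_upwards [self_mem_nhdsWithin] with x hx
      have : x ≠ 0 := (mem_Ioi.mp hx).ne'
      simpa using this
  have a := (Complex.continuous_re.tendsto _).comp ((Df_pole hβ).comp t)
  have := (tendsto_neg_atTop_atBot.comp inv_sq_atTop).atBot_add a
  refine this.congr fun x => ?_
  simp only [Function.comp_apply, Complex.sub_re]
  have : (1 / (x * I : ℂ) ^ 2) = ((-(1 / x ^ 2) : ℝ) : ℂ) := by
    push_cast; rw [mul_pow, Complex.I_sq]; ring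
  rw [this, Complex.ofReal_re]; ring

lemma ivt_top {f : ℝ → ℝ} {b E : ℝ} (hb : 0 < b) (hc : ∀ x, 0 < x → x ≤ b → ContinuousAt f x)
    (hl : Tendsto f (nhdsWithin 0 (Ioi 0)) atTop) (hE : f b < E) : ∃ x, 0 < x ∧ x < b ∧ f x = E := by
  have := (hl.eventually_gt_atTop E).and (Ioo_mem_nhdsGT hb)
  obtain ⟨a, ha, ha1, ha2⟩ := this.exists
  have := intermediate_value_Ioo' ha2.le (f := f)
    (fun x hx => (hc x (ha1.trans_le hx.1) hx.2).continuousWithinAt)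
  obtain ⟨x, hx, hx'⟩ := this ⟨hE, ha⟩
  exact ⟨x, ha1.trans hx.1, hx.2, hx'⟩

lemma dr_contAt (hβ : 0 < β) (x : ℝ) (h0 : 0 < x) (h1 : x ≤ Real.pi / 2) :
    ContinuousAt (fun x : ℝ => (Df β x).re) x := by
  have := (Df_contAt hβ (real_not_lam hβ h0 h1)).comp (f := fun x : ℝ => (x : ℂ))
    Complex.continuous_ofReal.continuousAt
  exact Complex.continuous_re.continuousAt.comp this

lemma di_contAt (hβ : 0 < β) (y : ℝ) (h0 : 0 < y) (h1 : y ≤ β) :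
    ContinuousAt (fun y : ℝ => (Df β (y * I)).re) y := by
  have := (Df_contAt hβ (imag_not_lam hβ h0 h1)).comp (f := fun y : ℝ => (y * I : ℂ))
    (by fun_prop)
  exact Complex.continuous_re.continuousAt.comp this

lemma real_exists (hβ : 0 < β) {x E : ℝ} (h0 : 0 < x) (h1 : x ≤ Real.pi / 2) (hE : (Df β x).re < E) :
    ∃ y : ℝ, 0 < y ∧ y < x ∧ Df β y = E := by
  obtain ⟨y, a, b, c⟩ := ivt_top h0 (fun y hy hy' => dr_contAt hβ y hy (hy'.trans h1)) (real_lim hβ) hE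
  exact ⟨y, a, b, by rw [Df_real hβ, c]⟩

lemma imag_exists (hβ : 0 < β) {x E : ℝ} (h0 : 0 < x) (h1 : x ≤ β) (hE : E < (Df β (x * I)).re) :
    ∃ y : ℝ, 0 < y ∧ y < x ∧ Df β (y * I) = E := by
  obtain ⟨y, a, b, c⟩ := ivt_top (f := fun y : ℝ => -(Df β (y * I)).re) (E := -E) h0
    (fun y hy hy' => (di_contAt hβ y hy (hy'.trans h1)).neg) 
    (tendsto_neg_atBot_atTop.comp (imag_lim hβ)) (by linarith)
  exact ⟨y, a, b, by rw [Df_imag hβ, neg_injective c]⟩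

lemma dr_anti (hβ : 0 < β) {x y : ℝ} (h0 : 0 < x) (hxy : x < y) (h1 : y ≤ Real.pi / 2) :
    (Df β y).re < (Df β x).re := by
  by_contra! hc
  rcases hc.lt_or_eq with h | h
  · obtain ⟨z, a, b, c⟩ := real_exists hβ h0 (hxy.le.trans h1) h
    rw [← Df_real hβ] at c
    have := real_inj hβ a (by linarith) (by linarith) h1 c
    linarith
  · have := real_inj hβ h0 (by linarith) (by linarith) h1 (by rw [Df_real hβ, h, ← Df_real hβ])
    linarith

lemma di_mono (hβ : 0 < β) {x y : ℝ} (h0 : 0 < x) (hxy : x < y) (h1 : y ≤ β) :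
    (Df β (x * I)).re < (Df β (y * I)).re := by
  by_contra! hc
  rcases hc.lt_or_eq with h | h
  · obtain ⟨z, a, b, c⟩ := imag_exists hβ h0 (hxy.le.trans h1) h
    rw [← Df_imag hβ] at c
    have := imag_inj hβ a (by linarith) (by linarith) h1 c
    linarith
  · have := imag_inj hβ h0 (by linarith) (by linarith) h1 (by rw [Df_imag hβ, ← h, ← Df_imag hβ])
    linarith

lemma cr_hasDeriv (hβ : 0 < β) {x : ℝ} (h0 : 0 < x) (h1 : x ≤ Real.pi / 2) :
    HasDerivAt (fun x : ℝ => (Cf β x).re) (-(Df β x).re) x := by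
  have := (Cf_hasDeriv hβ (real_not_lam hβ h0 h1)).real_of_complex
  simpa using this

lemma Cf_add_lam (hβ : 0 < β) {v w : ℂ} (hv : v ∉ Lam β) (hw : w ∈ Lam β) :
    ∃ n : ℤ, Cf β (v + w) = Cf β v - 2 * n * I := by
  refine ((lam_ind (p := fun z => z ∉ Lam β ∧ ∃ n : ℤ, Cf β z = Cf β v - 2 * n * I) (β := β)
    (fun z => ?_) (fun z => ?_) hw v).mpr ⟨hv, 0, by simp⟩).2
  · rw [Cf_add_pi, add_mem_lam pi_mem]
  · rw [add_mem_lam pt_mem]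
    refine and_congr_right fun hz => ?_
    rw [Cf_add_pt hβ hz]
    constructor
    · rintro ⟨n, h⟩; exact ⟨n - 1, by push_cast; linear_combination h⟩
    · rintro ⟨n, h⟩; exact ⟨n + 1, by push_cast; linear_combination h⟩

/-- `Re C` up to sign is constant on fibres of `D` -/
lemma Cf_re_lam (hβ : 0 < β) {v w : ℂ} (hv : v ∉ Lam β) (hw : w ∈ Lam β) : (Cf β (v + w)).re = (Cf β v).re := by
  obtain ⟨n, h⟩ := Cf_add_lam hβ hv hw
  rw [h]; simp

lemma Cf_re_fibre (hβ : 0 < β) {u v : ℂ} (hu : u ∉ Lam β) (hv : v ∉ Lam β) (h : Df β u = Df β v) :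
    (Cf β u).re = 0 ↔ (Cf β v).re = 0 := by
  rcases (Df_eq_iff hβ hu hv).mp h with h | h
  · have := Cf_re_lam hβ (v := -v) (by rwa [neg_mem_lam]) h
    rw [show -v + (u + v) = u by ring, Cf_neg, Complex.neg_re] at this
    rw [this, neg_eq_zero]
  · have := Cf_re_lam hβ (v := v) hv h
    rw [show v + (u - v) = u by ring] at this
    rw [this]

lemma core3 (hβ : 0 < β) : (∀ v ∉ Lam β, Df β v = 0 → (Cf β v).re ≠ 0) ↔ (Df β (Real.pi / 2)).re < 0 := by
  have hpi := Real.pi_pos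
  constructor
  · intro h
    by_contra! hc
    have key : ∃ y : ℝ, 0 < y ∧ y ≤ β ∧ Df β (y * I) = 0 := by
      rcases hc.lt_or_eq with h | h
      · obtain ⟨y, a, b, c⟩ := imag_exists (E := 0) hβ hβ le_rfl (by rwa [Df_ibeta hβ])
        exact ⟨y, a, b.le, by simpa using c⟩
      · refine ⟨β, hβ, le_rfl, ?_⟩
        rw [Df_imag hβ, Df_ibeta hβ, ← h]; simp
    obtain ⟨y, a, b, c⟩ := key
    exact h _ (imag_not_lam hβ a b) c (Cf_imag y)
  · intro h v hv hD
    rw [← half_cast] at h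
    obtain ⟨x, a, b, c⟩ := real_exists (E := 0) hβ (by positivity) le_rfl h
    rw [Complex.ofReal_zero] at c
    rw [Ne, Cf_re_fibre hβ hv (real_not_lam hβ a b.le) (by rw [hD, c])]
    have mono : StrictMonoOn (fun x : ℝ => (Cf β x).re) (Icc x (Real.pi / 2)) := by
      apply strictMonoOn_of_deriv_pos (convex_Icc _ _)
      · intro t ht
        exact (cr_hasDeriv hβ (a.trans_le ht.1) ht.2).continuousAt.continuousWithinAt
      · intro t ht
        rw [interior_Icc] at ht
        rw [(cr_hasDeriv hβ (a.trans ht.1) ht.2.le).deriv]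
        have := dr_anti hβ a ht.1 ht.2.le
        rw [c, Complex.zero_re] at this
        linarith
    have := mono (left_mem_Icc.mpr b.le) (right_mem_Icc.mpr b.le) b
    simp only [half_cast, Cf_half, Complex.zero_re] at this
    exact this.ne

lemma part_three (W : WeierstrassData) (hW : W.IsRhombic) :
      (W.Z W.w1 + W.w1 * W.e1).im = 0 ∧
      ((∀ k : ℂ, k ∉ W.lattice → W.Z W.w1 + W.w1 * W.P k = 0 → W.uFun W.w1 k ≠ 0)
        ↔ (W.Z W.w1 + W.w1 * W.e1).re < 0) := by
  obtain ⟨s, β, hs, hβ, h1, h3, hlat, hP, hZ⟩ := transfer W hW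
  have hpi := Real.pi_pos
  have hsC : (s : ℂ) ≠ 0 := by exact_mod_cast hs.ne'
  have hpos : 0 < Real.pi / (2 * s) := by positivity
  have hc : ((Real.pi / (2 * s) : ℝ) : ℂ) ≠ 0 := by exact_mod_cast hpos.ne'
  have t1 := (transfer' W hs hβ h1 hP hZ (half_not_lam hβ)).1
  rw [← h1] at t1
  change W.Z W.w1 + W.w1 * W.e1 = _ at t1
  have e := Df_real hβ (Real.pi / 2)
  rw [half_cast] at e
  rw [t1]
  refine ⟨by rw [Complex.im_ofReal_mul, e, Complex.ofReal_im, mul_zero], ?_⟩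
  rw [Complex.re_ofReal_mul, mul_neg_iff]
  have : (0 < Real.pi / (2 * s) ∧ (Df β (Real.pi / 2)).re < 0 ∨
      Real.pi / (2 * s) < 0 ∧ 0 < (Df β (Real.pi / 2)).re) ↔ (Df β (Real.pi / 2)).re < 0 := by
    constructor
    · rintro (h | h)
      · exact h.2
      · exact absurd h.1 (by linarith)
    · intro h; exact Or.inl ⟨hpos, h⟩
  rw [this, ← core3 hβ]
  have key : ∀ v ∉ Lam β, (W.Z W.w1 + W.w1 * W.P (s * v) = 0 ↔ Df β v = 0) ∧
      (W.uFun W.w1 (s * v) = 0 ↔ (Cf β v).re = 0) := by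
    intro v hv
    obtain ⟨a, b⟩ := transfer' W hs hβ h1 hP hZ hv
    constructor
    · rw [a]; simp only [mul_eq_zero, hc, false_or]
    · rw [WeierstrassData.uFun, b, ← Complex.ofReal_neg, Complex.re_ofReal_mul, mul_eq_zero]
      constructor
      · rintro (h | h)
        · linarith
        · exact h
      · exact Or.inr
  constructor
  · intro h v hv hD
    exact (key v hv).2.not.mp (h _ ((hlat v).not.mpr hv) ((key v hv).1.mpr hD))
  · intro h k hk hk'
    have e : k = s * (k / s) := by field_simp
    rw [e] at hk hk' ⊢
    have hv := (hlat _).not.mp hk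
    exact (key _ hv).2.not.mpr (h _ hv ((key _ hv).1.mp hk'))

end

noncomputable section
variable {β : ℝ}

def psi (β : ℝ) (k v : ℂ) : ℂ := Th β (v + k) / Th β v * cexp (-Cf β k * v)

lemma psi_diffAt (hβ : 0 < β) (k : ℂ) {v : ℂ} (hv : v ∉ Lam β) : DifferentiableAt ℂ (psi β k) v := by
  have h := Th_ne hβ hv
  have h1 := Th_diff hβ v
  have h2 : DifferentiableAt ℂ (fun v => Th β (v + k)) v := by
    have := Th_diff hβ
    fun_prop
  unfold psi
  fun_prop (disch := assumption)

lemma psi_analytic (hβ : 0 < β) (k : ℂ) {v : ℂ} (hv : v ∉ Lam β) : AnalyticAt ℂ (psi β k) v := by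
  rw [Complex.analyticAt_iff_eventually_differentiableAt]
  filter_upwards [lam_compl_nhds hβ hv] with w hw using psi_diffAt hβ k hw

lemma psi_add_pi (k v : ℂ) : psi β k (v + Real.pi) = cexp (-Cf β k * Real.pi) * psi β k v := by
  unfold psi
  rw [show v + Real.pi + k = (v + k) + Real.pi by ring, Th_add_pi, Th_add_pi, neg_div_neg_eq, mul_add,
    Complex.exp_add]
  ring

lemma dpsi_add_pi (k v : ℂ) : deriv (psi β k) (v + Real.pi) = cexp (-Cf β k * Real.pi) * deriv (psi β k) v := by
  have : (fun v => psi β k (v + Real.pi)) = fun v => cexp (-Cf β k * Real.pi) * psi β k v :=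
    funext (psi_add_pi k)
  have := congrArg (fun f => deriv f v) this
  simp only [deriv_comp_add_const, deriv_const_mul_field] at this
  exact this

lemma psi_hasDeriv (hβ : 0 < β) (k : ℂ) {v : ℂ} (hv : v ∉ Lam β) (hk : v + k ∉ Lam β) :
    HasDerivAt (psi β k) ((Cf β (v + k) - Cf β v - Cf β k) * psi β k v) v := by
  have h := Th_ne hβ hv
  have h' := Th_ne hβ hk
  have a : HasDerivAt (fun v => Th β (v + k)) (deriv (Th β) (v + k)) v := by
    simpa using (Th_diff hβ (v + k)).hasDerivAt.comp_add_const v k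
  have b : HasDerivAt (fun v => -Cf β k * v) (-Cf β k) v := by
    simpa using (hasDerivAt_id v).const_mul (-Cf β k)
  have := (a.div (Th_diff hβ v).hasDerivAt h).mul b.cexp
  refine this.congr_deriv ?_
  simp only [psi, Pi.div_apply]
  rw [show Cf β v = deriv (Th β) v / Th β v from rfl, show Cf β (v + k) = deriv (Th β) (v + k) / Th β (v + k) from rfl]
  field_simp
  ring

lemma psi_ode0 (hβ : 0 < β) {k : ℂ} (hk0 : k ∉ Lam β) {v : ℂ} (hv : v ∉ Lam β) (hk : v + k ∉ Lam β) :
    deriv (deriv (psi β k)) v = (2 * Df β v + Df β k - 3 * kap β) * psi β k v := by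
  have e : deriv (psi β k) =ᶠ[nhds v] fun v => (Cf β (v + k) - Cf β v - Cf β k) * psi β k v := by
    have hc : ContinuousAt (fun v => v + k) v := by fun_prop
    filter_upwards [lam_compl_nhds hβ hv, hc.eventually (lam_compl_nhds hβ hk)] with w hw hw'
    exact (psi_hasDeriv hβ k hw hw').deriv
  rw [e.deriv_eq]
  have a : HasDerivAt (fun v => Cf β (v + k)) (-Df β (v + k)) v := by
    simpa using (Cf_hasDeriv hβ hk).comp_add_const v k
  have := ((a.fun_sub (Cf_hasDeriv hβ hv)).sub_const (Cf β k)).fun_mul (psi_hasDeriv hβ k hv hk)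
  rw [this.deriv]
  linear_combination psi β k v * f_sq hβ hk0 hv hk

lemma psi_ode (hβ : 0 < β) {k : ℂ} (hk0 : k ∉ Lam β) {v : ℂ} (hv : v ∉ Lam β) :
    deriv (deriv (psi β k)) v = (2 * Df β v + Df β k - 3 * kap β) * psi β k v := by
  have c1 : ContinuousAt (deriv (deriv (psi β k))) v := (psi_analytic hβ k hv).deriv.deriv.continuousAt
  have c2 : ContinuousAt (fun v => (2 * Df β v + Df β k - 3 * kap β) * psi β k v) v := by
    have := Df_contAt hβ hv
    have := (psi_diffAt hβ k hv).continuousAt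
    fun_prop
  have hne : ∀ᶠ w in nhdsWithin v {v}ᶜ, w + k ∉ Lam β := by
    have t : Tendsto (fun w => w + k) (nhdsWithin v {v}ᶜ) (nhdsWithin (v + k) {v + k}ᶜ) := by
      apply tendsto_nhdsWithin_of_tendsto_nhds_of_eventually_within
      · have : ContinuousAt (fun w => w + k) v := by fun_prop
        exact this.tendsto.mono_left nhdsWithin_le_nhds
      · filter_upwards [self_mem_nhdsWithin] with w hw
        simpa using hw
    exact t.eventually (lam_discrete hβ (v + k))
  refine tendsto_nhds_unique (c1.tendsto.mono_left (nhdsWithin_le_nhds (s := {v}ᶜ))) ?_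
  refine (c2.tendsto.mono_left nhdsWithin_le_nhds).congr' ?_
  filter_upwards [hne, lam_discrete hβ v] with w h1 h2
  exact (psi_ode0 hβ hk0 h2 h1).symm

/-- composition with the real line -/
lemma line_deriv {f : ℂ → ℂ} {f' a : ℂ} {x : ℝ} (h : HasDerivAt f f' (Real.pi / 2 * x + a)) :
    HasDerivAt (fun x : ℝ => f (Real.pi / 2 * x + a)) (Real.pi / 2 * f') x := by
  have b : HasDerivAt (fun z : ℂ => Real.pi / 2 * z + a) (Real.pi / 2) x := by
    simpa using ((hasDerivAt_id (x : ℂ)).const_mul (Real.pi / 2 : ℂ)).add_const a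
  have := (HasDerivAt.comp (x : ℂ) (h₂ := f) (h := fun z : ℂ => Real.pi / 2 * z + a) h b).comp_ofReal
  rw [mul_comm]
  exact this

lemma line_contDiff {f : ℂ → ℂ} {a : ℂ} (h : ∀ x : ℝ, AnalyticAt ℂ f (Real.pi / 2 * x + a)) :
    ContDiff ℝ 2 (fun x : ℝ => f (Real.pi / 2 * x + a)) := by
  rw [contDiff_iff_contDiffAt]
  intro x
  have h1 : ContDiffAt ℝ 2 f (Real.pi / 2 * x + a) := (h x).contDiffAt.restrict_scalars ℝ
  have h2 : ContDiffAt ℝ 2 (fun x : ℝ => (Real.pi / 2 * x + a : ℂ)) x := by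
    have : ContDiff ℝ 2 (fun x : ℝ => (x : ℂ)) := Complex.ofRealCLM.contDiff
    have := this.contDiffAt (x := x)
    fun_prop
  exact h1.comp x h2

lemma periodic_bounded {f : ℝ → ℝ} (hf : Continuous f) (hp : ∀ x, f (x + 2) = f x) : ∃ C, ∀ x, f x ≤ C := by
  obtain ⟨C, hC⟩ := (isCompact_Icc (a := (0:ℝ)) (b := 2)).bddAbove_image hf.continuousOn
  refine ⟨C, fun x => ?_⟩
  have hper : Function.Periodic f 2 := hp
  obtain ⟨y, hy, e⟩ := hper.exists_mem_Ico₀ (by norm_num) x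
  rw [e]
  exact hC ⟨y, ⟨hy.1, hy.2.le⟩, rfl⟩

lemma landau {φ : ℝ → ℂ} (hφ : ContDiff ℝ 2 φ) {M B : ℝ} (hM : ∀ x, ‖φ x‖ ≤ M)
    (hB : ∀ x, ‖deriv (deriv φ) x‖ ≤ B) : ∀ x, ‖deriv φ x‖ ≤ 2 * M + B := by
  intro x
  have d1 : Differentiable ℝ φ := hφ.differentiable (by norm_num)
  have d2 : Differentiable ℝ (deriv φ) := by
    have : ContDiff ℝ 1 (deriv φ) := by
      have := (contDiff_succ_iff_deriv (n := 1) (f := φ) (𝕜 := ℝ)).mp (by rw [one_add_one_eq_two]; exact hφ)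
      exact this.2.2
    exact this.differentiable (by norm_num)
  have a : ∀ t ∈ Icc x (x + 1), ‖deriv φ t - deriv φ x‖ ≤ B := by
    intro t ht
    have := (convex_univ (𝕜 := ℝ) (E := ℝ)).norm_image_sub_le_of_norm_deriv_le (f := deriv φ) (C := B)
      (fun y _ => d2 y) (fun y _ => hB y) (mem_univ x) (mem_univ t)
    have hB0 : 0 ≤ B := (norm_nonneg _).trans (hB x)
    refine this.trans ?_
    have : ‖t - x‖ ≤ 1 := by
      rw [Real.norm_eq_abs, abs_le]; constructor <;> linarith [ht.1, ht.2]
    nlinarith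
  have b := (convex_Icc x (x + 1)).norm_image_sub_le_of_norm_hasDerivWithin_le
    (f := fun t : ℝ => φ t - (t : ℂ) * deriv φ x) (f' := fun t => deriv φ t - deriv φ x) (C := B)
    (fun t _ => by
      have h1 := (d1 t).hasDerivAt
      have h2 : HasDerivAt (fun t : ℝ => (t : ℂ) * deriv φ x) (deriv φ x) t := by
        simpa using (Complex.ofRealCLM.hasDerivAt (x := t)).mul_const (deriv φ x)
      exact (h1.fun_sub h2).hasDerivWithinAt) a
    (left_mem_Icc.mpr (by linarith)) (right_mem_Icc.mpr (by linarith))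
  simp only [add_sub_cancel_left, norm_one, mul_one] at b
  have e : deriv φ x = φ (x + 1) - φ x - (φ (x + 1) - ((x + 1 : ℝ) : ℂ) * deriv φ x - (φ x - x * deriv φ x)) := by
    push_cast; ring
  rw [e]
  refine (norm_sub_le _ _).trans ?_
  have := norm_sub_le (φ (x + 1)) (φ x)
  linarith [hM x, hM (x + 1)]

lemma wr_zero {φ φ' Y Y' : ℝ → ℂ} {M h : ℝ} {μ K : ℂ} (hμ : ‖μ‖ < 1) (h1 : ∀ x, ‖φ x‖ ≤ M)
    (h2 : ∀ x, ‖φ' x‖ ≤ M) (hY : ∀ x, Y (x + h) = μ * Y x) (hY' : ∀ x, Y' (x + h) = μ * Y' x)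
    (hK : ∀ x, φ x * Y' x - φ' x * Y x = K) : K = 0 := by
  have a : ∀ n : ℕ, Y (n * h) = μ ^ n * Y 0 := by
    intro n
    induction n with
    | zero => simp
    | succ n ih => push_cast; rw [add_mul, one_mul, hY, ih]; ring
  have a' : ∀ n : ℕ, Y' (n * h) = μ ^ n * Y' 0 := by
    intro n
    induction n with
    | zero => simp
    | succ n ih => push_cast; rw [add_mul, one_mul, hY', ih]; ring
  have b : ∀ n : ℕ, ‖K‖ ≤ ‖μ‖ ^ n * (M * (‖Y' 0‖ + ‖Y 0‖)) := by
    intro n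
    rw [← hK (n * h), a, a', show φ (n * h) * (μ ^ n * Y' 0) - φ' (n * h) * (μ ^ n * Y 0) =
      μ ^ n * (φ (n * h) * Y' 0 - φ' (n * h) * Y 0) by ring, norm_mul, norm_pow]
    refine mul_le_mul_of_nonneg_left ?_ (by positivity)
    refine (norm_sub_le _ _).trans ?_
    rw [norm_mul, norm_mul, mul_add]
    have := h1 (n * h)
    have := h2 (n * h)
    gcongr
  have t := (tendsto_pow_atTop_nhds_zero_of_lt_one (norm_nonneg _) hμ).mul_const (M * (‖Y' 0‖ + ‖Y 0‖))
  rw [zero_mul] at t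
  have := ge_of_tendsto' t b
  exact norm_le_zero_iff.mp this


lemma spec_sub (hβ : 0 < β) {a : ℂ} (ha : ∀ x : ℝ, (Real.pi / 2 * x + a : ℂ) ∉ Lam β) {k : ℂ} (hk : k ∉ Lam β)
    {φ : ℝ → ℂ} (h0 : φ ≠ 0) (h2 : ContDiff ℝ 2 φ) (hode : ∀ x : ℝ, deriv (deriv φ) x =
      (Real.pi ^ 2 / 4) * (2 * Df β (Real.pi / 2 * x + a) + Df β k - 3 * kap β) * φ x)
    {M : ℝ} (hM : ∀ x, ‖φ x‖ ≤ M) : (Cf β k).re ≤ 0 := by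
  by_contra! hc
  have hpi := Real.pi_pos
  have hkn : -k ∉ Lam β := by rwa [neg_mem_lam]
  -- coefficient bounded
  obtain ⟨B, hB⟩ : ∃ B, ∀ x : ℝ, ‖(Real.pi ^ 2 / 4 : ℂ) * (2 * Df β (Real.pi / 2 * x + a) + Df β k - 3 * kap β)‖ ≤ B := by
    apply periodic_bounded
    · have : Continuous fun x : ℝ => Df β (Real.pi / 2 * x + a) := by
        rw [continuous_iff_continuousAt]
        intro x
        exact (Df_contAt hβ (ha x)).comp (f := fun x : ℝ => (Real.pi / 2 * x + a : ℂ)) (by fun_prop)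
      fun_prop
    · intro x
      have : (Real.pi / 2 * ((x + 2 : ℝ) : ℂ) + a) = (Real.pi / 2 * x + a) + Real.pi := by push_cast; ring
      rw [this, Df_add_pi hβ]
  have hB2 : ∀ x, ‖deriv (deriv φ) x‖ ≤ B * M := by
    intro x
    rw [hode, norm_mul]
    have := hB x
    have := hM x
    gcongr
    exact (norm_nonneg _).trans (hB x)
  have hd := landau h2 hM hB2
  have hM0 : 0 ≤ M := (norm_nonneg _).trans (hM 0)
  have hBM : 0 ≤ B * M := (norm_nonneg _).trans (hB2 0)
  have d1 : Differentiable ℝ φ := h2.differentiable (by norm_num)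
  have d2 : Differentiable ℝ (deriv φ) := by
    have : ContDiff ℝ 1 (deriv φ) := by
      have := (contDiff_succ_iff_deriv (n := 1) (f := φ) (𝕜 := ℝ)).mp (by rw [one_add_one_eq_two]; exact h2)
      exact this.2.2
    exact this.differentiable (by norm_num)
  -- Wronskian vanishes
  have wr : ∀ k' : ℂ, k' ∉ Lam β → Df β k' = Df β k → ∀ μ : ℂ, ‖μ‖ < 1 → ∀ h : ℝ,
      (∀ v, psi β k' (v + Real.pi / 2 * h) = μ * psi β k' v) →
      (∀ v, deriv (psi β k') (v + Real.pi / 2 * h) = μ * deriv (psi β k') v) →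
      ∀ x : ℝ, φ x * deriv (psi β k') (Real.pi / 2 * x + a) * (Real.pi / 2) = deriv φ x * psi β k' (Real.pi / 2 * x + a) := by
    intro k' hk' hDk μ hμ h e1 e2
    have dd : ∀ x : ℝ, HasDerivAt (fun x : ℝ => φ x * (Real.pi / 2 * deriv (psi β k') (Real.pi / 2 * x + a))
        - deriv φ x * psi β k' (Real.pi / 2 * x + a)) 0 x := by
      intro x
      have a1 := line_deriv (psi_diffAt hβ k' (ha x)).hasDerivAt
      have a2 := line_deriv (psi_analytic hβ k' (ha x)).deriv.differentiableAt.hasDerivAt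
      have := ((d1 x).hasDerivAt.fun_mul (a2.const_mul (Real.pi / 2 : ℂ))).fun_sub ((d2 x).hasDerivAt.fun_mul a1)
      refine this.congr_deriv ?_
      rw [psi_ode hβ hk' (ha x), hDk, hode]
      ring
    have hconst := is_const_of_deriv_eq_zero (fun x => (dd x).differentiableAt) (fun x => (dd x).deriv)
    have hz := wr_zero (φ := φ) (φ' := deriv φ) (Y := fun x : ℝ => psi β k' (Real.pi / 2 * x + a))
      (Y' := fun x : ℝ => Real.pi / 2 * deriv (psi β k') (Real.pi / 2 * x + a)) (M := 2 * M + B * M) (h := h) (μ := μ) hμ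
      (fun x => (hM x).trans (by linarith)) hd (fun x => by
        rw [← e1]; congr 1; push_cast; ring) (fun x => by
        rw [mul_left_comm, ← e2]; congr 2; push_cast; ring) (fun x => hconst x 0)
    intro x
    have := hconst x 0
    simp only [hz] at this
    linear_combination this
  have hnorm : ‖cexp (-Cf β k * Real.pi)‖ < 1 := by
    rw [Complex.norm_exp, Real.exp_lt_one_iff]
    simp only [Complex.mul_re, Complex.neg_re, Complex.ofReal_re, Complex.ofReal_im]
    nlinarith
  have hpp : (Real.pi / 2 * ((2 : ℝ) : ℂ) : ℂ) = Real.pi := by push_cast; ring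
  have hpm : (Real.pi / 2 * ((-2 : ℝ) : ℂ) : ℂ) = -Real.pi := by push_cast; ring
  have hmul : cexp (-Cf β k * Real.pi) * cexp (-Cf β (-k) * Real.pi) = 1 := by
    rw [Cf_neg, ← Complex.exp_add]; simp
  have w1 := wr k hk rfl _ hnorm 2 (fun v => by rw [hpp, psi_add_pi]) (fun v => by rw [hpp, dpsi_add_pi])
  have w2 := wr (-k) hkn (Df_neg hβ k) _ hnorm (-2)
    (fun v => by
      have := psi_add_pi (β := β) (-k) (v + -Real.pi)
      rw [neg_add_cancel_right] at this
      rw [hpm, this, ← mul_assoc, hmul, one_mul])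
    (fun v => by
      have := dpsi_add_pi (β := β) (-k) (v + -Real.pi)
      rw [neg_add_cancel_right] at this
      rw [hpm, this, ← mul_assoc, hmul, one_mul])
  -- a generic point
  obtain ⟨x, hx, b1, b2⟩ : ∃ x : ℝ, φ x ≠ 0 ∧ (Real.pi / 2 * x + a) + k ∉ Lam β ∧ (Real.pi / 2 * x + a) - k ∉ Lam β := by
    have cnt : ∀ c : ℂ, {x : ℝ | (Real.pi / 2 * x + a) + c ∈ Lam β}.Countable := by
      intro c
      refine (lam_countable (β := β)).preimage_of_injOn (f := fun x : ℝ => (Real.pi / 2 * x + a : ℂ) + c) ?_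
      intro x _ y _ h
      have hne : (Real.pi / 2 : ℂ) ≠ 0 := by
        rw [← half_cast]; exact_mod_cast (by positivity : Real.pi / 2 ≠ 0)
      have : (Real.pi / 2 : ℂ) * x = Real.pi / 2 * y := by
        simp only at h
        linear_combination h
      exact_mod_cast mul_left_cancel₀ hne this
    have dn := ((cnt k).union (cnt (-k))).dense_compl ℝ
    have op : IsOpen {x | φ x ≠ 0} := isOpen_ne_fun h2.continuous continuous_const
    obtain ⟨x0, hx0⟩ := Function.ne_iff.mp h0
    obtain ⟨x, hx, hx'⟩ := dn.inter_open_nonempty _ op ⟨x0, hx0⟩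
    rw [mem_compl_iff, mem_union, not_or] at hx'
    exact ⟨x, hx, hx'.1, by simpa [sub_eq_add_neg] using hx'.2⟩
  have hv := ha x
  set v : ℂ := Real.pi / 2 * x + a with hvd
  have c1 := w1 x
  have c2 := w2 x
  rw [← hvd, (psi_hasDeriv hβ k hv b1).deriv] at c1
  rw [← hvd, (psi_hasDeriv hβ (-k) hv (by rwa [← sub_eq_add_neg])).deriv, Cf_neg, ← sub_eq_add_neg] at c2
  have p1 : psi β k v ≠ 0 := mul_ne_zero (div_ne_zero (Th_ne hβ b1) (Th_ne hβ hv)) (Complex.exp_ne_zero _)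
  have p2 : psi β (-k) v ≠ 0 := mul_ne_zero (div_ne_zero (Th_ne hβ (by rwa [← sub_eq_add_neg])) (Th_ne hβ hv)) (Complex.exp_ne_zero _)
  have q1 : φ x * (Cf β (v + k) - Cf β v - Cf β k) * (Real.pi / 2) = deriv φ x :=
    mul_right_cancel₀ p1 (by linear_combination c1)
  have q2 : φ x * (Cf β (v - k) - Cf β v + Cf β k) * (Real.pi / 2) = deriv φ x :=
    mul_right_cancel₀ p2 (by linear_combination c2)
  have hne : (Real.pi / 2 : ℂ) ≠ 0 := by
    rw [← half_cast]; exact_mod_cast (by positivity : Real.pi / 2 ≠ 0)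
  have q3 : Cf β (v + k) - Cf β (v - k) - 2 * Cf β k = 0 := by
    have : (φ x * (Real.pi / 2)) * (Cf β (v + k) - Cf β (v - k) - 2 * Cf β k) = 0 := by
      linear_combination q1 - q2
    exact (mul_eq_zero.mp this).resolve_left (mul_ne_zero hx hne)
  have q4 := Cf_addition hβ hv hk b1 b2
  rw [q3, zero_mul, eq_comm, neg_eq_zero, Df_deriv_eq_zero hβ hk] at q4
  have := Cf_re_lam hβ hkn q4
  rw [show -k + 2 * k = k by ring, Cf_neg, Complex.neg_re] at this
  linarith

/-- description of the spectrum -/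
lemma spec_eq (hβ : 0 < β) (W : WeierstrassData) {s : ℝ} (hs : 0 < s) (h1 : W.w1 = s * (Real.pi / 2))
    (hlat : ∀ v : ℂ, s * v ∈ W.lattice ↔ v ∈ Lam β)
    (hP : ∀ v ∉ Lam β, s ^ 2 * W.P (s * v) = Df β v - kap β) (z0 : ℂ)
    (hz : ∀ x : ℝ, W.w1 * x + z0 ∉ W.lattice) :
    W.lameSpectrum 1 W.w1 z0 = {lam | ∃ k ∉ Lam β, (Cf β k).re = 0 ∧ lam = -(Real.pi ^ 2 / 4) * (Df β k - kap β)} := by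
  have hsC : (s : ℂ) ≠ 0 := by exact_mod_cast hs.ne'
  have hpi := Real.pi_pos
  have hpC : (Real.pi : ℂ) ≠ 0 := by exact_mod_cast hpi.ne'
  have hli : ∀ x : ℝ, W.w1 * x + z0 = s * (Real.pi / 2 * x + z0 / s) := by
    intro x; rw [h1]; field_simp
  have ha : ∀ x : ℝ, (Real.pi / 2 * x + z0 / s : ℂ) ∉ Lam β := fun x => by
    rw [← hlat, ← hli]; exact hz x
  have hpot : ∀ x : ℝ, ((1 : ℕ) * ((1 : ℕ) + 1) : ℂ) * W.w1 ^ 2 * W.P (W.w1 * x + z0) =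
      Real.pi ^ 2 / 2 * (Df β (Real.pi / 2 * x + z0 / s) - kap β) := by
    intro x
    rw [hli, ← hP _ (ha x), h1]; push_cast; ring
  ext lam
  constructor
  · rintro ⟨φ, h0, h2, hode, M, hM⟩
    obtain ⟨k, hk, hD⟩ := Df_surj hβ (kap β - 4 * lam / Real.pi ^ 2)
    have hlam : lam = -(Real.pi ^ 2 / 4) * (Df β k - kap β) := by
      rw [hD]; field_simp; ring
    have ho : ∀ x : ℝ, deriv (deriv φ) x =
      (Real.pi ^ 2 / 4) * (2 * Df β (Real.pi / 2 * x + z0 / s) + Df β k - 3 * kap β) * φ x := by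
      intro x
      have := hode x
      rw [hpot, hlam] at this
      linear_combination -this
    refine ⟨k, hk, le_antisymm (spec_sub hβ ha hk h0 h2 ho hM) ?_, hlam⟩
    have := spec_sub hβ ha (k := -k) (by rwa [neg_mem_lam]) h0 h2 (by simpa only [Df_neg hβ] using ho) hM
    rw [Cf_neg, Complex.neg_re] at this
    linarith
  · rintro ⟨k, hk, hC, rfl⟩
    have dd : ∀ x : ℝ, HasDerivAt (fun x : ℝ => psi β k (Real.pi / 2 * x + z0 / s))
        (Real.pi / 2 * deriv (psi β k) (Real.pi / 2 * x + z0 / s)) x := fun x =>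
      line_deriv (psi_diffAt hβ k (ha x)).hasDerivAt
    refine ⟨fun x => psi β k (Real.pi / 2 * x + z0 / s), ?_, line_contDiff fun x => psi_analytic hβ k (ha x), ?_, ?_⟩
    · intro h
      have z : ∀ x : ℝ, Real.pi / 2 * x + z0 / s + k ∈ Lam β := by
        intro x
        have := congrFun h x
        by_contra hc
        exact (mul_ne_zero (div_ne_zero (Th_ne hβ hc) (Th_ne hβ (ha x))) (Complex.exp_ne_zero _)) this
      have z0' := z 0
      have z1 := z 1
      have := (sub_mem_lam z0').mpr z1
      refine half_not_lam hβ ?_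
      convert this using 1
      push_cast; ring
    · intro x
      have e : deriv (fun x : ℝ => psi β k (Real.pi / 2 * x + z0 / s)) =
          fun x : ℝ => Real.pi / 2 * deriv (psi β k) (Real.pi / 2 * x + z0 / s) := funext fun x => (dd x).deriv
      rw [e, ((line_deriv (psi_analytic hβ k (ha x)).deriv.differentiableAt.hasDerivAt).const_mul _).deriv,
        psi_ode hβ hk (ha x), hpot]
      ring
    · refine periodic_bounded ?_ ?_
      · have : Continuous (fun x : ℝ => psi β k (Real.pi / 2 * x + z0 / s)) :=
          continuous_iff_continuousAt.mpr fun x => (dd x).continuousAt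
        exact this.norm
      · intro x
        have : (Real.pi / 2 * ((x + 2 : ℝ) : ℂ) + z0 / s) = (Real.pi / 2 * x + z0 / s) + Real.pi := by push_cast; ring
        dsimp only
        rw [this, psi_add_pi, norm_mul, Complex.norm_exp]
        simp [hC]

end

noncomputable section
variable {β : ℝ}

def CRect (β : ℝ) : Set ℂ := Icc 0 (Real.pi / 2) ×ℂ Icc 0 β

lemma crect_compact : IsCompact (CRect β) := isCompact_Icc.reProdIm isCompact_Icc

lemma mem_crect {v : ℂ} : v ∈ CRect β ↔ (0 ≤ v.re ∧ v.re ≤ Real.pi / 2) ∧ 0 ≤ v.im ∧ v.im ≤ β := by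
  rw [CRect, Complex.mem_reProdIm, mem_Icc, mem_Icc]

lemma rect_sub : Rect β ⊆ CRect β := fun v hv => mem_crect.mpr ⟨⟨hv.1.le, hv.2.1.le⟩, hv.2.2.1.le, hv.2.2.2.le⟩

lemma Th_simple (hβ : 0 < β) {w : ℂ} (hw : w ∈ Lam β) : deriv (Th β) w ≠ 0 := by
  have := (lam_ind (p := fun z => Th β z = 0 ∧ deriv (Th β) z ≠ 0) (β := β) (fun z => ?_) (fun z => ?_) hw 0).mpr
    ⟨Th_zero hβ, Th_deriv_zero hβ⟩
  · rw [zero_add] at this; exact this.2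
  · have : (fun v => Th β (v + Real.pi)) = fun v => - Th β v := funext Th_add_pi
    have h := congrArg (fun f => deriv f z) this
    simp only [deriv_comp_add_const, deriv.fun_neg] at h
    rw [h, Th_add_pi]; simp
  · have : (fun v => Th β (v + pt β)) = fun v => - cexp (-(I * pt β)) * cexp (-(2 * I * v)) * Th β v :=
      funext (Th_add_pt hβ)
    have h := congrArg (fun f => deriv f z) this
    simp only [deriv_comp_add_const] at h
    have d : DifferentiableAt ℂ (fun v => - cexp (-(I * pt β)) * cexp (-(2 * I * v))) z := by fun_prop
    rw [deriv_fun_mul d (Th_diff hβ z)] at h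
    rw [h, Th_add_pt hβ]
    have ne : - cexp (-(I * pt β)) * cexp (-(2 * I * z)) ≠ 0 :=
      mul_ne_zero (neg_ne_zero.mpr (Complex.exp_ne_zero _)) (Complex.exp_ne_zero _)
    constructor
    · rintro ⟨a, b⟩
      have a := (mul_eq_zero.mp a).resolve_left ne
      rw [a, mul_zero, zero_add] at b
      exact ⟨a, right_ne_zero_of_mul b⟩
    · rintro ⟨a, b⟩
      rw [a, mul_zero, mul_zero, zero_add]
      exact ⟨rfl, mul_ne_zero ne b⟩

lemma Cf_analytic (hβ : 0 < β) {v : ℂ} (hv : v ∉ Lam β) : AnalyticAt ℂ (Cf β) v := by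
  rw [Complex.analyticAt_iff_eventually_differentiableAt]
  filter_upwards [lam_compl_nhds hβ hv] with w hw using (Cf_hasDeriv hβ hw).differentiableAt

lemma Df_analytic (hβ : 0 < β) {v : ℂ} (hv : v ∉ Lam β) : AnalyticAt ℂ (Df β) v := by
  rw [Complex.analyticAt_iff_eventually_differentiableAt]
  filter_upwards [lam_compl_nhds hβ hv] with w hw using Df_differentiableAt hβ hw

/-- injectivity of `C` on the rectangle -/
lemma Cf_inj (hβ : 0 < β) {p q : ℂ} (hp : p ∈ CRect β) (hpl : p ∉ Lam β) (hq : q ∈ Rect β)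
    (h : Cf β p = Cf β q) : p = q := by
  by_contra hne
  have hd : q - p ≠ 0 := sub_ne_zero.mpr (Ne.symm hne)
  obtain ⟨⟨a1, a2⟩, a3, a4⟩ := mem_crect.mp hp
  obtain ⟨b1, b2, b3, b4⟩ := hq
  have seg : ∀ t ∈ Ioc (0 : ℝ) 1, p + t * (q - p) ∈ Rect β := by
    rintro t ⟨t0, t1⟩
    have e1 : (p + t * (q - p)).re = (1 - t) * p.re + t * q.re := by simp; ring
    have e2 : (p + t * (q - p)).im = (1 - t) * p.im + t * q.im := by simp; ring
    rw [Rect, mem_setOf_eq, e1, e2]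
    have h1 : 0 ≤ 1 - t := by linarith
    refine ⟨?_, ?_, ?_, ?_⟩
    · have := mul_nonneg h1 a1
      have := mul_pos t0 b1
      linarith
    · nlinarith
    · have := mul_nonneg h1 a3
      have := mul_pos t0 b3
      linarith
    · nlinarith
  have segl : ∀ t ∈ Icc (0 : ℝ) 1, p + t * (q - p) ∉ Lam β := by
    rintro t ⟨t0, t1⟩
    rcases t0.lt_or_eq with h | h
    · exact rect_not_lam hβ (seg t ⟨h, t1⟩)
    · rw [← h]; simpa using hpl
  have dd : ∀ t ∈ Icc (0 : ℝ) 1, HasDerivAt (fun t : ℝ => (Cf β (p + t * (q - p)) / (q - p)).im)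
      (-(Df β (p + t * (q - p))).im) t := by
    intro t ht
    have b : HasDerivAt (fun z : ℂ => p + z * (q - p)) (q - p) (t : ℂ) := by
      simpa using ((hasDerivAt_id (t : ℂ)).mul_const (q - p)).const_add p
    have c := ((HasDerivAt.comp (t : ℂ) (h₂ := Cf β) (Cf_hasDeriv hβ (segl t ht)) b).div_const (q - p)).comp_ofReal
    have := (Complex.imCLM.hasFDerivAt.comp_hasDerivAt t c)
    refine this.congr_deriv ?_
    rw [mul_div_cancel_right₀ _ hd]; simp
  have mono : StrictMonoOn (fun t : ℝ => (Cf β (p + t * (q - p)) / (q - p)).im) (Icc 0 1) := by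
    apply strictMonoOn_of_deriv_pos (convex_Icc _ _)
    · intro t ht; exact (dd t ht).continuousAt.continuousWithinAt
    · intro t ht
      rw [interior_Icc] at ht
      rw [(dd t ⟨ht.1.le, ht.2.le⟩).deriv]
      have := Df_im_neg hβ (seg t ⟨ht.1, ht.2.le⟩)
      linarith
  have := mono (left_mem_Icc.mpr zero_le_one) (right_mem_Icc.mpr zero_le_one) zero_lt_one
  simp only [Complex.ofReal_zero, zero_mul, add_zero, Complex.ofReal_one, one_mul, add_sub_cancel] at this
  rw [h] at this
  exact lt_irrefl _ this

lemma Cf_sym (hβ : 0 < β) {v : ℂ} (hv : v ∉ Lam β) : Cf β (pt β - v) = - Cf β v - 2 * I := by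
  rw [show pt β - v = -v + pt β by ring, Cf_add_pt hβ (by rwa [neg_mem_lam]), Cf_neg]

lemma Df_sym (hβ : 0 < β) (v : ℂ) : Df β (pt β - v) = Df β v := by
  rw [show pt β - v = -v + pt β by ring, Df_add_pt hβ, Df_neg hβ]

lemma sym_lam {v : ℂ} : pt β - v ∈ Lam β ↔ v ∈ Lam β := by
  rw [show pt β - v = -v + pt β by ring, add_mem_lam pt_mem, neg_mem_lam]

lemma Cf_imag' (y : ℝ) : Cf β (y * I) = ((Cf β (y * I)).im : ℂ) * I := by
  apply Complex.ext <;> simp [Cf_imag]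

lemma ci_hasDeriv (hβ : 0 < β) {y : ℝ} (h0 : 0 < y) (h1 : y ≤ β) :
    HasDerivAt (fun y : ℝ => (Cf β (y * I)).im) (-(Df β (y * I)).re) y := by
  have b : HasDerivAt (fun z : ℂ => z * I) I (y : ℂ) := by
    simpa using (hasDerivAt_id (y : ℂ)).mul_const I
  have c := (HasDerivAt.comp (y : ℂ) (h₂ := Cf β) (Cf_hasDeriv hβ (imag_not_lam hβ h0 h1)) b).comp_ofReal
  have := (Complex.imCLM.hasFDerivAt.comp_hasDerivAt y c)
  refine this.congr_deriv ?_
  simp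

lemma ci_lim (hβ : 0 < β) : Tendsto (fun x : ℝ => (Cf β (x * I)).im) (nhdsWithin 0 (Ioi 0)) atBot := by
  have t : Tendsto (fun x : ℝ => (x * I : ℂ)) (nhdsWithin 0 (Ioi 0)) (nhdsWithin 0 {(0 : ℂ)}ᶜ) := by
    apply tendsto_nhdsWithin_of_tendsto_nhds_of_eventually_within
    · have : Continuous (fun x : ℝ => (x * I : ℂ)) := by fun_prop
      have := (this.tendsto 0).mono_left (nhdsWithin_le_nhds (s := Ioi 0))
      simpa using this
    · filter_upwards [self_mem_nhdsWithin] with x hx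
      have : x ≠ 0 := (mem_Ioi.mp hx).ne'
      simpa using this
  have r : Tendsto (fun x : ℝ => (Rf β (x * I)).im) (nhdsWithin 0 (Ioi 0)) (nhds (Rf β 0).im) :=
    (Complex.continuous_im.tendsto _).comp
      (((Rf_analytic hβ).continuousAt.tendsto.mono_left nhdsWithin_le_nhds).comp t)
  have := (tendsto_neg_atTop_atBot.comp (tendsto_inv_nhdsGT_zero (𝕜 := ℝ))).atBot_add r
  refine this.congr' ?_
  filter_upwards [t.eventually (Cf_local hβ)] with x hx
  rw [hx, Complex.add_im]
  have : (1 / (x * I : ℂ)) = ((-x⁻¹ : ℝ) : ℂ) * I := by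
    push_cast; rw [one_div, mul_inv, Complex.inv_I]; ring
  rw [this]; simp

lemma cr_pos (hβ : 0 < β) (hD : Df β (Real.pi / 2) = 0) {x : ℝ} (h0 : 0 < x) (h1 : x < Real.pi / 2) :
    0 < (Cf β x).re := by
  have anti : StrictAntiOn (fun x : ℝ => (Cf β x).re) (Icc x (Real.pi / 2)) := by
    apply strictAntiOn_of_deriv_neg (convex_Icc _ _)
    · intro t ht
      exact (cr_hasDeriv hβ (h0.trans_le ht.1) ht.2).continuousAt.continuousWithinAt
    · intro t ht
      rw [interior_Icc] at ht
      rw [(cr_hasDeriv hβ (h0.trans ht.1) ht.2.le).deriv]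
      have := dr_anti hβ (h0.trans ht.1) ht.2 le_rfl
      rw [half_cast, hD, Complex.zero_re] at this
      linarith
  have := anti (left_mem_Icc.mpr h1.le) (right_mem_Icc.mpr h1.le) h1
  simpa only [half_cast, Cf_half, Complex.zero_re] using this

lemma ci_le (hβ : 0 < β) (hD : Df β (Real.pi / 2) = 0) {y : ℝ} (h0 : 0 < y) (h1 : y ≤ β) :
    (Cf β (y * I)).im ≤ -2 := by
  have mono : MonotoneOn (fun y : ℝ => (Cf β (y * I)).im) (Icc y β) := by
    apply monotoneOn_of_deriv_nonneg (convex_Icc _ _)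
    · intro t ht
      exact (ci_hasDeriv hβ (h0.trans_le ht.1) ht.2).continuousAt.continuousWithinAt
    · intro t ht
      rw [interior_Icc] at ht
      exact (ci_hasDeriv hβ (h0.trans ht.1) ht.2.le).differentiableAt.differentiableWithinAt
    · intro t ht
      rw [interior_Icc] at ht
      rw [(ci_hasDeriv hβ (h0.trans ht.1) ht.2.le).deriv]
      have := di_mono hβ (h0.trans ht.1) ht.2 le_rfl
      rw [Df_ibeta hβ, hD, Complex.zero_re] at this
      linarith
  have := mono (left_mem_Icc.mpr h1) (right_mem_Icc.mpr h1) h1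
  simpa [Cf_ibeta hβ] using this

lemma ci_exists (hβ : 0 < β) {s : ℝ} (hs : 2 ≤ s) :
    ∃ y : ℝ, 0 < y ∧ y ≤ β ∧ Cf β (y * I) = -(s * I) := by
  rcases hs.lt_or_eq with h | h
  · obtain ⟨y, a, b, c⟩ := ivt_top (f := fun y : ℝ => -(Cf β (y * I)).im) (E := s) hβ
      (fun y h0 h1 => (ci_hasDeriv hβ h0 h1).continuousAt.neg)
      (tendsto_neg_atBot_atTop.comp (ci_lim hβ)) (by simpa [Cf_ibeta hβ] using h)
    refine ⟨y, a, b.le, ?_⟩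
    rw [Cf_imag', ← c]; push_cast; ring
  · refine ⟨β, hβ, le_rfl, ?_⟩
    rw [Cf_ibeta hβ, ← h]; push_cast; ring

lemma crect_sym {v : ℂ} : pt β - v ∈ CRect β ↔ v ∈ CRect β := by
  rw [mem_crect, mem_crect, Complex.sub_re, Complex.sub_im, pt_re, pt_im]
  constructor <;> rintro ⟨⟨a, b⟩, c, d⟩ <;> refine ⟨⟨?_, ?_⟩, ?_, ?_⟩ <;> linarith

lemma rect_sym {v : ℂ} (hv : v ∈ Rect β) : pt β - v ∈ Rect β := by
  obtain ⟨a, b, c, d⟩ := hv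
  rw [Rect, mem_setOf_eq, Complex.sub_re, Complex.sub_im, pt_re, pt_im]
  refine ⟨?_, ?_, ?_, ?_⟩ <;> linarith

/-- on the boundary `C` avoids `-i(0,2)` -/
lemma boundary1 (hβ : 0 < β) (hD : Df β (Real.pi / 2) = 0) {v : ℂ} (hv : v ∈ CRect β) (hl : v ∉ Lam β)
    (hb : v.re = 0 ∨ v.im = 0) {s : ℝ} (h0 : 0 < s) (h2 : s < 2) : Cf β v ≠ -(s * I) := by
  obtain ⟨⟨a1, a2⟩, a3, a4⟩ := mem_crect.mp hv
  intro h
  rcases hb with hb | hb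
  · have e : v = (v.im : ℂ) * I := by apply Complex.ext <;> simp [hb]
    have : 0 < v.im := by
      rcases a3.lt_or_eq with h | h
      · exact h
      · exfalso; apply hl; rw [e, ← h]; simpa using zero_mem_lam
    have := ci_le hβ hD this a4
    rw [← e, h] at this
    simp at this; linarith
  · have e : v = (v.re : ℂ) := by apply Complex.ext <;> simp [hb]
    have p : 0 < v.re := by
      rcases a1.lt_or_eq with h | h
      · exact h
      · exfalso; apply hl; rw [e, ← h]; simpa using zero_mem_lam
    rcases a2.lt_or_eq with hlt | heq
    · have := cr_pos hβ hD p hlt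
      rw [← e, h] at this
      simp at this
    · rw [e, heq, half_cast, Cf_half] at h
      have := congrArg Complex.im h
      simp at this; linarith

lemma boundary (hβ : 0 < β) (hD : Df β (Real.pi / 2) = 0) {v : ℂ} (hv : v ∈ CRect β) (hl : v ∉ Lam β)
    {s : ℝ} (h0 : 0 < s) (h2 : s < 2) (h : Cf β v = -(s * I)) : v ∈ Rect β := by
  obtain ⟨⟨a1, a2⟩, a3, a4⟩ := mem_crect.mp hv
  by_contra hc
  have : (v.re = 0 ∨ v.im = 0) ∨ ((pt β - v).re = 0 ∨ (pt β - v).im = 0) := by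
    by_contra! hn
    obtain ⟨⟨n1, n2⟩, n3, n4⟩ := hn
    rw [Complex.sub_re, pt_re] at n3
    rw [Complex.sub_im, pt_im] at n4
    refine hc ⟨a1.lt_of_ne' n1, a2.lt_of_ne fun h => n3 (by linarith), a3.lt_of_ne' n2, 
      a4.lt_of_ne fun h => n4 (by linarith)⟩
  rcases this with hb | hb
  · exact boundary1 hβ hD hv hl hb h0 h2 h
  · refine boundary1 hβ hD (crect_sym.mpr hv) (sym_lam.not.mpr hl) hb (s := 2 - s) (by linarith) (by linarith) ?_
    rw [Cf_sym hβ hl, h]; push_cast; ring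

lemma rect_val (hβ : 0 < β) {v : ℂ} (hv : v ∈ Rect β) (hr : (Cf β v).re = 0) :
    ∃ s : ℝ, 0 < s ∧ s < 2 ∧ Cf β v = -(s * I) := by
  have key : ∀ v ∈ Rect β, (Cf β v).re = 0 → -(Cf β v).im < 2 := by
    intro v hv hr
    by_contra! hc
    obtain ⟨y, a, b, c⟩ := ci_exists hβ hc
    have hpi := Real.pi_pos
    have e := Cf_inj hβ (p := y * I) (q := v) (mem_crect.mpr (by simp; exact ⟨by positivity, a.le, b⟩))
      (imag_not_lam hβ a b) hv (by rw [c]; apply Complex.ext <;> simp [hr])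
    have := hv.1
    rw [← e] at this
    simp at this
  refine ⟨-(Cf β v).im, ?_, key v hv hr, by apply Complex.ext <;> simp [hr]⟩
  have := key _ (rect_sym hv) (by rw [Cf_sym hβ (rect_not_lam hβ hv)]; simp [hr])
  rw [Cf_sym hβ (rect_not_lam hβ hv)] at this
  simp at this; linarith

lemma Cf_mid (hβ : 0 < β) : Cf β (pt β / 2) = -I := by
  have := Cf_sym hβ (rect_not_lam hβ (half_pt_rect hβ))
  rw [show pt β - pt β / 2 = pt β / 2 by ring] at this
  linear_combination this / 2

lemma rect_exists (hβ : 0 < β) (hD : Df β (Real.pi / 2) = 0) {s : ℝ} (h0 : 0 < s) (h2 : s < 2) :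
    ∃ v ∈ Rect β, Cf β v = -(s * I) := by
  have hro : IsOpen (Rect β) := by
    have : Rect β = Ioo 0 (Real.pi / 2) ×ℂ Ioo 0 β := by
      ext v; simp [Rect, Complex.mem_reProdIm, and_assoc]
    rw [this]; exact isOpen_Ioo.reProdIm isOpen_Ioo
  have hop : IsOpen (Cf β '' Rect β) := by
    rw [isOpen_iff_mem_nhds]
    rintro _ ⟨v, hv, rfl⟩
    have hl := rect_not_lam hβ hv
    have st := (Cf_analytic hβ hl).hasStrictDerivAt
    rw [(Cf_hasDeriv hβ hl).deriv] at st
    have hn : Df β v ≠ 0 := fun h => by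
      have := Df_im_neg hβ hv
      rw [h] at this; simp at this
    rw [← st.map_nhds_eq (neg_ne_zero.mpr hn)]
    exact image_mem_map (hro.mem_nhds hv)
  have hcont : Continuous fun s : ℝ => -((s : ℂ) * I) := by fun_prop
  have := (isPreconnected_Ioo (a := (0:ℝ)) (b := 2)).subset_of_closure_inter_subset
    (u := (fun s : ℝ => -((s : ℂ) * I)) ⁻¹' (Cf β '' Rect β)) (hop.preimage hcont)
    ⟨1, by norm_num, pt β / 2, half_pt_rect hβ, by rw [Cf_mid hβ]; simp⟩ ?_
  · exact this ⟨h0, h2⟩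
  · rintro t ⟨ht, ht0, ht2⟩
    have hcl : -((t : ℂ) * I) ∈ closure (Cf β '' Rect β) :=
      (hcont.closure_preimage_subset _) ht
    obtain ⟨u, hu, hul⟩ := mem_closure_iff_seq_limit.mp hcl
    choose v hv hvu using hu
    obtain ⟨w, hw, σ, hσ, hwl⟩ := crect_compact.tendsto_subseq (fun n => rect_sub (hv n))
    have hCl : Tendsto (fun n => Cf β (v (σ n))) atTop (nhds (-((t : ℂ) * I))) := by
      have := hul.comp hσ.tendsto_atTop
      refine this.congr fun n => ?_
      rw [Function.comp_apply, hvu]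
    have hnl : w ∉ Lam β := by
      intro hwL
      have t1 := ((Th_diff hβ).continuous.tendsto w).comp hwl
      have t2 := ((Th_diff' hβ).continuous.tendsto w).comp hwl
      have t3 := hCl.mul t1
      rw [(Th_zero_iff hβ w).mpr hwL, mul_zero] at t3
      refine Th_simple hβ hwL (tendsto_nhds_unique t2 (t3.congr fun n => ?_))
      simp only [Function.comp_apply, Cf]
      exact div_mul_cancel₀ _ (Th_ne hβ (rect_not_lam hβ (hv _)))
    have e : Cf β w = -((t : ℂ) * I) :=
      tendsto_nhds_unique (((Cf_analytic hβ hnl).continuousAt.tendsto).comp hwl) hCl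
    exact ⟨w, boundary hβ hD hw hnl ht0 ht2 e, e⟩

/-- every point of the lower half plane is a value on the rectangle -/
lemma rect_reduce (hβ : 0 < β) {E : ℂ} (hE : E.im < 0) : ∃ v ∈ Rect β, Df β v = E := by
  have hpi := Real.pi_pos
  obtain ⟨u, hu, rfl⟩ := Df_surj hβ E
  set n := ⌊u.im / β⌋ with hn
  set u1 := u + ((-n : ℤ) : ℂ) * pt β with hu1
  set m := round (u1.re / Real.pi) with hm
  set u2 := u1 + ((-m : ℤ) : ℂ) * Real.pi with hu2
  have D2 : Df β u2 = Df β u := by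
    rw [hu2, hu1, add_assoc, Df_add_lam hβ ⟨-m, -n, by ring⟩]
  have im2 : u2.im = u.im - n * β := by
    rw [hu2, hu1]; simp [pt_im]; ring
  have re2 : u2.re = u1.re - m * Real.pi := by
    rw [hu2]; simp; ring
  have i0 : 0 ≤ u2.im := by
    have := Int.floor_le (u.im / β)
    rw [← hn, le_div_iff₀ hβ] at this
    rw [im2]; linarith
  have i1 : u2.im < β := by
    have := Int.lt_floor_add_one (u.im / β)
    rw [← hn, div_lt_iff₀ hβ] at this
    rw [im2]; linarith
  have r1 : |u2.re| ≤ Real.pi / 2 := by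
    have := abs_sub_round (u1.re / Real.pi)
    rw [← hm] at this
    have e : u2.re = (u1.re / Real.pi - m) * Real.pi := by rw [re2]; field_simp
    rw [e, abs_mul, abs_of_pos hpi]
    nlinarith
  have hE2 : (Df β u2).im < 0 := by rw [D2]; exact hE
  rw [← D2]
  have bd : ∀ w : ℂ, 0 ≤ w.re → w.re ≤ Real.pi / 2 → 0 ≤ w.im → w.im < β → (Df β w).im ≠ 0 → w ∈ Rect β := by
    intro w a b c d hne
    refine ⟨a.lt_of_ne' fun h => hne ?_, b.lt_of_ne fun h => hne ?_, c.lt_of_ne' fun h => hne ?_, d⟩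
    · have e : w = (w.im : ℂ) * I := by apply Complex.ext <;> simp [h]
      rw [e, Df_imag hβ, Complex.ofReal_im]
    · have e : w = pt β - ((β - w.im : ℝ) : ℂ) * I := by
        apply Complex.ext <;> simp [h, pt_re, pt_im]
      rw [e, Df_sym hβ, Df_imag hβ, Complex.ofReal_im]
    · have e : w = (w.re : ℂ) := by apply Complex.ext <;> simp [h]
      rw [e, Df_real hβ, Complex.ofReal_im]
  obtain ⟨r2, r3⟩ := abs_le.mp r1
  rcases le_total 0 u2.re with h | h
  · exact ⟨u2, bd _ h r3 i0 i1 hE2.ne, rfl⟩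
  · exfalso
    have e : Df β (-(starRingEnd ℂ) u2) = (starRingEnd ℂ) (Df β u2) := by
      rw [Df_neg hβ, Df_conj hβ]
    have hr := bd (-(starRingEnd ℂ) u2) (by simpa using h) (by simp; linarith) (by simpa using i0) (by simpa using i1)
      (by rw [e]; simpa using hE2.ne)
    have := Df_im_neg hβ hr
    rw [e, Complex.conj_im] at this
    linarith

end

noncomputable section
variable {β : ℝ}

def Gf (β : ℝ) (v : ℂ) : ℂ := Complex.sin (Real.pi * I * Cf β v / 2) ^ 2

lemma Gf_neg (v : ℂ) : Gf β (-v) = Gf β v := by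
  unfold Gf
  rw [Cf_neg, show (Real.pi * I * -Cf β v / 2 : ℂ) = -(Real.pi * I * Cf β v / 2) by ring, Complex.sin_neg, neg_sq]

lemma Gf_add_lam (hβ : 0 < β) {v w : ℂ} (hv : v ∉ Lam β) (hw : w ∈ Lam β) : Gf β (v + w) = Gf β v := by
  obtain ⟨n, hn⟩ := Cf_add_lam hβ hv hw
  unfold Gf
  rw [hn, show (Real.pi * I * (Cf β v - 2 * n * I) / 2 : ℂ) = Real.pi * I * Cf β v / 2 + n * Real.pi by
    linear_combination (-(Real.pi * n) : ℂ) * I_sq]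
  have h := Complex.cos_periodic.int_mul n (2 * (Real.pi * I * Cf β v / 2))
  rw [show (2 * (Real.pi * I * Cf β v / 2) + n * (2 * Real.pi) : ℂ) = 2 * (Real.pi * I * Cf β v / 2 + n * Real.pi) by ring,
    Complex.cos_two_mul, Complex.cos_two_mul] at h
  rw [Complex.sin_sq, Complex.sin_sq]
  linear_combination (-1 / 2 : ℂ) * h

lemma Gf_fibre (hβ : 0 < β) {u v : ℂ} (hu : u ∉ Lam β) (hv : v ∉ Lam β) (h : Df β u = Df β v) :
    Gf β u = Gf β v := by
  rcases (Df_eq_iff hβ hu hv).mp h with h | h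
  · have := Gf_add_lam hβ (v := -v) (by rwa [neg_mem_lam]) h
    rw [Gf_neg] at this
    rw [← this]; congr 1; ring
  · have := Gf_add_lam hβ (v := v) hv h
    rw [← this]; congr 1; ring

open Classical in
/-- squared discriminant type function, as a function of the energy -/
def gE (β : ℝ) (E : ℂ) : ℂ := if h : ∃ v, v ∉ Lam β ∧ Df β v = E then Gf β h.choose else 0

lemma gE_Df (hβ : 0 < β) {v : ℂ} (hv : v ∉ Lam β) : gE β (Df β v) = Gf β v := by
  have h : ∃ u, u ∉ Lam β ∧ Df β u = Df β v := ⟨v, hv, rfl⟩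
  rw [gE, dif_pos h]
  exact Gf_fibre hβ h.choose_spec.1 hv h.choose_spec.2

lemma Gf_analytic (hβ : 0 < β) {v : ℂ} (hv : v ∉ Lam β) : AnalyticAt ℂ (Gf β) v := by
  have := Cf_analytic hβ hv
  unfold Gf
  have : AnalyticAt ℂ (fun v => Real.pi * I * Cf β v / 2) v := by fun_prop
  exact ((Complex.analyticAt_sin).fun_comp this).pow 2

lemma gE_comp (hβ : 0 < β) {v : ℂ} (hv : v ∉ Lam β) : gE β ∘ Df β =ᶠ[nhds v] Gf β := by
  filter_upwards [lam_compl_nhds hβ hv] with w hw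
  exact gE_Df hβ hw

lemma gE_an1 (hβ : 0 < β) {v : ℂ} (hv : v ∉ Lam β) (hd : deriv (Df β) v ≠ 0) : AnalyticAt ℂ (gE β) (Df β v) := by
  rw [← analyticAt_comp_iff_of_deriv_ne_zero (Df_analytic hβ hv) hd]
  exact (Gf_analytic hβ hv).congr (gE_comp hβ hv).symm

lemma Df_deriv_disc (hβ : 0 < β) {v : ℂ} (hv : v ∉ Lam β) :
    ∀ᶠ w in nhdsWithin v {v}ᶜ, deriv (Df β) w ≠ 0 := by
  have h := lam_discrete hβ (2 * v)
  have t : Tendsto (fun w : ℂ => 2 * w) (nhdsWithin v {v}ᶜ) (nhdsWithin (2 * v) {2 * v}ᶜ) := by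
    apply tendsto_nhdsWithin_of_tendsto_nhds_of_eventually_within
    · exact (Continuous.tendsto (by fun_prop) v).mono_left nhdsWithin_le_nhds
    · filter_upwards [self_mem_nhdsWithin] with w hw
      simpa using hw
  filter_upwards [t.eventually h, (lam_compl_nhds hβ hv).filter_mono nhdsWithin_le_nhds] with w a b
  rw [Ne, Df_deriv_eq_zero hβ b]; exact a

lemma Df_open (hβ : 0 < β) {v : ℂ} (hv : v ∉ Lam β) : nhds (Df β v) ≤ map (Df β) (nhds v) := by
  refine (Df_analytic hβ hv).eventually_constant_or_nhds_le_map_nhds.resolve_left fun h => ?_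
  have h1 : ∀ᶠ w in nhds v, deriv (Df β) w = 0 := by
    filter_upwards [h.eventually_nhds] with w hw
    rw [EventuallyEq.deriv_eq (f := fun _ => Df β v) hw]; simp
  have h2 := (h1.filter_mono nhdsWithin_le_nhds).and (Df_deriv_disc hβ hv)
  obtain ⟨w, a, b⟩ := h2.exists
  exact b a

lemma gE_analytic (hβ : 0 < β) (E : ℂ) : AnalyticAt ℂ (gE β) E := by
  obtain ⟨v, hv, rfl⟩ := Df_surj hβ E
  apply analyticAt_of_differentiable_on_punctured_nhds_of_continuousAt
  · rw [eventually_nhdsWithin_iff]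
    apply Df_open hβ hv
    change ∀ᶠ w in nhds v, _
    have := Df_deriv_disc hβ hv
    rw [eventually_nhdsWithin_iff] at this
    filter_upwards [this, lam_compl_nhds hβ hv] with w h1 h2 h3
    exact (gE_an1 hβ h2 (h1 (by rintro rfl; exact h3 rfl))).differentiableAt
  · unfold ContinuousAt
    rw [gE_Df hβ hv]
    have : Tendsto (gE β) (map (Df β) (nhds v)) (nhds (Gf β v)) := by
      rw [tendsto_map'_iff]
      exact (Gf_analytic hβ hv).continuousAt.congr' (gE_comp hβ hv).symm
    exact this.mono_left (Df_open hβ hv)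

lemma Gf_conj (v : ℂ) : Gf β ((starRingEnd ℂ) v) = (starRingEnd ℂ) (Gf β v) := by
  unfold Gf
  rw [Cf_conj, map_pow, ← Complex.sin_conj]
  simp only [map_mul, map_div₀, conj_ofReal, conj_I, map_ofNat]
  rw [show (Real.pi * -I * (starRingEnd ℂ) (Cf β v) / 2 : ℂ) = -(Real.pi * I * (starRingEnd ℂ) (Cf β v) / 2) by ring,
    Complex.sin_neg, neg_sq]

lemma gE_conj (hβ : 0 < β) (E : ℂ) : gE β ((starRingEnd ℂ) E) = (starRingEnd ℂ) (gE β E) := by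
  obtain ⟨v, hv, rfl⟩ := Df_surj hβ E
  rw [← Df_conj hβ, gE_Df hβ (by rwa [conj_mem_lam hβ]), gE_Df hβ hv, Gf_conj]

/-- order relation -/
lemma order_rel (hβ : 0 < β) {v : ℂ} (hv : v ∉ Lam β) (c : ℂ) :
    analyticOrderAt (fun w => Gf β w - c) v =
      analyticOrderAt (fun E => gE β E - c) (Df β v) * analyticOrderAt (fun w => Df β w - Df β v) v := by
  rw [← AnalyticAt.analyticOrderAt_comp (f := fun E => gE β E - c) ((gE_analytic hβ _).sub analyticAt_const) (Df_analytic hβ hv)]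
  apply analyticOrderAt_congr
  filter_upwards [gE_comp hβ hv] with w hw
  simp only [Function.comp_apply] at hw ⊢
  rw [hw]

lemma Gf_hasDeriv (hβ : 0 < β) {v : ℂ} (hv : v ∉ Lam β) :
    HasDerivAt (Gf β) (-(Real.pi * I / 2) * Complex.sin (Real.pi * I * Cf β v) * Df β v) v := by
  have h := ((((Cf_hasDeriv hβ hv).const_mul (Real.pi * I)).div_const 2).csin).pow 2
  refine h.congr_deriv ?_
  rw [show (Real.pi * I * Cf β v : ℂ) = 2 * (Real.pi * I * Cf β v / 2) by ring, Complex.sin_two_mul]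
  simp
  ring

lemma gE_deriv_ne (hβ : 0 < β) {v : ℂ} (hv : v ∈ Rect β) (hr : (Cf β v).re = 0) : deriv (gE β) (Df β v) ≠ 0 := by
  have hl := rect_not_lam hβ hv
  have hD : Df β v ≠ 0 := fun h => by have := Df_im_neg hβ hv; rw [h] at this; simp at this
  obtain ⟨s, s0, s2, hs⟩ := rect_val hβ hv hr
  have hz : (Real.pi * I * Cf β v : ℂ) = ((Real.pi * s : ℝ) : ℂ) := by
    rw [hs]; push_cast; linear_combination (-(Real.pi * s) : ℂ) * I_sq
  have key : analyticOrderAt (fun E => gE β E - gE β (Df β v)) (Df β v) = 1 := by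
    have hrel := order_rel hβ hl (gE β (Df β v))
    by_cases h1 : s = 1
    · have hv' : v = pt β / 2 := Cf_inj hβ (rect_sub hv) hl (half_pt_rect hβ) (by rw [hs, Cf_mid hβ, h1]; simp)
      have hgv : gE β (Df β v) = 1 := by
        rw [gE_Df hβ hl, Gf, hz, h1, show (((Real.pi * 1 : ℝ) : ℂ) / 2) = ((Real.pi / 2 : ℝ) : ℂ) by push_cast; ring,
          ← Complex.ofReal_sin, Real.sin_pi_div_two]; simp
      have hA : AnalyticAt ℂ (fun w => Complex.cos (Real.pi * I * Cf β w / 2)) v := by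
        have := Cf_analytic hβ hl
        have : AnalyticAt ℂ (fun v => Real.pi * I * Cf β v / 2) v := by fun_prop
        exact (Complex.analyticAt_cos).fun_comp this
      have e0 : (Real.pi * I * Cf β v / 2 : ℂ) = ((Real.pi / 2 : ℝ) : ℂ) := by
        rw [hz, h1]; push_cast; ring
      have hc0 : Complex.cos (Real.pi * I * Cf β v / 2) = 0 := by
        rw [e0, ← Complex.ofReal_cos, Real.cos_pi_div_two]; simp
      have hco : analyticOrderAt (fun w => Complex.cos (Real.pi * I * Cf β w / 2)) v = 1 := by
        apply hA.analyticOrderAt_eq_one_of_zero_deriv_ne_zero hc0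
        rw [((((Cf_hasDeriv hβ hl).const_mul (Real.pi * I)).div_const 2).ccos).deriv, e0, ← Complex.ofReal_sin,
          Real.sin_pi_div_two]
        simp [hD, Real.pi_ne_zero]
      have hG : analyticOrderAt (fun w => Gf β w - gE β (Df β v)) v = 2 := by
        have : (fun w => Gf β w - gE β (Df β v)) = -((fun w => Complex.cos (Real.pi * I * Cf β w / 2)) ^ 2) := by
          funext w
          simp only [Pi.neg_apply, Pi.pow_apply, hgv, Gf]
          linear_combination Complex.sin_sq_add_cos_sq (Real.pi * I * Cf β w / 2)
        rw [this, analyticOrderAt_neg, analyticOrderAt_pow hA, hco]; simp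
      have hDo : 2 ≤ analyticOrderAt (fun w => Df β w - Df β v) v := by
        have h1 := (Df_analytic hβ hl).analyticOrderAt_deriv_add_one
        have h2 : analyticOrderAt (deriv (Df β)) v ≠ 0 := by
          rw [(Df_analytic hβ hl).deriv.analyticOrderAt_ne_zero, Df_deriv_eq_zero hβ hl, hv']
          rw [show 2 * (pt β / 2) = pt β by ring]; exact pt_mem
        rw [← h1]
        calc (2 : ℕ∞) = 1 + 1 := by norm_num
          _ ≤ _ := by gcongr; exact Order.one_le_iff_ne_zero.mpr h2
      rw [hG] at hrel
      have hg0 : analyticOrderAt (fun E => gE β E - gE β (Df β v)) (Df β v) ≠ 0 := by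
        intro h; rw [h] at hrel; simp at hrel
      revert hrel hDo hg0
      generalize analyticOrderAt (fun E => gE β E - gE β (Df β v)) (Df β v) = a
      generalize analyticOrderAt (fun w => Df β w - Df β v) v = b
      intro h1 h2 h3
      by_contra hne
      have : 2 ≤ a := by
        have := Order.one_le_iff_ne_zero.mpr h3
        have := lt_of_le_of_ne this (Ne.symm hne)
        have h := Order.add_one_le_of_lt this
        rwa [one_add_one_eq_two] at h
      have : (2 : ℕ∞) * 2 ≤ a * b := by gcongr
      rw [← h1] at this
      norm_num at this
    · have hG : analyticOrderAt (fun w => Gf β w - gE β (Df β v)) v = 1 := by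
        rw [gE_Df hβ hl]
        apply (Gf_analytic hβ hl).analyticOrderAt_sub_eq_one_of_deriv_ne_zero
        rw [(Gf_hasDeriv hβ hl).deriv, hz, ← Complex.ofReal_sin]
        have : Real.sin (Real.pi * s) ≠ 0 := by
          rw [Real.sin_ne_zero_iff]
          intro n hn
          rw [mul_comm] at hn
          have := mul_left_cancel₀ Real.pi_ne_zero hn
          subst this
          have a : (0 : ℤ) < n := by exact_mod_cast s0
          have b : n < (2 : ℤ) := by exact_mod_cast s2
          exact h1 (by have : n = 1 := by omega
                       simp [this])
        simp [hD, Real.pi_ne_zero, -Complex.ofReal_sin]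
        exact this
      rw [hG] at hrel
      revert hrel
      generalize analyticOrderAt (fun E => gE β E - gE β (Df β v)) (Df β v) = a
      generalize analyticOrderAt (fun w => Df β w - Df β v) v = b
      intro h1
      have ha : a ≠ 0 := by rintro rfl; simp at h1
      have hb : b ≠ 0 := by rintro rfl; simp at h1
      have ha1 := Order.one_le_iff_ne_zero.mpr ha
      have hb1 := Order.one_le_iff_ne_zero.mpr hb
      apply le_antisymm _ ha1
      calc a = a * 1 := by simp
        _ ≤ a * b := by gcongr
        _ = 1 := h1.symm
  have h1 := (gE_analytic hβ (Df β v)).analyticOrderAt_deriv_add_one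
  rw [key] at h1
  have : analyticOrderAt (deriv (gE β)) (Df β v) = 0 := by
    revert h1
    generalize analyticOrderAt (deriv (gE β)) (Df β v) = a
    intro h1
    by_contra h
    have := Order.one_le_iff_ne_zero.mpr h
    have h2 : (1 : ℕ∞) + 1 ≤ a + 1 := by gcongr
    rw [h1] at h2; norm_num at h2
  rwa [(gE_analytic hβ (Df β v)).deriv.analyticOrderAt_eq_zero] at this

lemma gE_order (hβ : 0 < β) (hD : Df β (Real.pi / 2) = 0) : analyticOrderAt (gE β) 0 = 3 := by
  have hl := half_not_lam hβ
  set v : ℂ := Real.pi / 2 with hv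
  have a1 : analyticOrderAt (deriv (Df β)) v = 1 := by
    apply (Df_analytic hβ hl).deriv.analyticOrderAt_eq_one_of_zero_deriv_ne_zero
    · rw [Df_deriv_eq_zero hβ hl, hv, show (2 * (Real.pi / 2) : ℂ) = Real.pi by ring]; exact pi_mem
    · intro h0
      have hE : (fun w => deriv (Df β) w * Th β w ^ 4) =ᶠ[nhds v] fun w => - (Th β (2 * w) * deriv (Th β) 0 ^ 3) := by
        filter_upwards [lam_compl_nhds hβ hl] with w hw
        exact Df_deriv_formula hβ hw
      have hz : deriv (Df β) v = 0 := by
        rw [Df_deriv_eq_zero hβ hl, hv, show (2 * (Real.pi / 2) : ℂ) = Real.pi by ring]; exact pi_mem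
      have hp : 2 * v = Real.pi := by rw [hv]; ring
      have l := ((Df_analytic hβ hl).deriv.differentiableAt.hasDerivAt.mul ((Th_diff hβ v).hasDerivAt.pow 4))
      have r : HasDerivAt (fun w => - (Th β (2 * w) * deriv (Th β) 0 ^ 3)) (-((deriv (Th β) (2 * v) * 2) * deriv (Th β) 0 ^ 3)) v := by
        have : HasDerivAt (fun w : ℂ => 2 * w) 2 v := by simpa using (hasDerivAt_id v).const_mul 2
        exact (((Th_diff hβ (2 * v)).hasDerivAt.comp v this).mul_const _).neg
      have := (l.congr_of_eventuallyEq hE.symm).unique r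
      rw [h0, hz, hp] at this
      have h3 := Th_simple hβ (pi_mem (β := β))
      have h4 := Th_deriv_zero hβ
      simp [h3, h4] at this
  have a2 : analyticOrderAt (fun w => Df β w - Df β v) v = 2 := by
    rw [← (Df_analytic hβ hl).analyticOrderAt_deriv_add_one, a1]; norm_num
  have a3 : analyticOrderAt (Cf β) v = 3 := by
    have h := (Cf_analytic hβ hl).analyticOrderAt_deriv_add_one
    have h0 : analyticOrderAt (deriv (Cf β)) v = 2 := by
      rw [← a2, ← analyticOrderAt_neg]
      apply analyticOrderAt_congr
      filter_upwards [lam_compl_nhds hβ hl] with w hw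
      rw [Pi.neg_apply, (Cf_hasDeriv hβ hw).deriv, hD]; simp
    rw [h0] at h
    rw [show analyticOrderAt (Cf β) v = analyticOrderAt (fun x => Cf β x - Cf β v) v by rw [hv, Cf_half]; simp, ← h]
    norm_num
  have hAz : AnalyticAt ℂ (fun v => Real.pi * I * Cf β v / 2) v := by
    have := Cf_analytic hβ hl
    fun_prop
  have hz0 : (Real.pi * I * Cf β v / 2 : ℂ) = 0 := by rw [hv, Cf_half]; simp
  have a4 : analyticOrderAt (fun v => Real.pi * I * Cf β v / 2) v = 3 := by
    have : (fun v => Real.pi * I * Cf β v / 2) = (fun _ => (Real.pi * I / 2 : ℂ)) * Cf β := by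
      funext w; simp only [Pi.mul_apply]; ring
    rw [this, analyticOrderAt_mul analyticAt_const (Cf_analytic hβ hl), a3,
      (analyticAt_const (𝕜 := ℂ)).analyticOrderAt_eq_zero.mpr (by simp [Real.pi_ne_zero])]
    simp
  have a5 : analyticOrderAt (fun w => Complex.sin (Real.pi * I * Cf β w / 2)) v = 3 := by
    have h := AnalyticAt.analyticOrderAt_comp (f := Complex.sin) (g := fun v => Real.pi * I * Cf β v / 2) (z₀ := v)
      Complex.analyticAt_sin hAz
    simp only [hz0, sub_zero] at h
    rw [a4] at h
    have h6 : analyticOrderAt Complex.sin 0 = 1 := by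
      apply Complex.analyticAt_sin.analyticOrderAt_eq_one_of_zero_deriv_ne_zero
      · simp
      · rw [Complex.deriv_sin]; simp
    rw [h6, one_mul] at h
    exact h
  have hAs : AnalyticAt ℂ (fun w => Complex.sin (Real.pi * I * Cf β w / 2)) v := (Complex.analyticAt_sin).fun_comp hAz
  have a6 : analyticOrderAt (fun w => Gf β w - 0) v = 6 := by
    have : (fun w => Gf β w - 0) = (fun w => Complex.sin (Real.pi * I * Cf β w / 2)) ^ 2 := by
      funext w; simp [Gf]
    rw [this, analyticOrderAt_pow hAs, a5]; norm_num
  have h := order_rel hβ hl 0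
  rw [a6, a2, hD] at h
  simp only [sub_zero] at h
  change _ = analyticOrderAt (gE β) 0 * 2 at h
  revert h
  generalize analyticOrderAt (gE β) 0 = a
  intro h
  cases a with
  | top => simp at h
  | coe n => norm_cast at h ⊢; omega

end

noncomputable section
variable {β : ℝ}

lemma glue {f e0 : ℝ → ℂ} (h : ∀ p0 ∈ Icc (0 : ℝ) 1, ∃ e : ℝ → ℂ, AnalyticAt ℝ e p0 ∧ deriv e p0 ≠ 0 ∧
      ∀ᶠ p in nhds p0, p ∈ Icc (0 : ℝ) 1 → e p = f p)
    (h0 : AnalyticAt ℝ e0 0) (h1 : deriv e0 0 ≠ 0) (h2 : ∀ᶠ p in nhds 0, p ∈ Icc (0 : ℝ) 1 → e0 p = f p) :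
    ∃ F : ℝ → ℂ, AnalyticOnNhd ℝ F (Icc 0 1) ∧ (∀ t ∈ Icc (0 : ℝ) 1, deriv F t ≠ 0) ∧ EqOn F f (Icc 0 1) ∧
      deriv F 0 = deriv e0 0 := by
  obtain ⟨e1, a1, b1, c1⟩ := h 1 (by simp)
  set F : ℝ → ℂ := fun p => if p < 0 then e0 p else if p ≤ 1 then f p else e1 p with hF
  have g0 : F =ᶠ[nhds 0] e0 := by
    filter_upwards [h2, Iio_mem_nhds (zero_lt_one' ℝ)] with p hp hp1
    simp only [hF]
    split_ifs with q1 q2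
    · rfl
    · exact (hp ⟨not_lt.mp q1, q2⟩).symm
    · exact absurd (le_of_lt hp1) q2
  have g1 : F =ᶠ[nhds 1] e1 := by
    filter_upwards [c1, Ioi_mem_nhds (zero_lt_one' ℝ)] with p hp hp1
    simp only [hF]
    split_ifs with q1 q2
    · exact absurd hp1 (by simpa using q1.le)
    · exact (hp ⟨not_lt.mp q1, q2⟩).symm
    · rfl
  have key : ∀ t ∈ Icc (0 : ℝ) 1, AnalyticAt ℝ F t ∧ deriv F t ≠ 0 := by
    intro t ht
    by_cases t0 : t = 0
    · subst t0
      exact ⟨h0.congr g0.symm, by rwa [g0.deriv_eq]⟩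
    by_cases t1 : t = 1
    · subst t1
      exact ⟨a1.congr g1.symm, by rwa [g1.deriv_eq]⟩
    obtain ⟨e, a, b, c⟩ := h t ht
    have g : F =ᶠ[nhds t] e := by
      have i1 : 0 < t := lt_of_le_of_ne ht.1 (Ne.symm t0)
      have i2 : t < 1 := lt_of_le_of_ne ht.2 t1
      filter_upwards [c, Ioo_mem_nhds i1 i2] with p hp hp1
      simp only [hF]
      rw [if_neg (not_lt.mpr hp1.1.le), if_pos hp1.2.le, hp ⟨hp1.1.le, hp1.2.le⟩]
    exact ⟨a.congr g.symm, by rwa [g.deriv_eq]⟩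
  refine ⟨F, fun t ht => (key t ht).1, fun t ht => (key t ht).2, fun t ht => ?_, g0.deriv_eq⟩
  simp only [hF]
  rw [if_neg (not_lt.mpr ht.1), if_pos ht.2]

lemma lower_re (hβ : 0 < β) {v : ℂ} (hl : v ∉ Lam β) {t : ℝ} (h0 : 0 ≤ t) (h1 : t ≤ 1) (h : Gf β v = t) :
    (Cf β v).re = 0 := by
  have hs1 : Real.sqrt t ≤ 1 := by simpa using h1
  have hs0 := Real.sqrt_nonneg t
  set θ := Real.arcsin (Real.sqrt t)
  have hθ : Real.sin θ = Real.sqrt t := Real.sin_arcsin (by linarith) hs1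
  set z : ℂ := Real.pi * I * Cf β v / 2 with hz
  have e : Complex.sin z ^ 2 = (Complex.sin (θ : ℂ)) ^ 2 := by
    rw [← Complex.ofReal_sin, hθ, ← Complex.ofReal_pow, Real.sq_sqrt h0]; exact h
  have him : z.im = 0 := by
    rcases sq_eq_sq_iff_eq_or_eq_neg.mp e with h | h
    · obtain ⟨k, hk | hk⟩ := Complex.sin_eq_sin_iff.mp h
      · have := congrArg Complex.im hk
        simp at this; linarith
      · have := congrArg Complex.im hk
        simp at this; linarith
    · rw [← Complex.sin_neg] at h
      obtain ⟨k, hk | hk⟩ := Complex.sin_eq_sin_iff.mp h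
      · have := congrArg Complex.im hk
        simp at this; linarith
      · have := congrArg Complex.im hk
        simp at this; linarith
  rw [hz] at him
  have : (Real.pi * I * Cf β v / 2 : ℂ).im = Real.pi * (Cf β v).re / 2 := by
    rw [show (Real.pi * I * Cf β v / 2 : ℂ) = ((Real.pi / 2 : ℝ) : ℂ) * (I * Cf β v) by push_cast; ring,
      Complex.im_ofReal_mul]
    simp; ring
  rw [this] at him
  have hp := Real.pi_pos
  have h3 : Real.pi * (Cf β v).re = 0 := by linarith
  exact (mul_eq_zero.mp h3).resolve_left hp.ne'

lemma Gf_val {v : ℂ} {s : ℝ} (hs : Cf β v = -(s * I)) : Gf β v = ((Real.sin (Real.pi * s / 2) ^ 2 : ℝ) : ℂ) := by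
  rw [Gf, hs, show (Real.pi * I * -(s * I) / 2 : ℂ) = ((Real.pi * s / 2 : ℝ) : ℂ) by
    push_cast; linear_combination (-(Real.pi * s) / 2 : ℂ) * I_sq]
  push_cast; rfl

lemma lower_rep (hβ : 0 < β) {E : ℂ} (hE : E.im < 0) {t : ℝ} (h0 : 0 ≤ t) (h1 : t ≤ 1) (h : gE β E = t) :
    ∃ v ∈ Rect β, Df β v = E ∧ (Cf β v).re = 0 := by
  obtain ⟨v, hv, rfl⟩ := rect_reduce hβ hE
  have hl := rect_not_lam hβ hv
  rw [gE_Df hβ hl] at h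
  exact ⟨v, hv, rfl, lower_re hβ hl h0 h1 h⟩

lemma lower_unique (hβ : 0 < β) {E E' : ℂ} (hE : E.im < 0) (hE' : E'.im < 0) {t : ℝ} (h0 : 0 ≤ t) (h1 : t ≤ 1)
    (h : gE β E = t) (h' : gE β E' = t) : E = E' := by
  obtain ⟨v, hv, rfl, hr⟩ := lower_rep hβ hE h0 h1 h
  obtain ⟨v', hv', rfl, hr'⟩ := lower_rep hβ hE' h0 h1 h'
  have hl := rect_not_lam hβ hv
  have hl' := rect_not_lam hβ hv'
  obtain ⟨s, s0, s2, hs⟩ := rect_val hβ hv hr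
  obtain ⟨s', s0', s2', hs'⟩ := rect_val hβ hv' hr'
  rw [gE_Df hβ hl, Gf_val hs] at h
  rw [gE_Df hβ hl', Gf_val hs'] at h'
  have e : Real.sin (Real.pi * s / 2) ^ 2 = Real.sin (Real.pi * s' / 2) ^ 2 := by exact_mod_cast h.trans h'.symm
  have e2 : Real.cos (Real.pi * s) = Real.cos (Real.pi * s') := by
    rw [show Real.pi * s = 2 * (Real.pi * s / 2) by ring, show Real.pi * s' = 2 * (Real.pi * s' / 2) by ring,
      Real.cos_two_mul, Real.cos_two_mul, Real.cos_sq', Real.cos_sq', e]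
  have hp := Real.pi_pos
  obtain ⟨k, hk | hk⟩ := Real.cos_eq_cos_iff.mp e2
  · have : s' = 2 * k + s := by
      apply mul_left_cancel₀ hp.ne'; rw [hk]; ring
    have a : (k : ℝ) < 1 := by linarith
    have b : (-1 : ℝ) < k := by linarith
    have a' : k < 1 := by exact_mod_cast a
    have b' : -1 < k := by exact_mod_cast b
    have : k = 0 := by omega
    have : s' = s := by simp_all
    rw [Cf_inj hβ (rect_sub hv) hl hv' (by rw [hs, hs', this])]
  · have : s' = 2 * k - s := by
      apply mul_left_cancel₀ hp.ne'; rw [hk]; ring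
    have a : (k : ℝ) < 2 := by linarith
    have b : (0 : ℝ) < k := by linarith
    have a' : k < 2 := by exact_mod_cast a
    have b' : 0 < k := by exact_mod_cast b
    have : k = 1 := by omega
    have h3 : s' = 2 - s := by simp_all
    rw [← Df_sym hβ v']
    rw [Cf_inj hβ (rect_sub hv) hl (rect_sym hv') (by rw [Cf_sym hβ hl', hs, hs', h3]; push_cast; ring)]

lemma lower_exists (hβ : 0 < β) (hD : Df β (Real.pi / 2) = 0) {t : ℝ} (h0 : 0 < t) (h1 : t ≤ 1) :
    ∃ E : ℂ, E.im < 0 ∧ gE β E = t := by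
  have hs1 : Real.sqrt t ≤ 1 := by simpa using h1
  have hs0 := Real.sqrt_pos.mpr h0
  set θ := Real.arcsin (Real.sqrt t) with hθd
  have hθ : Real.sin θ = Real.sqrt t := Real.sin_arcsin (by linarith) hs1
  have hp := Real.pi_pos
  have t0 : 0 < θ := Real.arcsin_pos.mpr hs0
  have t1 : θ ≤ Real.pi / 2 := Real.arcsin_le_pi_div_two _
  obtain ⟨v, hv, hc⟩ := rect_exists hβ hD (s := 2 * θ / Real.pi) (by positivity) (by rw [div_lt_iff₀ hp]; linarith)
  refine ⟨Df β v, Df_im_neg hβ hv, ?_⟩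
  rw [gE_Df hβ (rect_not_lam hβ hv), Gf_val hc, show Real.pi * (2 * θ / Real.pi) / 2 = θ by field_simp, hθ,
    Real.sq_sqrt h0.le]

lemma lower_deriv (hβ : 0 < β) {E : ℂ} (hE : E.im < 0) {t : ℝ} (h0 : 0 ≤ t) (h1 : t ≤ 1) (h : gE β E = t) :
    deriv (gE β) E ≠ 0 := by
  obtain ⟨v, hv, rfl, hr⟩ := lower_rep hβ hE h0 h1 h
  exact gE_deriv_ne hβ hv hr

lemma lower_spec (hβ : 0 < β) {v : ℂ} (hv : v ∉ Lam β) (hE : (Df β v).im < 0) (hr : (Cf β v).re = 0) :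
    ∃ t : ℝ, 0 < t ∧ t ≤ 1 ∧ gE β (Df β v) = t := by
  obtain ⟨u, hu, he⟩ := rect_reduce hβ hE
  have hl := rect_not_lam hβ hu
  obtain ⟨s, s0, s2, hs⟩ := rect_val hβ hu ((Cf_re_fibre hβ hl hv he).mpr hr)
  have hp := Real.pi_pos
  refine ⟨Real.sin (Real.pi * s / 2) ^ 2, ?_, Real.sin_sq_le_one _, ?_⟩
  · apply pow_pos
    apply Real.sin_pos_of_pos_of_lt_pi <;> nlinarith
  · rw [← he, gE_Df hβ hl, Gf_val hs]

lemma gE_real_neg (hβ : 0 < β) (hD : Df β (Real.pi / 2) = 0) {E : ℝ} (hE : 0 < E) :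
    ∃ q : ℝ, q < 0 ∧ gE β E = q := by
  obtain ⟨y, y0, y1, hy⟩ := real_exists hβ (x := Real.pi / 2) (E := E) (by positivity) le_rfl (by
    rw [half_cast, hD]; simpa using hE)
  have hl := real_not_lam hβ y0 (y1.le)
  have hc := cr_pos hβ hD y0 y1
  refine ⟨-Real.sinh (Real.pi * (Cf β y).re / 2) ^ 2, ?_, ?_⟩
  · have : 0 < Real.sinh (Real.pi * (Cf β y).re / 2) := Real.sinh_pos_iff.mpr (by positivity)
    nlinarith
  · rw [← hy, gE_Df hβ hl, Gf, Cf_real]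
    simp only [ofReal_re]
    rw [show (Real.pi * I * ((Cf β y).re : ℂ) / 2 : ℂ) = ((Real.pi * (Cf β y).re / 2 : ℝ) : ℂ) * I by push_cast; ring,
      Complex.sin_mul_I, mul_pow, I_sq]
    push_cast; ring

end

noncomputable section
variable {β : ℝ}

lemma germ_zero (hβ : 0 < β) (hD : Df β (Real.pi / 2) = 0) : ∃ (e : ℂ → ℂ) (a : ℝ), 0 < a ∧ AnalyticAt ℂ e 0 ∧
    e 0 = 0 ∧ deriv e 0 = a * cexp (-(Real.pi * I / 3)) ∧ ∀ᶠ p in nhds 0, gE β (e p) = p ^ 3 := by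
  have ho := gE_order hβ hD
  obtain ⟨h, ha, hn, hE⟩ := (gE_analytic hβ 0).analyticOrderAt_eq_natCast (n := 3) |>.mp (by exact_mod_cast ho)
  simp only [sub_zero, smul_eq_mul] at hE
  -- `h 0` is a negative real
  have hcast : Tendsto (fun x : ℝ => (x : ℂ)) (nhdsWithin 0 (Ioi 0)) (nhds 0) := by
    have : Tendsto (fun x : ℝ => (x : ℂ)) (nhds 0) (nhds ((0 : ℝ) : ℂ)) := Complex.continuous_ofReal.tendsto 0
    simpa using this.mono_left nhdsWithin_le_nhds
  have hlim : Tendsto (fun x : ℝ => h x) (nhdsWithin 0 (Ioi 0)) (nhds (h 0)) := ha.continuousAt.tendsto.comp hcast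
  have hsgn : ∀ᶠ x : ℝ in nhdsWithin 0 (Ioi 0), (h x).im = 0 ∧ (h x).re ≤ 0 := by
    filter_upwards [hcast.eventually hE, self_mem_nhdsWithin] with x hx x0
    have x0' : 0 < x := x0
    obtain ⟨q, hq, hq'⟩ := gE_real_neg hβ hD x0'
    have : h x = ((q / x ^ 3 : ℝ) : ℂ) := by
      have hx0 : (x : ℂ) ≠ 0 := by exact_mod_cast x0'.ne'
      push_cast
      rw [eq_div_iff (pow_ne_zero 3 hx0), ← hq', hx]; ring
    rw [this]
    refine ⟨by simp [-ofReal_div], ?_⟩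
    rw [ofReal_re]
    exact (div_neg_of_neg_of_pos hq (by positivity)).le
  have him : (h 0).im = 0 := by
    have := (Complex.continuous_im.tendsto _).comp hlim
    refine tendsto_nhds_unique this (tendsto_const_nhds.congr' ?_)
    filter_upwards [hsgn] with x hx using hx.1.symm
  have hre : (h 0).re ≤ 0 := by
    have := (Complex.continuous_re.tendsto _).comp hlim
    refine le_of_tendsto this ?_
    filter_upwards [hsgn] with x hx using hx.2
  have hre' : (h 0).re < 0 := lt_of_le_of_ne hre fun h' => hn (Complex.ext h' him)
  have hh : -h 0 = ((-(h 0).re : ℝ) : ℂ) := by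
    apply Complex.ext <;> simp [him]
  have hsl : -h 0 ∈ slitPlane := by rw [hh, Complex.ofReal_mem_slitPlane]; linarith
  set r : ℂ → ℂ := fun E => cexp (Complex.log (-h E) / 3) with hr
  have hra : AnalyticAt ℂ r 0 := by
    have h1 : AnalyticAt ℂ (fun E => Complex.log (-h E)) 0 := (ha.neg).clog hsl
    have h2 : AnalyticAt ℂ (fun E => Complex.log (-h E) / 3) 0 := by fun_prop
    exact h2.cexp
  set b : ℝ := Real.exp (Real.log (-(h 0).re) / 3) with hb
  have hr0 : r 0 = b := by
    simp only [hr, hb, hh]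
    rw [← Complex.ofReal_log (by linarith)]
    push_cast; rfl
  have hb0 : 0 < b := Real.exp_pos _
  set F : ℂ → ℂ := fun E => cexp (Real.pi * I / 3) * (E * r E) with hF
  have hFa : AnalyticAt ℂ F 0 := by fun_prop
  have hF0 : F 0 = 0 := by simp [hF]
  have hFd : deriv F 0 = cexp (Real.pi * I / 3) * b := by
    have h1 := (((hasDerivAt_id (0 : ℂ)).mul hra.differentiableAt.hasDerivAt)).const_mul (cexp (Real.pi * I / 3))
    have h2 : HasDerivAt F _ 0 := h1
    rw [h2.deriv, hr0]; simp
  have hFd0 : deriv F 0 ≠ 0 := by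
    rw [hFd]
    exact mul_ne_zero (Complex.exp_ne_zero _) (by exact_mod_cast hb0.ne')
  have hF3 : ∀ᶠ E in nhds 0, gE β E = F E ^ 3 := by
    filter_upwards [hE, ha.continuousAt.eventually_ne hn] with E h1 h2
    have e1 : cexp (Real.pi * I / 3) ^ 3 = -1 := by
      rw [← Complex.exp_nat_mul, show ((3 : ℕ) : ℂ) * (Real.pi * I / 3) = Real.pi * I by push_cast; ring, Complex.exp_pi_mul_I]
    have e2 : r E ^ 3 = - h E := by
      simp only [hr]
      rw [← Complex.exp_nat_mul, show ((3 : ℕ) : ℂ) * (Complex.log (-h E) / 3) = Complex.log (-h E) by push_cast; ring,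
        Complex.exp_log (neg_ne_zero.mpr h2)]
    simp only [hF]
    rw [mul_pow, mul_pow, e1, e2, h1]; ring
  have hst := hFa.hasStrictDerivAt
  set e : ℂ → ℂ := hst.localInverse F (deriv F 0) 0 hFd0 with he
  have hea : AnalyticAt ℂ e 0 := by
    have := hFa.analyticAt_localInverse hFd0
    rwa [hF0] at this
  have he0 : e 0 = 0 := by
    have := (hst.eventually_left_inverse hFd0).self_of_nhds
    rwa [hF0] at this
  have hed := (hst.to_localInverse hFd0).hasDerivAt
  rw [hF0] at hed
  have hri := hst.eventually_right_inverse hFd0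
  rw [hF0] at hri
  refine ⟨e, b⁻¹, inv_pos.mpr hb0, hea, he0, ?_, ?_⟩
  · rw [hed.deriv, hFd, Complex.exp_neg, mul_inv]; push_cast; ring
  · have t : Tendsto e (nhds 0) (nhds 0) := by
      have := hea.continuousAt.tendsto
      rwa [he0] at this
    filter_upwards [t.eventually hF3, hri] with p h1 h2
    rw [h1]
    exact congrArg (· ^ 3) h2

lemma comp_real {e : ℂ → ℂ} {p : ℝ} (h : AnalyticAt ℂ e p) :
    AnalyticAt ℝ (fun x : ℝ => e x) p ∧ deriv (fun x : ℝ => e x) p = deriv e p := by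
  constructor
  · exact (h.restrictScalars (𝕜 := ℝ)).comp (Complex.ofRealCLM.analyticAt p)
  · exact h.differentiableAt.hasDerivAt.comp_ofReal.deriv

lemma exp_third : cexp (-(Real.pi * I / 3)) = ((1 / 2 : ℝ) : ℂ) - ((Real.sqrt 3 / 2 : ℝ) : ℂ) * I := by
  rw [show (-(Real.pi * I / 3) : ℂ) = ((-(Real.pi / 3) : ℝ) : ℂ) * I by push_cast; ring, Complex.exp_mul_I,
    ← Complex.ofReal_cos, ← Complex.ofReal_sin, Real.cos_neg, Real.sin_neg, Real.cos_pi_div_three, Real.sin_pi_div_three]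
  push_cast; ring

lemma curve (hβ : 0 < β) (hD : Df β (Real.pi / 2) = 0) : ∃ (F : ℝ → ℂ) (a : ℝ), 0 < a ∧ AnalyticOnNhd ℝ F (Icc 0 1) ∧
    (∀ t ∈ Icc (0 : ℝ) 1, deriv F t ≠ 0) ∧ F 0 = 0 ∧ deriv F 0 = a * cexp (-(Real.pi * I / 3)) ∧
    ∀ p : ℝ, 0 < p → p ≤ 1 → (F p).im < 0 ∧ gE β (F p) = ((p ^ 3 : ℝ) : ℂ) := by
  have hex : ∀ p : ℝ, ∃ E : ℂ, 0 < p → p ≤ 1 → E.im < 0 ∧ gE β E = ((p ^ 3 : ℝ) : ℂ) := by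
    intro p
    by_cases h : 0 < p ∧ p ≤ 1
    · obtain ⟨E, h1, h2⟩ := lower_exists hβ hD (t := p ^ 3) (pow_pos h.1 3) (pow_le_one₀ h.1.le h.2)
      exact ⟨E, fun _ _ => ⟨h1, h2⟩⟩
    · exact ⟨0, fun h1 h2 => absurd ⟨h1, h2⟩ h⟩
  choose f0 hf0 using hex
  set f : ℝ → ℂ := fun p => if p = 0 then 0 else f0 p with hfd
  have hf : ∀ p : ℝ, 0 < p → p ≤ 1 → (f p).im < 0 ∧ gE β (f p) = ((p ^ 3 : ℝ) : ℂ) := by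
    intro p h1 h2
    simp only [hfd, if_neg h1.ne']
    exact hf0 p h1 h2
  have f00 : f 0 = 0 := by simp [hfd]
  obtain ⟨e, a, ha, hea, he0, hed, heg⟩ := germ_zero hβ hD
  obtain ⟨r1, r2⟩ := comp_real (p := 0) (by simpa using hea)
  simp only [ofReal_zero] at r2
  have hd0 : deriv (fun x : ℝ => e x) 0 ≠ 0 := by
    rw [r2, hed]
    exact mul_ne_zero (by exact_mod_cast ha.ne') (Complex.exp_ne_zero _)
  have hneg : ∀ᶠ p : ℝ in nhds 0, 0 < p → (e p).im < 0 := by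
    have h1 : HasDerivAt (fun x : ℝ => (e x).im) (a * (-(Real.sqrt 3 / 2))) 0 := by
      have h2 := r1.differentiableAt.hasDerivAt
      rw [r2, hed, exp_third] at h2
      have h3 := (Complex.imCLM.hasFDerivAt).comp_hasDerivAt (0 : ℝ) h2
      refine h3.congr_deriv ?_
      simp
    have h4 := (hasDerivAt_iff_tendsto_slope.mp h1).eventually (Iio_mem_nhds
      (show a * (-(Real.sqrt 3 / 2)) < 0 by
        have : 0 < Real.sqrt 3 := by positivity
        nlinarith [mul_pos ha this]))
    rw [eventually_nhdsWithin_iff] at h4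
    filter_upwards [h4] with p hp p0
    have h5 := hp (by simpa using p0.ne')
    simp only [slope_def_field, mem_Iio, ofReal_zero, he0, sub_zero, zero_im] at h5
    by_contra hc
    have : 0 ≤ (e p).im / p := div_nonneg (not_lt.mp hc) p0.le
    linarith
  have hg0 : ∀ᶠ p : ℝ in nhds 0, p ∈ Icc (0 : ℝ) 1 → e p = f p := by
    have t : Tendsto (fun x : ℝ => (x : ℂ)) (nhds 0) (nhds 0) := by
      simpa using Complex.continuous_ofReal.tendsto 0
    filter_upwards [t.eventually heg, hneg] with p h1 h2 hp
    by_cases p0 : p = 0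
    · rw [p0, f00, ofReal_zero, he0]
    have p0' : 0 < p := lt_of_le_of_ne hp.1 (Ne.symm p0)
    obtain ⟨h3, h4⟩ := hf p p0' hp.2
    exact lower_unique hβ (h2 p0') h3 (t := p ^ 3) (by positivity) (pow_le_one₀ hp.1 hp.2) (by rw [h1]; push_cast; rfl) h4
  obtain ⟨F, F1, F2, F3, F4⟩ := glue (f := f) (e0 := fun x : ℝ => e x) (by
    intro p0 hp0
    by_cases hz : p0 = 0
    · subst hz
      exact ⟨fun x : ℝ => e x, r1, hd0, hg0⟩
    have hpos : 0 < p0 := lt_of_le_of_ne hp0.1 (Ne.symm hz)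
    obtain ⟨h3, h4⟩ := hf p0 hpos hp0.2
    have hgd := lower_deriv hβ h3 (t := p0 ^ 3) (by positivity) (pow_le_one₀ hp0.1 hp0.2) h4
    have hst := (gE_analytic hβ (f p0)).hasStrictDerivAt
    have hra := (gE_analytic hβ (f p0)).analyticAt_localInverse hgd
    have hli := (hst.eventually_left_inverse hgd).self_of_nhds
    have hri := hst.eventually_right_inverse hgd
    have hrd := (hst.to_localInverse hgd).hasDerivAt
    revert hra hli hri hrd
    generalize hst.localInverse (gE β) (deriv (gE β) (f p0)) (f p0) hgd = r
    intro hra hli hri hrd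
    have hc : gE β (f p0) = (p0 : ℂ) ^ 3 := by rw [h4]; push_cast; rfl
    rw [hc] at hra hli hri hrd
    have hA : AnalyticAt ℂ (fun p : ℂ => r (p ^ 3)) (p0 : ℂ) :=
      hra.fun_comp_of_eq (by fun_prop) rfl
    obtain ⟨q1, q2⟩ := comp_real hA
    refine ⟨fun p : ℝ => r ((p : ℂ) ^ 3), q1, ?_, ?_⟩
    · rw [q2]
      have := hrd.comp (p0 : ℂ) (hasDerivAt_pow 3 (p0 : ℂ))
      have h5 : HasDerivAt (fun p : ℂ => r (p ^ 3)) _ (p0 : ℂ) := this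
      rw [h5.deriv]
      have : (p0 : ℂ) ≠ 0 := by exact_mod_cast hz
      simp [hgd, this]
    · have tc : Tendsto (fun p : ℝ => (p : ℂ) ^ 3) (nhds p0) (nhds ((p0 : ℂ) ^ 3)) :=
        Continuous.tendsto (by fun_prop) p0
      have ti : Tendsto (fun p : ℝ => (r ((p : ℂ) ^ 3)).im) (nhds p0) (nhds ((f p0).im)) := by
        have := (Complex.continuous_im.tendsto _).comp (hra.continuousAt.tendsto.comp tc)
        rwa [hli] at this
      filter_upwards [tc.eventually hri, ti.eventually (Iio_mem_nhds h3), Ioi_mem_nhds hpos] with p k1 k2 k3 k4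
      obtain ⟨h3', h4'⟩ := hf p k3 k4.2
      exact lower_unique hβ k2 h3' (t := p ^ 3) (pow_nonneg k4.1 3) (pow_le_one₀ k4.1 k4.2) (by rw [k1]; push_cast; rfl) h4')
    r1 hd0 hg0
  refine ⟨F, a, ha, F1, F2, ?_, ?_, ?_⟩
  · rw [F3 (by simp), f00]
  · rw [F4, r2, hed]
  · intro p h1 h2
    rw [F3 ⟨h1.le, h2⟩]
    exact hf p h1 h2

end

noncomputable section
variable {β : ℝ}

def SE (β : ℝ) : Set ℂ := {E | ∃ k ∉ Lam β, (Cf β k).re = 0 ∧ E = Df β k}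

lemma SE_conj (hβ : 0 < β) {E : ℂ} (h : E ∈ SE β) : (starRingEnd ℂ) E ∈ SE β := by
  obtain ⟨k, h1, h2, rfl⟩ := h
  exact ⟨(starRingEnd ℂ) k, by rwa [conj_mem_lam hβ], by rw [Cf_conj]; simpa using h2, by rw [Df_conj hβ]⟩

lemma SE_nonpos (hβ : 0 < β) (hD : Df β (Real.pi / 2) = 0) {x : ℝ} (hx : x ≤ 0) : (x : ℂ) ∈ SE β := by
  rcases hx.lt_or_eq with h | h
  · obtain ⟨y, a, b, c⟩ := imag_exists (E := x) hβ hβ le_rfl (by rw [Df_ibeta hβ, hD]; simpa using h)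
    exact ⟨y * I, imag_not_lam hβ a b.le, Cf_imag y, c.symm⟩
  · exact ⟨β * I, imag_not_lam hβ hβ le_rfl, Cf_imag β, by rw [Df_ibeta hβ, hD, h]; simp⟩

lemma SE_real (hβ : 0 < β) (hD : Df β (Real.pi / 2) = 0) {x : ℝ} (h : (x : ℂ) ∈ SE β) : x ≤ 0 := by
  by_contra hx
  push Not at hx
  obtain ⟨k, h1, h2, h3⟩ := h
  obtain ⟨y, y0, y1, hy⟩ := real_exists hβ (x := Real.pi / 2) (E := x) (by positivity) le_rfl (by
    rw [half_cast, hD]; simpa using hx)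
  have hl := real_not_lam hβ y0 (y1.le)
  have hc := cr_pos hβ hD y0 y1
  have := (Cf_re_fibre hβ h1 hl (by rw [hy, h3])).mp h2
  linarith

lemma SE_lower (hβ : 0 < β) {F : ℝ → ℂ}
    (hF : ∀ p : ℝ, 0 < p → p ≤ 1 → (F p).im < 0 ∧ gE β (F p) = ((p ^ 3 : ℝ) : ℂ)) {E : ℂ} (hE : E.im < 0)
    (h : E ∈ SE β) : ∃ p : ℝ, 0 < p ∧ p ≤ 1 ∧ F p = E := by
  obtain ⟨k, h1, h2, rfl⟩ := h
  obtain ⟨t, t0, t1, ht⟩ := lower_spec hβ h1 hE h2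
  set p : ℝ := t ^ ((1 : ℝ) / 3) with hp
  have p0 : 0 < p := Real.rpow_pos_of_pos t0 _
  have p1 : p ≤ 1 := Real.rpow_le_one t0.le t1 (by norm_num)
  have p3 : p ^ 3 = t := by
    rw [hp, ← Real.rpow_natCast, ← Real.rpow_mul t0.le]; norm_num
  obtain ⟨a, b⟩ := hF p p0 p1
  rw [p3] at b
  exact ⟨p, p0, p1, lower_unique hβ a hE t0.le t1 b ht⟩

lemma SE_lower' (hβ : 0 < β) {E : ℂ} (hE : E.im < 0) {t : ℝ} (h0 : 0 ≤ t) (h1 : t ≤ 1) (h : gE β E = t) :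
    E ∈ SE β := by
  obtain ⟨v, hv, he, hr⟩ := lower_rep hβ hE h0 h1 h
  exact ⟨v, rect_not_lam hβ hv, hr, he.symm⟩

lemma e_two : cexp (2 * Real.pi * I / 3) = -((1 / 2 : ℝ) : ℂ) + ((Real.sqrt 3 / 2 : ℝ) : ℂ) * I := by
  have h : cexp (2 * Real.pi * I / 3) = -cexp (-(Real.pi * I / 3)) := by
    rw [show (2 * Real.pi * I / 3 : ℂ) = -(Real.pi * I / 3) + Real.pi * I by ring, Complex.exp_add, Complex.exp_pi_mul_I]; ring
  rw [h, exp_third]; ring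

lemma e_sq : cexp (2 * Real.pi * I / 3) * cexp (2 * Real.pi * I / 3) = cexp (4 * Real.pi * I / 3) := by
  rw [← Complex.exp_add]; congr 1; ring

lemma e_cube : cexp (2 * Real.pi * I / 3) * cexp (4 * Real.pi * I / 3) = 1 := by
  rw [← Complex.exp_add, show (2 * Real.pi * I / 3 + 4 * Real.pi * I / 3 : ℂ) = 2 * Real.pi * I by ring, Complex.exp_two_pi_mul_I]

lemma sqrt3_sq : ((Real.sqrt 3 : ℝ) : ℂ) ^ 2 = 3 := by
  rw [← Complex.ofReal_pow, Real.sq_sqrt (by norm_num)]; norm_num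

lemma e_four : cexp (4 * Real.pi * I / 3) = -((1 / 2 : ℝ) : ℂ) - ((Real.sqrt 3 / 2 : ℝ) : ℂ) * I := by
  rw [← e_sq, e_two]
  push_cast
  linear_combination (((Real.sqrt 3 : ℝ) : ℂ) ^ 2 / 4) * I_sq - (1 / 4 : ℂ) * sqrt3_sq

lemma part_two (W : WeierstrassData) (hW : W.IsRhombic) (h : W.Z W.w1 + W.w1 * W.e1 = 0) (z0 : ℂ)
    (hz : ∀ x : ℝ, W.w1 * x + z0 ∉ W.lattice) : W.HasTripodSpectrum W.w1 z0 := by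
  obtain ⟨s, β, hs, hβ, h1, h3, hlat, hP, hZ⟩ := transfer W hW
  have hpi := Real.pi_pos
  have hD : Df β (Real.pi / 2) = 0 := by
    have t1 := (transfer' W hs hβ h1 hP hZ (half_not_lam hβ)).1
    rw [← h1] at t1
    change W.Z W.w1 + W.w1 * W.e1 = _ at t1
    rw [h] at t1
    have hc : ((Real.pi / (2 * s) : ℝ) : ℂ) ≠ 0 := by
      have : Real.pi / (2 * s) ≠ 0 := by positivity
      exact_mod_cast this
    exact (mul_eq_zero.mp t1.symm).resolve_left hc
  obtain ⟨F, a, ha, F1, F2, F0, Fd, Fp⟩ := curve hβ hD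
  set m : ℝ := Real.pi ^ 2 / 4 with hm
  have m0 : 0 < m := by positivity
  have mC : (m : ℂ) ≠ 0 := by exact_mod_cast m0.ne'
  set c : ℂ := m * kap β with hc
  have hspec : W.lameSpectrum 1 W.w1 z0 = (fun E : ℂ => c - m * E) '' SE β := by
    rw [spec_eq hβ W hs h1 hlat hP z0 hz]
    ext x
    constructor
    · rintro ⟨k, k1, k2, rfl⟩
      refine ⟨Df β k, ⟨k, k1, k2, rfl⟩, ?_⟩
      simp only [hc, hm]; push_cast; ring
    · rintro ⟨E, ⟨k, k1, k2, rfl⟩, rfl⟩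
      refine ⟨k, k1, k2, ?_⟩
      simp only [hc, hm]; push_cast; ring
  set T : ℂ → ℂ := fun E : ℂ => c - m * E with hT
  have Tinj : Function.Injective T := by
    intro x y hxy
    simp only [hT] at hxy
    exact mul_left_cancel₀ mC (sub_right_injective hxy)
  set K : ℝ → ℂ := fun p => (starRingEnd ℂ) (F p) with hK
  set R : ℝ → ℂ := fun t => ((-(t / m) : ℝ) : ℂ) with hR
  have Fim : ∀ p ∈ Icc (0 : ℝ) 1, (F p).im ≤ 0 ∧ ((F p).im = 0 → F p = 0) := by
    intro p hp
    by_cases p0 : p = 0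
    · rw [p0, F0]; simp
    · have := (Fp p (lt_of_le_of_ne hp.1 (Ne.symm p0)) hp.2).1
      exact ⟨this.le, fun h => absurd h this.ne⟩
  have Finj : InjOn F (Icc 0 1) := by
    have hg : ∀ p ∈ Icc (0 : ℝ) 1, gE β (F p) = ((p ^ 3 : ℝ) : ℂ) := by
      intro p hp
      by_cases p0 : p = 0
      · rw [p0, F0]
        have h := gE_Df hβ (half_not_lam hβ)
        rw [hD] at h
        rw [h, Gf, Cf_half]; simp
      · exact (Fp p (lt_of_le_of_ne hp.1 (Ne.symm p0)) hp.2).2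
    intro p hp q hq hpq
    have e := hg p hp
    rw [hpq, hg q hq] at e
    have e' : q ^ 3 = p ^ 3 := by exact_mod_cast e
    exact ((pow_left_inj₀ hq.1 hp.1 (by norm_num)).mp e').symm
  have Tder : ∀ (G : ℝ → ℂ) (t : ℝ), DifferentiableAt ℝ G t → deriv (fun p => T (G p)) t = -(m * deriv G t) := by
    intro G t hG
    have := (hG.hasDerivAt.const_mul (m : ℂ)).const_sub c
    exact this.deriv
  have Tan : ∀ (G : ℝ → ℂ) (t : ℝ), AnalyticAt ℝ G t → AnalyticAt ℝ (fun p => T (G p)) t := by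
    intro G t hG
    exact analyticAt_const.sub (analyticAt_const.mul hG)
  have Kan : AnalyticOnNhd ℝ K (Icc 0 1) := fun t ht =>
    (Complex.conjCLE.toContinuousLinearMap.analyticAt (F t)).comp (F1 t ht)
  have Kder : ∀ t ∈ Icc (0 : ℝ) 1, deriv K t = (starRingEnd ℂ) (deriv F t) := by
    intro t ht
    have := (Complex.conjCLE.toContinuousLinearMap.hasFDerivAt (x := F t)).comp_hasDerivAt t (F1 t ht).differentiableAt.hasDerivAt
    exact this.deriv
  have Rder : ∀ t : ℝ, HasDerivAt R ((-(1 / m) : ℝ) : ℂ) t := by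
    intro t
    exact (((hasDerivAt_id t).div_const m).neg).ofReal_comp
  have Ran : ∀ t : ℝ, AnalyticAt ℝ R t := by
    intro t
    have h1 : AnalyticAt ℝ (fun t : ℝ => -(t / m)) t := by
      have : AnalyticAt ℝ (fun t : ℝ => t / m) t := analyticAt_id.div analyticAt_const m0.ne'
      exact this.neg
    exact (Complex.ofRealCLM.analyticAt _).comp h1
  have ic : ∀ {A B : ℝ → ℂ} {s t : Set ℝ}, (A '' s ∩ B '' t = {0}) → ((fun p => T (A p)) '' s ∩ (fun p => T (B p)) '' t = {c}) := by
    intro A B s t hAB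
    rw [← image_image T A s, ← image_image T B t, ← image_inter Tinj, hAB, image_singleton]
    simp [hT]
  have FK : F '' Icc 0 1 ∩ K '' Icc 0 1 = {0} := by
    ext E
    constructor
    · rintro ⟨⟨p, hp, rfl⟩, ⟨q, hq, hpq⟩⟩
      have a1 := Fim p hp
      have a2 := Fim q hq
      have e := congrArg Complex.im hpq
      simp only [hK, conj_im] at e
      exact a1.2 (by linarith [a1.1, a2.1])
    · rintro rfl
      exact ⟨⟨0, by simp, F0⟩, ⟨0, by simp, by simp [hK, F0]⟩⟩
  have FR : F '' Icc 0 1 ∩ R '' Ici 0 = {0} := by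
    ext E
    constructor
    · rintro ⟨⟨p, hp, rfl⟩, ⟨q, hq, hpq⟩⟩
      have e := congrArg Complex.im hpq
      simp only [hR, ofReal_im] at e
      exact (Fim p hp).2 e.symm
    · rintro rfl
      exact ⟨⟨0, by simp, F0⟩, ⟨0, by simp, by simp [hR]⟩⟩
  have KR : K '' Icc 0 1 ∩ R '' Ici 0 = {0} := by
    ext E
    constructor
    · rintro ⟨⟨p, hp, rfl⟩, ⟨q, hq, hpq⟩⟩
      have e := congrArg Complex.im hpq
      simp only [hR, ofReal_im, hK, conj_im] at e
      have := (Fim p hp).2 (by linarith)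
      simp [hK, this]
    · rintro rfl
      exact ⟨⟨0, by simp, by simp [hK, F0]⟩, ⟨0, by simp, by simp [hR]⟩⟩
  have hSE : SE β = F '' Icc 0 1 ∪ K '' Icc 0 1 ∪ R '' Ici 0 := by
    have z0S : (0 : ℂ) ∈ SE β := by simpa using SE_nonpos hβ hD (x := 0) le_rfl
    have FS : ∀ p ∈ Icc (0 : ℝ) 1, F p ∈ SE β := by
      intro p hp
      by_cases p0 : p = 0
      · rw [p0, F0]; exact z0S
      · obtain ⟨i1, i2⟩ := Fp p (lt_of_le_of_ne hp.1 (Ne.symm p0)) hp.2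
        exact SE_lower' hβ i1 (pow_nonneg hp.1 3) (pow_le_one₀ hp.1 hp.2) i2
    ext E
    constructor
    · intro hE
      rcases lt_trichotomy E.im 0 with hi | hi | hi
      · obtain ⟨p, p0, p1, hp⟩ := SE_lower hβ Fp hi hE
        exact Or.inl (Or.inl ⟨p, ⟨p0.le, p1⟩, hp⟩)
      · have hE' : E = ((E.re : ℝ) : ℂ) := Complex.ext (by simp) (by simp [hi])
        rw [hE'] at hE
        have := SE_real hβ hD hE
        refine Or.inr ⟨-(m * E.re), ?_, ?_⟩
        · simp only [mem_Ici]; nlinarith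
        · simp only [hR]
          rw [show -(-(m * E.re) / m) = E.re by field_simp]; exact hE'.symm
      · obtain ⟨p, p0, p1, hp⟩ := SE_lower hβ Fp (E := (starRingEnd ℂ) E) (by simpa using hi) (SE_conj hβ hE)
        exact Or.inl (Or.inr ⟨p, ⟨p0.le, p1⟩, by simp [hK, hp]⟩)
    · rintro ((⟨p, hp, rfl⟩ | ⟨p, hp, rfl⟩) | ⟨t, ht, rfl⟩)
      · exact FS p hp
      · exact SE_conj hβ (FS p hp)
      · exact SE_nonpos hβ hD (by
          have : 0 ≤ t / m := div_nonneg ht m0.le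
          linarith)
  have bdd : ∀ G : ℝ → ℂ, AnalyticOnNhd ℝ G (Icc 0 1) → Bornology.IsBounded ((fun p => T (G p)) '' Icc 0 1) := by
    intro G hG
    apply IsCompact.isBounded
    apply isCompact_Icc.image_of_continuousOn
    exact fun t ht => (Tan G t (hG t ht)).continuousAt.continuousWithinAt
  have R0 : R 0 = 0 := by simp [hR]
  have K0 : K 0 = 0 := by simp [hK, F0]
  have T0 : T 0 = c := by simp [hT]
  have zI : (0 : ℝ) ∈ Icc (0 : ℝ) 1 := by simp
  refine ⟨c, fun p => T (F p), fun p => T (K p), fun p => T (R p), 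
    fun t ht => Tan F t (F1 t ht), ?_, ?_, fun t ht => Tan K t (Kan t ht), ?_, ?_, fun t _ => Tan R t (Ran t), ?_, ?_,
    ?_, ?_, ?_, ?_, ic FK, ic FR, ic KR, ?_, bdd F F1, bdd K Kan, ?_⟩
  · intro t ht
    rw [Tder F t (F1 t ht).differentiableAt]
    exact neg_ne_zero.mpr (mul_ne_zero mC (F2 t ht))
  · exact fun p hp q hq hpq => Finj hp hq (Tinj hpq)
  · intro t ht
    rw [Tder K t (Kan t ht).differentiableAt, Kder t ht]
    exact neg_ne_zero.mpr (mul_ne_zero mC (by simpa using F2 t ht))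
  · exact fun p hp q hq hpq => Finj hp hq ((starRingEnd ℂ).injective (Tinj hpq))
  · intro t ht
    rw [Tder R t (Ran t).differentiableAt, (Rder t).deriv]
    refine neg_ne_zero.mpr (mul_ne_zero mC ?_)
    have : -(1 / m) ≠ 0 := by simp [m0.ne']
    exact_mod_cast this
  · intro p hp q hq hpq
    have e : -(p / m) = -(q / m) := by
      have := Tinj hpq
      simp only [hR] at this
      exact_mod_cast this
    field_simp at e
    linarith
  · change T (F 0) = c; rw [F0, T0]
  · change T (K 0) = c; rw [K0, T0]
  · change T (R 0) = c; rw [R0, T0]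
  · rw [hspec, hSE, image_union, image_union, image_image, image_image, image_image]
  · have e : ∀ t : ℝ, T (R t) = c + t := by
      intro t
      simp only [hT, hR]
      push_cast
      field_simp
      ring
    have l : Tendsto (fun t : ℝ => t - ‖c‖) atTop atTop := tendsto_atTop_add_const_right _ _ tendsto_id
    refine tendsto_atTop_mono (fun t => ?_) l
    change t - ‖c‖ ≤ ‖T (R t)‖
    rw [e]
    have h1 : ‖(t : ℂ)‖ ≤ ‖c + t‖ + ‖c‖ := by
      calc ‖(t : ℂ)‖ = ‖(c + t) - c‖ := by congr 1; ring
        _ ≤ _ := norm_sub_le _ _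
    have h2 : t ≤ ‖(t : ℂ)‖ := by rw [Complex.norm_real]; exact Real.le_norm_self t
    linarith
  · refine ⟨cexp (2 * Real.pi * I / 3), Complex.exp_ne_zero _, m * a, m * a, 1, by positivity, by positivity, one_pos, ?_, ?_, ?_⟩
    · rw [Tder F 0 (F1 0 zI).differentiableAt, Fd, exp_third, e_two]
      push_cast; ring
    · rw [Tder K 0 (Kan 0 zI).differentiableAt, Kder 0 zI, Fd, exp_third, e_sq, e_four]
      simp only [map_mul, map_sub, conj_ofReal, conj_I]
      push_cast; ring
    · rw [Tder R 0 (Ran 0).differentiableAt, (Rder 0).deriv, e_cube]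
      push_cast
      field_simp

end

/-- Among rhombic lattices there is, up to scaling, exactly
one exceptional elliptic curve `𝓔*` for which the non-degeneracy conditions
`η₁ + ω₁eⱼ ≠ 0` are violated; it is uniquely determined by `η₁ + ω₁e₁ = 0`.
For this curve the spectrum of the `m = 1` complex Lamé operator with `ω = ω₁`
has a tripod structure (three simple regular analytic arcs joined at one point
at angles `2π/3`); the same curve is the bifurcation point of the
non-singularity condition, separating the rhombic cases with intersecting and
non-intersecting spectral arcs. -/
theorem exceptional_rhombic_curve :
    -- existence and uniqueness (up to scaling, i.e. up to the j-invariant)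
    (∃ Wst : WeierstrassData, Wst.IsRhombic ∧
      Wst.Z Wst.w1 + Wst.w1 * Wst.e1 = 0 ∧
      ∀ W : WeierstrassData, W.IsRhombic →
        (W.Z W.w1 + W.w1 * W.e1 = 0 ∨ W.Z W.w1 + W.w1 * W.e2 = 0 ∨
          W.Z W.w1 + W.w1 * W.e3 = 0) →
        (W.Z W.w1 + W.w1 * W.e1 = 0 ∧ W.jInv = Wst.jInv)) ∧
    -- the exceptional curve has a tripod spectrum
    (∀ W : WeierstrassData, W.IsRhombic → W.Z W.w1 + W.w1 * W.e1 = 0 →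
      ∀ z0 : ℂ, (∀ x : ℝ, W.w1 * x + z0 ∉ W.lattice) →
        W.HasTripodSpectrum W.w1 z0) ∧
    -- bifurcation of the non-singularity condition at the exceptional curve:
    -- for rhombic lattices, `η₁ + ω₁e₁` is real and the non-singularity
    -- condition `u(k*) ≠ 0` holds if and only if `η₁ + ω₁e₁ < 0`
    (∀ W : WeierstrassData, W.IsRhombic →
      (W.Z W.w1 + W.w1 * W.e1).im = 0 ∧
      ((∀ k : ℂ, k ∉ W.lattice → W.Z W.w1 + W.w1 * W.P k = 0 → W.uFun W.w1 k ≠ 0)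
        ↔ (W.Z W.w1 + W.w1 * W.e1).re < 0)) := by
  exact ⟨part_one, fun W hW h z0 hz => part_two W hW h z0 hz, fun W hW => part_three W hW⟩
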